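/- Let K ≥ 0 and h₁ ∈ (−1,1), and let (v,h) be a classical solution of the fluid–particle system on [0,∞). Then for every t ≥ 0 the energy identity holds: ∫_{−1}^{1} v(t,y)² dy + g(t)² + K(h(t)−h₁)² + 2∫_{0}^{t}∫_{−1}^{1} v_y(σ,y)² dy dσ = ∫_{−1}^{1} v₀(y)² dy + g₀² + K(h₀−h₁)². -/

import Mathlib

open Real Set MeasureTheory Filter

/-- A classical solution of the simplified fluid–particle interaction system on `[0,∞)`,
with feedback constant `K ≥ 0` and target position `h₁ ∈ (-1,1)`.
`v t y` is the fluid velocity, `h t` the particle position; `vt`, `vy`, `vyy` are the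
time derivative, the spatial derivative (for `y ≠ h t`) and the second spatial derivative
of `v`, while `vyL t`, `vyR t` are the one-sided spatial derivatives of `v t` at `y = h t`. -/
structure FluidParticleSol (K h₁ : ℝ) where
  v : ℝ → ℝ → ℝ
  h : ℝ → ℝ
  vt : ℝ → ℝ → ℝ
  vy : ℝ → ℝ → ℝ
  vyy : ℝ → ℝ → ℝ
  vyL : ℝ → ℝ
  vyR : ℝ → ℝ
  hK : 0 ≤ K
  hh₁ : h₁ ∈ Set.Ioo (-1 : ℝ) 1
  h_in : ∀ t, 0 ≤ t → h t ∈ Set.Ioo (-1 : ℝ) 1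
  h_C2 : ContDiff ℝ 2 h
  v_cont : ContinuousOn (fun p : ℝ × ℝ => v p.1 p.2) (Set.Ici 0 ×ˢ Set.Icc (-1) 1)
  hasDeriv_t : ∀ t, 0 ≤ t → ∀ y ∈ Set.Icc (-1 : ℝ) 1, HasDerivAt (fun s => v s y) (vt t y) t
  vt_cont : ∀ y ∈ Set.Icc (-1 : ℝ) 1, ContinuousOn (fun t => vt t y) (Set.Ici 0)
  hasDeriv_y : ∀ t, 0 ≤ t → ∀ y ∈ Set.Ioo (-1 : ℝ) 1, y ≠ h t →
      HasDerivAt (fun x => v t x) (vy t y) y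
  hasDeriv_yL : ∀ t, 0 ≤ t → HasDerivWithinAt (fun x => v t x) (vyL t) (Set.Iic (h t)) (h t)
  hasDeriv_yR : ∀ t, 0 ≤ t → HasDerivWithinAt (fun x => v t x) (vyR t) (Set.Ici (h t)) (h t)
  vy_contL : ∀ t, 0 ≤ t → ContinuousOn (fun y => vy t y) (Set.Ico (-1) (h t))
  vy_contR : ∀ t, 0 ≤ t → ContinuousOn (fun y => vy t y) (Set.Ioc (h t) 1)
  vy_limL : ∀ t, 0 ≤ t →
      Filter.Tendsto (fun y => vy t y) (nhdsWithin (h t) (Set.Iio (h t))) (nhds (vyL t))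
  vy_limR : ∀ t, 0 ≤ t →
      Filter.Tendsto (fun y => vy t y) (nhdsWithin (h t) (Set.Ioi (h t))) (nhds (vyR t))
  hasDeriv_yy : ∀ t, 0 ≤ t → ∀ y ∈ Set.Ioo (-1 : ℝ) 1, y ≠ h t →
      HasDerivAt (fun x => vy t x) (vyy t y) y
  pde : ∀ t, 0 ≤ t → ∀ y ∈ Set.Ioo (-1 : ℝ) 1, y ≠ h t →
      vt t y + v t y * vy t y = vyy t y
  bc_left : ∀ t, 0 ≤ t → v t (-1) = 0
  bc_right : ∀ t, 0 ≤ t → v t 1 = 0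
  ode1 : ∀ t, 0 ≤ t → deriv h t = v t (h t)
  ode2 : ∀ t, 0 ≤ t → deriv (deriv h) t = vyR t - vyL t + K * (h₁ - h t)

open scoped Topology

theorem secondDeriv_nonpos_of_isLocalMax {F F' : ℝ → ℝ} {y m : ℝ} (hmax : IsLocalMax F y)
    (hF : ∀ᶠ x in 𝓝 y, HasDerivAt F (F' x) x) (hF' : HasDerivAt F' m y) : m ≤ 0 := by
  by_contra! hm
  have hd : deriv F =ᶠ[𝓝 y] F' := hF.mono fun x hx => hx.deriv
  have hdd : deriv (deriv F) y = m := by rw [hd.deriv_eq]; exact hF'.deriv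
  have hmin := isLocalMin_of_deriv_deriv_pos (f := F) (x₀ := y) (by rw [hdd]; exact hm)
    hmax.deriv_eq_zero hF.self_of_nhds.continuousAt
  have hc : F =ᶠ[𝓝 y] fun _ => F y := by
    filter_upwards [hmax, hmin] with x h1 h2 using le_antisymm h1 h2
  have h0 : deriv F =ᶠ[𝓝 y] fun _ => 0 := by
    filter_upwards [hc.eventuallyEq_nhds] with x hx
    rw [hx.deriv_eq]; simp
  rw [h0.deriv_eq] at hdd
  simp at hdd
  linarith

/-- A continuous function whose symmetric second differences are asymptotically nonnegative
is convex. -/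
theorem convexOn_Icc_of_frequently_second_difference {F : ℝ → ℝ} {a b : ℝ}
    (hF : ContinuousOn F (Icc a b))
    (H : ∀ y ∈ Ioo a b, ∀ ε > 0, ∃ᶠ r in 𝓝[>] (0 : ℝ),
      -ε * r ^ 2 ≤ F (y + r) + F (y - r) - 2 * F y) : ConvexOn ℝ (Icc a b) F := by
  refine ⟨convex_Icc a b, ?_⟩
  intro x hx z hz α β hα hβ hαβ
  wlog hxz : x ≤ z generalizing x z α β
  · have := this hz hx hβ hα (by linarith) (by linarith)
    rw [add_comm, add_comm (α • F x)]; exact this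
  by_contra! hlt
  simp only [smul_eq_mul] at hlt
  set y := α * x + β * z with hy
  have hα0 : α ≠ 0 := by
    rintro rfl
    have : β = 1 := by linarith
    subst this; simp [hy] at hlt
  have hβ0 : β ≠ 0 := by
    rintro rfl
    have : α = 1 := by linarith
    subst this; simp [hy] at hlt
  have hα' : 0 < α := lt_of_le_of_ne hα hα0.symm
  have hβ' : 0 < β := lt_of_le_of_ne hβ hβ0.symm
  have hα1 : α = 1 - β := by linarith
  have hne : x ≠ z := by
    rintro rfl
    have : y = x := by rw [hy, hα1]; ring
    rw [this, hα1] at hlt; linarith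
  have hxz' : x < z := lt_of_le_of_ne hxz hne
  set κ := (F y - (α * F x + β * F z)) / (α * β * (z - x) ^ 2) / 2 with hκ
  have hden : 0 < α * β * (z - x) ^ 2 := by
    have : 0 < z - x := by linarith
    positivity
  have hκ0 : 0 < κ := by
    rw [hκ]; have : 0 < F y - (α * F x + β * F z) := by linarith
    positivity
  set u : ℝ → ℝ := fun w => F w - (F x + (F z - F x) / (z - x) * (w - x))
    - κ * ((w - x) * (z - w)) with hu
  have hsub : Icc x z ⊆ Icc a b := Icc_subset_Icc hx.1 hz.2
  have hucont : ContinuousOn u (Icc x z) := by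
    have := hF.mono hsub
    simp only [hu]
    fun_prop
  have hyI : y ∈ Icc x z := by
    constructor <;> rw [hy, hα1] <;> nlinarith
  obtain ⟨w, hw, hmax⟩ := isCompact_Icc.exists_isMaxOn ⟨x, left_mem_Icc.2 hxz⟩ hucont
  have hzx : z - x ≠ 0 := by linarith
  have huy : 0 < u y := by
    have e1 : y - x = β * (z - x) := by rw [hy, hα1]; ring
    have e2 : z - y = α * (z - x) := by rw [hy, hα1]; ring
    have e3 : (F z - F x) / (z - x) * (y - x) = β * (F z - F x) := by
      rw [e1]; field_simp
    have e4 : κ * ((y - x) * (z - y)) = (F y - (α * F x + β * F z)) / 2 := by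
      rw [e1, e2, hκ]
      have : β * (z - x) * (α * (z - x)) = α * β * (z - x) ^ 2 := by ring
      rw [this]; field_simp
    simp only [hu]
    rw [e3, e4]
    rw [hα1] at hlt ⊢
    linarith
  have huw : 0 < u w := lt_of_lt_of_le huy (hmax hyI)
  have hwx : w ≠ x := by
    rintro rfl; simp [hu] at huw
  have hwz : w ≠ z := by
    rintro rfl
    simp only [hu] at huw
    rw [div_mul_cancel₀ _ hzx] at huw
    linarith
  have hw1 : x < w := lt_of_le_of_ne hw.1 (Ne.symm hwx)
  have hw2 : w < z := lt_of_le_of_ne hw.2 hwz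
  have hfr := H w ⟨lt_of_le_of_lt hx.1 hw1, lt_of_lt_of_le hw2 hz.2⟩ κ hκ0
  have hev : ∀ᶠ r in 𝓝[>] (0 : ℝ), r ∈ Ioo 0 (min (w - x) (z - w)) :=
    Ioo_mem_nhdsGT (lt_min (by linarith) (by linarith))
  obtain ⟨r, hr, hr0, hr1⟩ := (hfr.and_eventually hev).exists
  have h1 := lt_of_lt_of_le hr1 (min_le_left _ _)
  have h2 := lt_of_lt_of_le hr1 (min_le_right _ _)
  have m1 : u (w + r) ≤ u w := hmax ⟨by linarith, by linarith⟩
  have m2 : u (w - r) ≤ u w := hmax ⟨by linarith, by linarith⟩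
  simp only [hu] at m1 m2
  have : 0 < κ * r ^ 2 := by positivity
  nlinarith

/-- A lower semicontinuity property of integrals along a sequence bounded below. -/
theorem eventually_integral_ge_of_liminf_ge {q : ℕ → ℝ → ℝ} {P : ℝ → ℝ} {s t C : ℝ} (hst : s ≤ t)
    (hq : ∀ n, IntervalIntegrable (q n) volume s t) (hP : IntervalIntegrable P volume s t)
    (hC : ∀ n, ∀ x ∈ Icc s t, C ≤ q n x)
    (hlim : ∀ᵐ x, x ∈ Set.uIoc s t → ∀ δ > 0, ∀ᶠ n in atTop, P x - δ ≤ q n x) {δ : ℝ} (hδ : 0 < δ) :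
    ∀ᶠ n in atTop, (∫ x in s..t, P x) - δ ≤ ∫ x in s..t, q n x := by
  have hintg : ∀ n, IntervalIntegrable (fun x => min (q n x) (P x)) volume s t := by
    intro n
    have e : (fun x => min (q n x) (P x)) = fun x => ((q n x + P x) - |q n x - P x|) / 2 := by
      funext x; rw [min_def]; split_ifs with h
      · rw [abs_of_nonpos (by linarith)]; ring
      · rw [abs_of_nonneg (by linarith)]; ring
    rw [e]
    exact (((hq n).add hP).sub ((hq n).sub hP).abs).div_const 2
  have hT : Tendsto (fun n => ∫ x in s..t, min (q n x) (P x)) atTop (𝓝 (∫ x in s..t, P x)) := by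
    refine intervalIntegral.tendsto_integral_filter_of_dominated_convergence
      (fun x => |C| + |P x|) ?_ ?_ ?_ ?_
    · exact Eventually.of_forall fun n => (hintg n).def'.aestronglyMeasurable
    · refine Eventually.of_forall fun n => Eventually.of_forall fun x hx => ?_
      have hx' : x ∈ Icc s t := by
        rw [uIoc_of_le hst] at hx; exact Ioc_subset_Icc_self hx
      have h1 := hC n x hx'
      rw [Real.norm_eq_abs, abs_le]
      constructor
      · rcases min_cases (q n x) (P x) with h | h <;> rw [h.1]
        · linarith [neg_abs_le C, abs_nonneg (P x)]
        · linarith [neg_abs_le (P x), abs_nonneg C]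
      · linarith [min_le_right (q n x) (P x), le_abs_self (P x), abs_nonneg C]
    · exact (intervalIntegrable_const).add hP.abs
    · filter_upwards [hlim] with x hx hxs
      rw [Metric.tendsto_atTop]
      intro ε hε
      obtain ⟨N, hN⟩ := eventually_atTop.1 (hx hxs (ε / 2) (by positivity))
      refine ⟨N, fun n hn => ?_⟩
      have := hN n hn
      rw [Real.dist_eq, abs_lt]
      rcases min_cases (q n x) (P x) with h | h <;> rw [h.1] <;> constructor <;> linarith
  filter_upwards [hT.eventually (lt_mem_nhds (show (∫ x in s..t, P x) - δ < ∫ x in s..t, P x by linarith))] with n hn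
  refine hn.le.trans (intervalIntegral.integral_mono_on hst (hintg n) (hq n) fun x _ => min_le_left _ _)

/-- Second-order Taylor expansion at a point of twice differentiability. -/
theorem eventually_abs_taylor_two_le {u u' : ℝ → ℝ} {y m : ℝ}
    (hu : ∀ᶠ x in 𝓝 y, HasDerivAt u (u' x) x) (hu' : HasDerivAt u' m y) {ε : ℝ} (hε : 0 < ε) :
    ∀ᶠ x in 𝓝 (0 : ℝ), |u (y + x) - u y - u' y * x - m * x ^ 2 / 2| ≤ ε * x ^ 2 := by
  have h1 : ∀ᶠ x in 𝓝 y, |u' x - u' y - m * (x - y)| ≤ ε * |x - y| := by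
    have := (hasDerivAt_iff_isLittleO.1 hu').def hε
    filter_upwards [this] with x hx
    simpa [Real.norm_eq_abs, mul_comm] using hx
  obtain ⟨d, hd, hball⟩ := Metric.eventually_nhds_iff.1 (hu.and h1)
  refine Metric.eventually_nhds_iff.2 ⟨d, hd, fun x hx => ?_⟩
  rw [Real.dist_eq, sub_zero] at hx
  set R : ℝ → ℝ := fun z => u (y + z) - u y - u' y * z - m * z ^ 2 / 2 with hR
  have hder : ∀ z ∈ Icc (-|x|) |x|, HasDerivWithinAt R (u' (y + z) - u' y - m * z)
      (Icc (-|x|) |x|) z := by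
    intro z hz
    have hz' : |z| < d := lt_of_le_of_lt (abs_le.2 hz) hx
    have h2 := (hball (y := y + z) (by simpa [Real.dist_eq] using hz')).1
    have h3 : HasDerivAt (fun z => u (y + z)) (u' (y + z)) z := by
      simpa using h2.comp_const_add y z
    have h4 := ((h3.sub_const (u y)).sub ((hasDerivAt_id z).const_mul (u' y))).sub
      (((hasDerivAt_pow 2 z).const_mul m).div_const 2)
    refine (h4.congr_deriv ?_).hasDerivWithinAt
    simp; ring
  have hbd : ∀ z ∈ Icc (-|x|) |x|, ‖u' (y + z) - u' y - m * z‖ ≤ ε * |x| := by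
    intro z hz
    have hz' : |z| < d := lt_of_le_of_lt (abs_le.2 hz) hx
    have h2 := (hball (y := y + z) (by simpa [Real.dist_eq] using hz')).2
    rw [add_sub_cancel_left] at h2
    exact h2.trans (mul_le_mul_of_nonneg_left (abs_le.2 hz) hε.le)
  have := (convex_Icc (-|x|) |x|).norm_image_sub_le_of_norm_hasDerivWithin_le hder hbd
    (x := 0) (y := x) ⟨by simp, by simp⟩ ⟨neg_abs_le x, le_abs_self x⟩
  simp only [hR, Real.norm_eq_abs] at this
  simp only [add_zero, mul_zero, sub_self, sub_zero] at this
  norm_num at this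
  calc _ ≤ _ := this
    _ = ε * x ^ 2 := by rw [mul_assoc, ← abs_mul, ← sq, abs_of_nonneg (sq_nonneg x)]

/-- Second differences of the primitive of `f ^ 2 / 2`. -/
theorem second_difference_primitive {f : ℝ → ℝ} (hf : Continuous f) (a y r : ℝ) :
    (∫ x in a..(y + r), f x ^ 2 / 2) + (∫ x in a..(y - r), f x ^ 2 / 2)
      - 2 * (∫ x in a..y, f x ^ 2 / 2)
    = ∫ x in (0 : ℝ)..r, (f (y + x) ^ 2 - f (y - x) ^ 2) / 2 := by
  have hc : Continuous fun x => f x ^ 2 / 2 := by fun_prop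
  have hi : ∀ p q, IntervalIntegrable (fun x => f x ^ 2 / 2) volume p q :=
    fun p q => hc.intervalIntegrable p q
  have e1 : (∫ x in a..(y + r), f x ^ 2 / 2) - ∫ x in a..y, f x ^ 2 / 2
      = ∫ x in (0 : ℝ)..r, f (y + x) ^ 2 / 2 := by
    rw [intervalIntegral.integral_interval_sub_left (hi _ _) (hi _ _)]
    rw [intervalIntegral.integral_comp_add_left (fun x => f x ^ 2 / 2) y]; simp
  have e2 : (∫ x in a..y, f x ^ 2 / 2) - ∫ x in a..(y - r), f x ^ 2 / 2
      = ∫ x in (0 : ℝ)..r, f (y - x) ^ 2 / 2 := by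
    rw [intervalIntegral.integral_interval_sub_left (hi _ _) (hi _ _)]
    rw [intervalIntegral.integral_comp_sub_left (fun x => f x ^ 2 / 2) y]; simp
  have e3 : (∫ x in (0 : ℝ)..r, (f (y + x) ^ 2 - f (y - x) ^ 2) / 2)
      = (∫ x in (0 : ℝ)..r, f (y + x) ^ 2 / 2) - ∫ x in (0 : ℝ)..r, f (y - x) ^ 2 / 2 := by
    rw [← intervalIntegral.integral_sub]
    · congr 1; funext x; ring
    · exact (by fun_prop : Continuous fun x => f (y + x) ^ 2 / 2).intervalIntegrable _ _
    · exact (by fun_prop : Continuous fun x => f (y - x) ^ 2 / 2).intervalIntegrable _ _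
  rw [e3, ← e1, ← e2]; ring

set_option maxHeartbeats 1000000 in
/-- If a semiconvex function `f` is touched from below at `y` by a twice differentiable
function `u`, then the second differences of `f - ∫ f ^ 2 / 2` at `y` are asymptotically at least
`u'' - f u'`. -/
theorem eventually_second_difference_ge_of_touching {f u u' : ℝ → ℝ} {a y m Λ d : ℝ}
    (hf : Continuous f) (hd : 0 < d) (hΛ : 0 ≤ Λ)
    (hconv : ConvexOn ℝ (Icc (y - d) (y + d)) fun x => f x + Λ * x ^ 2 / 2)
    (hu : ∀ᶠ x in 𝓝 y, HasDerivAt u (u' x) x) (hu' : HasDerivAt u' m y)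
    (htouch : ∀ᶠ x in 𝓝 y, u x - u y ≤ f x - f y) {ε : ℝ} (hε : 0 < ε) :
    ∀ᶠ r in 𝓝[>] (0 : ℝ), (m - f y * u' y - ε) * r ^ 2 ≤
      ((f (y + r) - ∫ x in a..(y + r), f x ^ 2 / 2)
        + (f (y - r) - ∫ x in a..(y - r), f x ^ 2 / 2))
        - 2 * (f y - ∫ x in a..y, f x ^ 2 / 2) := by
  set q := u' y with hq
  set β : ℝ → ℝ := fun x => f (y + x) - f y - q * x with hβ
  have htouch0 : ∀ᶠ x in 𝓝 (0 : ℝ), u (y + x) - u y ≤ f (y + x) - f y := by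
    have : Tendsto (fun x => y + x) (𝓝 0) (𝓝 y) := by
      have : Continuous fun x : ℝ => y + x := by fun_prop
      simpa using this.tendsto 0
    exact this.eventually htouch
  have hβlow : ∀ᶠ x in 𝓝 (0 : ℝ), (m / 2 - ε / 4) * x ^ 2 ≤ β x := by
    filter_upwards [htouch0, eventually_abs_taylor_two_le hu hu'
      (show 0 < ε / 4 by positivity)] with x h1 h2
    have := (abs_le.1 h2).1
    simp only [hβ]; linarith
  have hβ1 : ∀ᶠ x in 𝓝 (0 : ℝ), |β x| < 1 := by
    have hc : Continuous fun x => |β x| := by simp only [hβ]; fun_prop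
    have h0 : |β 0| < 1 := by simp [hβ]
    exact hc.continuousAt.eventually (gt_mem_nhds h0)
  obtain ⟨d1, hd1, hball⟩ := Metric.eventually_nhds_iff.1 (hβlow.and hβ1)
  set C := |m / 2 - ε / 4| with hC
  set K := 2 * |f y| + 2 * |q| + 1 with hK
  have hC0 : 0 ≤ C := abs_nonneg _
  have hK0 : 0 < K := by positivity
  set Q := K * (3 * C + Λ + |m - ε / 2|) with hQ
  have hQ0 : 0 ≤ Q := by positivity
  have hev : ∀ᶠ r in 𝓝[>] (0 : ℝ),
      r ∈ Ioo 0 (min (min d d1) (min 1 (min (1 / K) (ε / 2 / (Q + 1))))) := by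
    apply Ioo_mem_nhdsGT
    have : 0 < ε / 2 / (Q + 1) := by positivity
    have : 0 < 1 / K := by positivity
    exact lt_min (lt_min hd hd1) (lt_min one_pos (lt_min ‹_› ‹_›))
  filter_upwards [hev] with r ⟨hr0, hr⟩
  simp only [lt_min_iff] at hr
  obtain ⟨⟨hrd, hrd1⟩, hr1, hrK, hrQ⟩ := hr
  have low : ∀ x, |x| ≤ r → -(C * r ^ 2) ≤ β x := by
    intro x hx
    have h1 := (hball (y := x) (by rw [Real.dist_eq, sub_zero]; linarith)).1
    have h2 : -C ≤ m / 2 - ε / 4 := neg_abs_le _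
    have h3 : x ^ 2 ≤ r ^ 2 := sq_le_sq' (by linarith [neg_abs_le x]) (by linarith [le_abs_self x])
    nlinarith [sq_nonneg x]
  set S := β r + β (-r) with hS
  have hSlow : (m - ε / 2) * r ^ 2 ≤ S := by
    have h1 := (hball (y := r) (by rw [Real.dist_eq, sub_zero, abs_of_pos hr0]; linarith)).1
    have h2 := (hball (y := -r)
      (by rw [Real.dist_eq, sub_zero, abs_neg, abs_of_pos hr0]; linarith)).1
    rw [neg_sq] at h2
    rw [hS]; linarith
  set Z := S + 3 * C * r ^ 2 + Λ * r ^ 2 with hZ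
  have hβr : -(C * r ^ 2) ≤ β r := low r (by rw [abs_of_pos hr0])
  have hβr' : -(C * r ^ 2) ≤ β (-r) := low (-r) (by rw [abs_neg, abs_of_pos hr0])
  have hr2 : 0 < r ^ 2 := by positivity
  have hΛr : 0 ≤ Λ * r ^ 2 := by positivity
  have hZC : C * r ^ 2 ≤ Z := by rw [hZ, hS]; linarith
  have up : ∀ x, |x| ≤ r → β x ≤ Z := by
    have key : ∀ σ : ℝ, (σ = 1 ∨ σ = -1) → ∀ x ∈ Icc 0 r, β (σ * x) ≤ Z := by
      intro σ hσ x hx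
      have hσ2 : σ ^ 2 = 1 := by rcases hσ with h | h <;> simp [h]
      have hσa : |σ| = 1 := by rcases hσ with h | h <;> simp [h]
      have hmem : ∀ z ∈ Icc 0 r, y + σ * z ∈ Icc (y - d) (y + d) := by
        intro z hz
        have : |σ * z| ≤ d := by rw [abs_mul, hσa, one_mul, abs_of_nonneg hz.1]; linarith [hz.2]
        have := abs_le.1 this
        constructor <;> linarith
      have h0 : y ∈ Icc (y - d) (y + d) := ⟨by linarith, by linarith⟩
      set θ := x / r with hθ
      have hθ0 : 0 ≤ θ := div_nonneg hx.1 hr0.le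
      have hθ1 : θ ≤ 1 := (div_le_one hr0).2 hx.2
      have hxθ : x = θ * r := by rw [hθ]; field_simp
      have hcv := hconv.2 h0 (hmem r ⟨hr0.le, le_rfl⟩) (show 0 ≤ 1 - θ by linarith) hθ0 (by ring)
      simp only [smul_eq_mul] at hcv
      have e : (1 - θ) * y + θ * (y + σ * r) = y + σ * x := by rw [hxθ]; ring
      rw [e] at hcv
      have h1 : β (σ * x) ≤ θ * (β (σ * r) + Λ * r ^ 2 / 2) := by
        simp only [hβ]
        have e2 : (y + σ * x) ^ 2 = y ^ 2 + 2 * y * σ * (θ * r) + θ ^ 2 * r ^ 2 := by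
          rw [hxθ]; linear_combination (θ ^ 2 * r ^ 2) * hσ2
        have e3 : (y + σ * r) ^ 2 = y ^ 2 + 2 * y * σ * r + r ^ 2 := by
          linear_combination (r ^ 2) * hσ2
        rw [e2, e3] at hcv
        have e4 : q * (σ * x) = θ * (q * (σ * r)) := by rw [hxθ]; ring
        rw [e4]
        linarith [mul_nonneg hΛr (sq_nonneg θ)]
      have h2 : β (σ * r) ≤ S + C * r ^ 2 := by
        rcases hσ with h | h
        · rw [h, one_mul, hS]; linarith
        · rw [h, neg_one_mul, hS]; linarith
      have h3 : β (σ * r) + Λ * r ^ 2 / 2 ≤ Z := by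
        rw [hZ]; linarith [mul_nonneg hC0 hr2.le]
      have h4 : 0 ≤ Z := le_trans (by positivity) hZC
      exact h1.trans ((mul_le_mul_of_nonneg_left h3 hθ0).trans (mul_le_of_le_one_left h4 hθ1))
    intro x hx
    rcases le_total 0 x with h | h
    · have := key 1 (Or.inl rfl) x ⟨h, by rwa [abs_of_nonneg h] at hx⟩
      rwa [one_mul] at this
    · have := key (-1) (Or.inr rfl) (-x) ⟨by linarith, by rwa [abs_of_nonpos h] at hx⟩
      simpa using this
  have habs : ∀ x, |x| ≤ r → |β x| ≤ Z := fun x hx =>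
    abs_le.2 ⟨by linarith [low x hx], up x hx⟩
  have hlt1 : ∀ x, |x| ≤ r → |β x| ≤ 1 := fun x hx =>
    (hball (y := x) (by rw [Real.dist_eq, sub_zero]; linarith)).2.le
  have hintg : (∫ x in (0 : ℝ)..r, (f (y + x) ^ 2 - f (y - x) ^ 2) / 2)
      ≤ q * f y * r ^ 2 + K * Z * r := by
    have hrhs : (∫ x in (0 : ℝ)..r, (2 * q * f y * x + K * Z)) = q * f y * r ^ 2 + K * Z * r := by
      rw [intervalIntegral.integral_add (by
        exact (by fun_prop : Continuous fun x => 2 * q * f y * x).intervalIntegrable _ _)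
        (by simp), intervalIntegral.integral_const_mul, integral_id]
      simp; ring
    rw [← hrhs]
    refine intervalIntegral.integral_mono_on hr0.le
      ((by fun_prop : Continuous fun x => (f (y + x) ^ 2 - f (y - x) ^ 2) / 2).intervalIntegrable _ _)
      ((by fun_prop : Continuous fun x => 2 * q * f y * x + K * Z).intervalIntegrable _ _) ?_
    intro x hx
    have hxr : |x| ≤ r := by rw [abs_of_nonneg hx.1]; exact hx.2
    have hxr' : |-x| ≤ r := by rwa [abs_neg]
    have ep : f (y + x) = f y + q * x + β x := by simp only [hβ]; ring
    have em : f (y - x) = f y - q * x + β (-x) := by simp only [hβ, ← sub_eq_add_neg]; ring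
    have b1 := habs x hxr
    have b2 := habs (-x) hxr'
    have c1 := hlt1 x hxr
    have c2 := hlt1 (-x) hxr'
    have hx1 : |x| ≤ 1 := by linarith
    have t1 : f y * (β x - β (-x)) ≤ |f y| * (2 * Z) := by
      refine (le_abs_self _).trans ?_
      rw [abs_mul]
      refine mul_le_mul_of_nonneg_left ?_ (abs_nonneg _)
      have := abs_sub (β x) (β (-x)); linarith
    have t2 : q * x * (β x + β (-x)) ≤ |q| * (2 * Z) := by
      refine (le_abs_self _).trans ?_
      rw [abs_mul, abs_mul]
      have := abs_add_le (β x) (β (-x))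
      have h5 : |q| * |x| ≤ |q| := mul_le_of_le_one_right (abs_nonneg q) hx1
      exact mul_le_mul h5 (by linarith) (abs_nonneg _) (abs_nonneg _)
    have t3 : (β x ^ 2 - β (-x) ^ 2) / 2 ≤ Z := by
      have h6 : β x ^ 2 ≤ Z := by
        rw [← sq_abs, sq]
        exact (mul_le_of_le_one_right (abs_nonneg _) c1).trans b1
      have h7 : 0 ≤ Z := le_trans (by positivity) hZC
      linarith [sq_nonneg (β (-x))]
    have hKZ : K * Z = 2 * (|f y| * Z) + 2 * (|q| * Z) + Z := by rw [hK]; ring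
    rw [ep, em, hKZ]
    linarith
  have hsd := second_difference_primitive hf a y r
  have hSf : S = f (y + r) + f (y - r) - 2 * f y := by
    rw [hS]; simp only [hβ, ← sub_eq_add_neg]; ring
  have hfin : (m - ε / 2) * r ^ 2 - K * Z * r ≥ (m - ε) * r ^ 2 + ((m - ε / 2) * r ^ 2 - S) := by
    have hKr : K * r ≤ 1 := by
      rw [lt_div_iff₀ hK0] at hrK; linarith
    have hQr : Q * r ≤ ε / 2 := by
      rw [lt_div_iff₀ (by positivity)] at hrQ; linarith
    have h8 : S * (1 - K * r) ≥ (m - ε / 2) * r ^ 2 * (1 - K * r) :=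
      mul_le_mul_of_nonneg_right hSlow (by linarith)
    have h9 : (m - ε / 2) * (K * r) ≤ |m - ε / 2| * (K * r) :=
      mul_le_mul_of_nonneg_right (le_abs_self _) (by positivity)
    have h10 : (m - ε / 2) * (K * r) * r ^ 2 ≤ |m - ε / 2| * (K * r) * r ^ 2 :=
      mul_le_mul_of_nonneg_right h9 (by positivity)
    have h11 : Q * r * r ^ 2 ≤ ε / 2 * r ^ 2 := mul_le_mul_of_nonneg_right hQr (by positivity)
    rw [hQ] at h11
    rw [hZ]
    linarith
  linarith

/-- `f` is the sup-convolution of `v` in the time variable over `[τ₁, τ₂]`, and `σ` selects the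
maximisers. -/
structure IsSupConv (v f σ : ℝ → ℝ → ℝ) (τ₁ τ₂ ε : ℝ) : Prop where
  mem : ∀ t y, σ t y ∈ Icc τ₁ τ₂
  eq : ∀ t y, f t y = v (σ t y) y - (t - σ t y) ^ 2 / (2 * ε)
  le : ∀ t y, ∀ s ∈ Icc τ₁ τ₂, v s y - (t - s) ^ 2 / (2 * ε) ≤ f t y

theorem exists_isSupConv {v : ℝ → ℝ → ℝ} (hv : Continuous fun p : ℝ × ℝ => v p.1 p.2)
    {τ₁ τ₂ : ℝ} (hτ : τ₁ ≤ τ₂) (ε : ℝ) : ∃ f σ, IsSupConv v f σ τ₁ τ₂ ε := by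
  have h : ∀ t y, ∃ s ∈ Icc τ₁ τ₂, ∀ s' ∈ Icc τ₁ τ₂,
      v s' y - (t - s') ^ 2 / (2 * ε) ≤ v s y - (t - s) ^ 2 / (2 * ε) := by
    intro t y
    have hc : Continuous fun s => v s y - (t - s) ^ 2 / (2 * ε) := by
      have : Continuous fun s => v s y := hv.comp (by fun_prop : Continuous fun s : ℝ => (s, y))
      fun_prop
    obtain ⟨s, hs, hmax⟩ := isCompact_Icc.exists_isMaxOn (nonempty_Icc.2 hτ) hc.continuousOn
    exact ⟨s, hs, fun s' hs' => hmax hs'⟩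
  choose σ hσ hmax using h
  exact ⟨fun t y => v (σ t y) y - (t - σ t y) ^ 2 / (2 * ε), σ, hσ, fun _ _ => rfl, hmax⟩

namespace IsSupConv

variable {v f σ : ℝ → ℝ → ℝ} {τ₁ τ₂ ε : ℝ}

theorem lipschitz_space (h : IsSupConv v f σ τ₁ τ₂ ε) {L : ℝ}
    (hL : ∀ t x y, |v t x - v t y| ≤ L * |x - y|) (t x y : ℝ) :
    |f t x - f t y| ≤ L * |x - y| := by
  have key : ∀ x y, f t x - f t y ≤ L * |x - y| := by
    intro x y
    have h1 := h.le t y (σ t x) (h.mem t x)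
    rw [h.eq t x]
    linarith [(abs_le.1 (hL (σ t x) x y)).2]
  refine abs_le.2 ⟨?_, key x y⟩
  have := key y x
  rw [abs_sub_comm] at this
  linarith

theorem abs_sub_time_le (h : IsSupConv v f σ τ₁ τ₂ ε) (hε : 0 < ε) {R : ℝ} {t t' : ℝ}
    (ht : |t| ≤ R) (ht' : |t'| ≤ R) (y : ℝ) :
    |f t y - f t' y| ≤ (R + |τ₁| + |τ₂|) / ε * |t - t'| := by
  have key : ∀ t t', |t| ≤ R → |t'| ≤ R →
      f t y - f t' y ≤ (R + |τ₁| + |τ₂|) / ε * |t - t'| := by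
    intro t t' ht ht'
    have h1 := h.le t' y (σ t y) (h.mem t y)
    rw [h.eq t y]
    have hs : |σ t y| ≤ |τ₁| + |τ₂| := by
      obtain ⟨h1, h2⟩ := h.mem t y
      rw [abs_le]; constructor
      · linarith [neg_abs_le τ₁, abs_nonneg τ₂]
      · linarith [le_abs_self τ₂, abs_nonneg τ₁]
    have h2 : (t' - σ t y) ^ 2 - (t - σ t y) ^ 2 ≤ 2 * (R + |τ₁| + |τ₂|) * |t - t'| := by
      have e : (t' - σ t y) ^ 2 - (t - σ t y) ^ 2 = (t' + t - 2 * σ t y) * (t' - t) := by ring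
      rw [e, abs_sub_comm]
      refine (le_abs_self _).trans ?_
      rw [abs_mul]
      refine mul_le_mul_of_nonneg_right ?_ (abs_nonneg _)
      obtain ⟨a1, a2⟩ := abs_le.1 hs
      obtain ⟨b1, b2⟩ := abs_le.1 ht
      obtain ⟨c1, c2⟩ := abs_le.1 ht'
      rw [abs_le]; constructor <;> linarith
    have h3 : ((t' - σ t y) ^ 2 - (t - σ t y) ^ 2) / (2 * ε)
        ≤ 2 * (R + |τ₁| + |τ₂|) * |t - t'| / (2 * ε) :=
      div_le_div_of_nonneg_right h2 (by positivity)
    have e : 2 * (R + |τ₁| + |τ₂|) * |t - t'| / (2 * ε) = (R + |τ₁| + |τ₂|) / ε * |t - t'| := by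
      field_simp
    rw [e, sub_div] at h3
    linarith
  refine abs_le.2 ⟨?_, key t t' ht ht'⟩
  have := key t' t ht' ht
  rw [abs_sub_comm] at this
  linarith

theorem continuous (h : IsSupConv v f σ τ₁ τ₂ ε) (hε : 0 < ε) {L : ℝ}
    (hL : ∀ t x y, |v t x - v t y| ≤ L * |x - y|) : Continuous fun p : ℝ × ℝ => f p.1 p.2 := by
  rw [continuous_iff_continuousAt]
  rintro ⟨t, y⟩
  set R := |t| + 1 with hR
  set K := (R + |τ₁| + |τ₂|) / ε with hK
  have hbd : ∀ᶠ p : ℝ × ℝ in 𝓝 (t, y), ‖f p.1 p.2 - f t y‖ ≤ K * |p.1 - t| + L * |p.2 - y| := by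
    have hc : ContinuousAt (fun p : ℝ × ℝ => |p.1|) (t, y) := by fun_prop
    filter_upwards [hc.eventually (gt_mem_nhds (show |t| < R by rw [hR]; linarith))] with p hp
    have h1 := h.abs_sub_time_le hε (R := R) hp.le (show |t| ≤ R by rw [hR]; linarith) p.2
    have h2 := h.lipschitz_space hL t p.2 y
    rw [Real.norm_eq_abs]
    calc |f p.1 p.2 - f t y| = |(f p.1 p.2 - f t p.2) + (f t p.2 - f t y)| := by ring_nf
      _ ≤ _ := (abs_add_le _ _).trans (add_le_add h1 h2)
  have hz : Tendsto (fun p : ℝ × ℝ => K * |p.1 - t| + L * |p.2 - y|) (𝓝 (t, y)) (𝓝 0) := by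
    have hc : Continuous fun p : ℝ × ℝ => K * |p.1 - t| + L * |p.2 - y| := by fun_prop
    have := hc.tendsto (t, y)
    simpa using this
  have := squeeze_zero_norm' hbd hz
  have h3 := this.add_const (f t y)
  simpa [ContinuousAt] using h3

theorem absolutelyContinuous (h : IsSupConv v f σ τ₁ τ₂ ε) (hε : 0 < ε) (y t₁ t₂ : ℝ) :
    AbsolutelyContinuousOnInterval (fun t => f t y) t₁ t₂ := by
  set R := |t₁| + |t₂|
  have hR : ∀ t ∈ uIcc t₁ t₂, |t| ≤ R := by
    intro t ht
    have h1 := abs_le_max_abs_abs ht.1 ht.2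
    refine h1.trans (max_le ?_ ?_)
    · rcases min_choice t₁ t₂ with e | e <;> rw [e] <;> simp [R]
    · rcases max_choice t₁ t₂ with e | e <;> rw [e] <;> simp [R]
  have hK : 0 ≤ (R + |τ₁| + |τ₂|) / ε := by positivity
  have : LipschitzOnWith ⟨_, hK⟩ (fun t => f t y) (uIcc t₁ t₂) :=
    LipschitzOnWith.of_dist_le_mul fun s hs t ht => h.abs_sub_time_le hε (hR s hs) (hR t ht) y
  exact this.absolutelyContinuousOnInterval

/-- The time derivative of the sup-convolution, where it exists. -/
theorem deriv_time (h : IsSupConv v f σ τ₁ τ₂ ε) (hε : 0 < ε) {t y : ℝ}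
    (hd : DifferentiableAt ℝ (fun t => f t y) t) :
    deriv (fun t => f t y) t = (σ t y - t) / ε := by
  set s := σ t y with hs
  have hmin : IsLocalMin (fun t' => f t' y + (t' - s) ^ 2 / (2 * ε)) t := by
    refine Eventually.of_forall fun t' => ?_
    have h1 := h.le t' y s (h.mem t y)
    have h2 := h.eq t y
    rw [← hs] at h2
    simp only
    linarith
  have hder : HasDerivAt (fun t' => f t' y + (t' - s) ^ 2 / (2 * ε))
      (deriv (fun t => f t y) t + (t - s) / ε) t := by
    have h1 := (((hasDerivAt_id t).sub_const s).pow 2).div_const (2 * ε)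
    refine (hd.hasDerivAt.add h1).congr_deriv ?_
    simp; field_simp
  have := hmin.hasDerivAt_eq_zero hder
  have e : (s - t) / ε = -((t - s) / ε) := by ring
  rw [e]; linarith

/-- At an interior maximiser, the time derivative of `v` is the slope of the parabola. -/
theorem hasDerivAt_eq (h : IsSupConv v f σ τ₁ τ₂ ε) (hε : 0 < ε) {t y d : ℝ}
    (hs : σ t y ∈ Ioo τ₁ τ₂) (hd : HasDerivAt (fun s => v s y) d (σ t y)) :
    d = (σ t y - t) / ε := by
  set s := σ t y with hs'
  have hmax : IsLocalMax (fun s' => v s' y - (t - s') ^ 2 / (2 * ε)) s := by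
    filter_upwards [Icc_mem_nhds hs.1 hs.2] with s' h'
    have h1 := h.le t y s' h'
    have h2 := h.eq t y
    rw [← hs'] at h2
    linarith
  have hder : HasDerivAt (fun s' => v s' y - (t - s') ^ 2 / (2 * ε)) (d + (t - s) / ε) s := by
    have h1 := (((hasDerivAt_id s).const_sub t).pow 2).div_const (2 * ε)
    refine (hd.sub h1).congr_deriv ?_
    simp; field_simp; ring
  have := hmax.hasDerivAt_eq_zero hder
  have e : (s - t) / ε = -((t - s) / ε) := by ring
  rw [e]; linarith

theorem touching (h : IsSupConv v f σ τ₁ τ₂ ε) (t x y : ℝ) :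
    v (σ t y) x - v (σ t y) y ≤ f t x - f t y := by
  have h1 := h.le t x (σ t y) (h.mem t y)
  have h2 := h.eq t y
  linarith

end IsSupConv

/-- Sup-convolutions in time with small parameter approximate uniformly and have interior
maximisers. -/
theorem exists_isSupConv_approx {v : ℝ → ℝ → ℝ} (hv : Continuous fun p : ℝ × ℝ => v p.1 p.2)
    {B : ℝ} (hB : ∀ t y, |v t y| ≤ B) {τ₁ τ₂ t₁ t₂ : ℝ} (h1 : τ₁ < t₁) (h12 : t₁ ≤ t₂)
    (h2 : t₂ < τ₂) (a b : ℝ) {η : ℝ} (hη : 0 < η) :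
    ∃ ε > 0, ∃ f σ, IsSupConv v f σ τ₁ τ₂ ε ∧ (∀ t ∈ Icc t₁ t₂, ∀ y, σ t y ∈ Ioo τ₁ τ₂) ∧
      ∀ t ∈ Icc t₁ t₂, ∀ y ∈ Icc a b,
        v t y ≤ f t y ∧ f t y ≤ v (σ t y) y ∧ v (σ t y) y ≤ v t y + η := by
  have hB0 : 0 ≤ B := (abs_nonneg _).trans (hB 0 0)
  have huc : UniformContinuousOn (fun p : ℝ × ℝ => v p.1 p.2) (Icc τ₁ τ₂ ×ˢ Icc a b) :=
    (isCompact_Icc.prod isCompact_Icc).uniformContinuousOn_of_continuous hv.continuousOn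
  obtain ⟨δ, hδ, hδ'⟩ := Metric.uniformContinuousOn_iff.1 huc η hη
  set γ := min δ (min (t₁ - τ₁) (τ₂ - t₂)) with hγ
  have hγ0 : 0 < γ := lt_min hδ (lt_min (by linarith) (by linarith))
  set ε := γ ^ 2 / (4 * B + 1) / 2 with hε
  have hε0 : 0 < ε := by positivity
  obtain ⟨f, σ, hf⟩ := exists_isSupConv hv (show τ₁ ≤ τ₂ by linarith) ε
  have hle : ∀ t ∈ Icc t₁ t₂, ∀ y, v t y ≤ f t y := by
    intro t ht y
    have := hf.le t y t ⟨by linarith [ht.1], by linarith [ht.2]⟩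
    simpa using this
  have hclose : ∀ t ∈ Icc t₁ t₂, ∀ y, |t - σ t y| < γ := by
    intro t ht y
    have e1 := hle t ht y
    rw [hf.eq t y] at e1
    have e2 := (abs_le.1 (hB t y)).1
    have e3 := (abs_le.1 (hB (σ t y) y)).2
    have e4 : (t - σ t y) ^ 2 / (2 * ε) ≤ 2 * B := by linarith
    rw [div_le_iff₀ (by positivity)] at e4
    have e5 : 2 * B * (2 * ε) < γ ^ 2 := by
      rw [hε]
      have : 2 * B * (2 * (γ ^ 2 / (4 * B + 1) / 2)) = γ ^ 2 * (2 * B / (4 * B + 1)) := by ring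
      rw [this]
      have : 2 * B / (4 * B + 1) < 1 := by rw [div_lt_one (by positivity)]; linarith
      nlinarith [sq_pos_of_pos hγ0]
    exact abs_lt_of_sq_lt_sq (by linarith) hγ0.le
  refine ⟨ε, hε0, f, σ, hf, ?_, ?_⟩
  · intro t ht y
    have := abs_lt.1 ((hclose t ht y).trans_le ((min_le_right _ _)))
    have m1 := min_le_left (t₁ - τ₁) (τ₂ - t₂)
    have m2 := min_le_right (t₁ - τ₁) (τ₂ - t₂)
    constructor <;> linarith [ht.1, ht.2]
  · intro t ht y hy
    refine ⟨hle t ht y, ?_, ?_⟩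
    · rw [hf.eq t y]
      have : 0 ≤ (t - σ t y) ^ 2 / (2 * ε) := by positivity
      linarith
    · have hc := (hclose t ht y).trans_le (min_le_left _ _)
      have := hδ' (σ t y, y) ⟨hf.mem t y, hy⟩ (t, y)
        ⟨⟨by linarith [ht.1], by linarith [ht.2]⟩, hy⟩ (by
          rw [Prod.dist_eq]
          simp only [dist_self, Real.dist_eq]
          rw [abs_sub_comm, max_eq_left (abs_nonneg _)]; exact hc)
      rw [Real.dist_eq] at this
      linarith [(abs_lt.1 this).2]

/-- A globally defined bounded continuous function, Lipschitz in space, which solves the viscous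
Burgers equation classically in `(τ₁, τ₂) × (a, b)`. -/
structure IsBurgersBox (v vt vy vyy : ℝ → ℝ → ℝ) (τ₁ τ₂ a b B L : ℝ) : Prop where
  cont : Continuous fun p : ℝ × ℝ => v p.1 p.2
  bound : ∀ t y, |v t y| ≤ B
  lip : ∀ t x y, |v t x - v t y| ≤ L * |x - y|
  L_nonneg : 0 ≤ L
  time : ∀ t ∈ Ioo τ₁ τ₂, ∀ y ∈ Ioo a b, HasDerivAt (fun s => v s y) (vt t y) t
  space : ∀ t ∈ Ioo τ₁ τ₂, ∀ y ∈ Ioo a b, HasDerivAt (fun x => v t x) (vy t y) y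
  space₂ : ∀ t ∈ Ioo τ₁ τ₂, ∀ y ∈ Ioo a b, HasDerivAt (fun x => vy t x) (vyy t y) y
  pde : ∀ t ∈ Ioo τ₁ τ₂, ∀ y ∈ Ioo a b, vt t y + v t y * vy t y = vyy t y

namespace IsBurgersBox

variable {v vt vy vyy f σ : ℝ → ℝ → ℝ} {τ₁ τ₂ a b B L ε : ℝ}

theorem abs_space_le (h : IsBurgersBox v vt vy vyy τ₁ τ₂ a b B L) {t y : ℝ} (ht : t ∈ Ioo τ₁ τ₂)
    (hy : y ∈ Ioo a b) : |vy t y| ≤ L :=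
  (h.space t ht y hy).le_of_lip' h.L_nonneg (Eventually.of_forall fun x => h.lip t x y)

theorem eventually_space (h : IsBurgersBox v vt vy vyy τ₁ τ₂ a b B L) {t y : ℝ}
    (ht : t ∈ Ioo τ₁ τ₂) (hy : y ∈ Ioo a b) :
    ∀ᶠ x in 𝓝 y, HasDerivAt (fun x => v t x) (vy t x) x := by
  filter_upwards [Ioo_mem_nhds hy.1 hy.2] with x hx using h.space t ht x hx

theorem convexOn_supConv (h : IsBurgersBox v vt vy vyy τ₁ τ₂ a b B L)
    (hf : IsSupConv v f σ τ₁ τ₂ ε) (hε : 0 < ε) {t : ℝ} (ht : t ∈ Icc τ₁ τ₂)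
    (hσ : ∀ y, σ t y ∈ Ioo τ₁ τ₂) :
    ConvexOn ℝ (Icc a b) fun x => f t x + ((τ₂ - τ₁) / ε + B * L) * x ^ 2 / 2 := by
  set Λ := (τ₂ - τ₁) / ε + B * L with hΛ
  have hfc : Continuous (f t) :=
    (hf.continuous hε h.lip).comp (by fun_prop : Continuous fun x : ℝ => (t, x))
  refine convexOn_Icc_of_frequently_second_difference (by fun_prop) fun y hy ε' hε' => ?_
  set s := σ t y with hs
  have hsm : s ∈ Ioo τ₁ τ₂ := hσ y
  have hT := eventually_abs_taylor_two_le (h.eventually_space hsm hy) (h.space₂ s hsm y hy)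
    (half_pos hε')
  have hvt := hf.hasDerivAt_eq hε hsm (h.time s hsm y hy)
  have hm : -Λ ≤ vyy s y := by
    have h1 : -((τ₂ - τ₁) / ε) ≤ vt s y := by
      rw [hvt, ← neg_div]
      exact div_le_div_of_nonneg_right (by linarith [hsm.1, ht.2]) hε.le
    have h2 : |v s y * vy s y| ≤ B * L := by
      rw [abs_mul]
      exact mul_le_mul (h.bound s y) (h.abs_space_le hsm hy) (abs_nonneg _)
        ((abs_nonneg _).trans (h.bound s y))
    rw [← h.pde s hsm y hy, hΛ]
    linarith [(abs_le.1 h2).1]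
  refine Eventually.frequently ?_
  have hneg : Tendsto (fun r : ℝ => -r) (𝓝 0) (𝓝 0) := by
    simpa using (tendsto_id (α := ℝ) (x := 𝓝 0)).neg
  filter_upwards [hT.filter_mono nhdsWithin_le_nhds, (hneg.eventually hT).filter_mono
    nhdsWithin_le_nhds] with r h1 h2
  have h3 := hf.touching t (y + r) y
  have h4 := hf.touching t (y - r) y
  rw [← hs] at h3 h4
  rw [← sub_eq_add_neg] at h2
  have h5 := (abs_le.1 h1).1
  have h6 := (abs_le.1 h2).1
  have h7 : -Λ * r ^ 2 ≤ vyy s y * r ^ 2 := mul_le_mul_of_nonneg_right hm (sq_nonneg r)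
  have e : f t (y + r) + Λ * (y + r) ^ 2 / 2 + (f t (y - r) + Λ * (y - r) ^ 2 / 2)
      - 2 * (f t y + Λ * y ^ 2 / 2) = f t (y + r) + f t (y - r) - 2 * f t y + Λ * r ^ 2 := by ring
  rw [e]
  linarith

end IsBurgersBox

/-- Second differences of a convex function plus a quadratic. -/
theorem second_difference_ge_of_convexOn_add_sq {f : ℝ → ℝ} {a b Λ y r : ℝ}
    (hc : ConvexOn ℝ (Icc a b) fun x => f x + Λ * x ^ 2 / 2) (h1 : y - r ∈ Icc a b)
    (h2 : y + r ∈ Icc a b) : -Λ * r ^ 2 ≤ f (y + r) + f (y - r) - 2 * f y := by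
  have := hc.2 h1 h2 (show (0 : ℝ) ≤ 1 / 2 by norm_num) (show (0 : ℝ) ≤ 1 / 2 by norm_num)
    (by norm_num)
  simp only [smul_eq_mul] at this
  rw [show 1 / 2 * (y - r) + 1 / 2 * (y + r) = y by ring] at this
  linarith

theorem abs_second_difference_primitive_le {f : ℝ → ℝ} (hf : Continuous f) {B L y r : ℝ} (a : ℝ)
    (hr : 0 ≤ r) (hB : ∀ x ∈ Icc (y - r) (y + r), |f x| ≤ B)
    (hL : ∀ x z, |f x - f z| ≤ L * |x - z|) (hL0 : 0 ≤ L) :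
    |(∫ x in a..(y + r), f x ^ 2 / 2) + (∫ x in a..(y - r), f x ^ 2 / 2)
      - 2 * (∫ x in a..y, f x ^ 2 / 2)| ≤ 2 * B * L * r ^ 2 := by
  rw [second_difference_primitive hf]
  have : ∀ x ∈ Set.uIoc 0 r, ‖(f (y + x) ^ 2 - f (y - x) ^ 2) / 2‖ ≤ 2 * B * L * r := by
    intro x hx
    rw [uIoc_of_le hr] at hx
    have h1 := hB (y + x) ⟨by linarith [hx.1], by linarith [hx.2]⟩
    have h2 := hB (y - x) ⟨by linarith [hx.2], by linarith [hx.1]⟩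
    have h3 := hL (y + x) (y - x)
    rw [show y + x - (y - x) = 2 * x by ring, abs_of_pos (by linarith [hx.1] : 0 < 2 * x)] at h3
    rw [Real.norm_eq_abs, show (f (y + x) ^ 2 - f (y - x) ^ 2) / 2
      = (f (y + x) + f (y - x)) / 2 * (f (y + x) - f (y - x)) by ring, abs_mul]
    have hB0 : 0 ≤ B := (abs_nonneg _).trans h1
    have h4 : |(f (y + x) + f (y - x)) / 2| ≤ B := by
      rw [abs_le] at *; constructor <;> linarith [h1.1, h1.2, h2.1, h2.2]
    calc _ ≤ B * (L * (2 * r)) := mul_le_mul h4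
          (h3.trans (mul_le_mul_of_nonneg_left (by linarith [hx.2]) hL0)) (abs_nonneg _) hB0
      _ = _ := by ring
  have := intervalIntegral.norm_integral_le_of_norm_le_const this
  rw [Real.norm_eq_abs] at this
  refine this.trans (le_of_eq ?_)
  rw [sub_zero, abs_of_nonneg hr]; ring

namespace IsBurgersBox

variable {v vt vy vyy f σ : ℝ → ℝ → ℝ} {τ₁ τ₂ t₁ t₂ a b B L ε η : ℝ}

theorem eventually_second_difference_supConv (h : IsBurgersBox v vt vy vyy τ₁ τ₂ a b B L)
    (hf : IsSupConv v f σ τ₁ τ₂ ε) (hε : 0 < ε) (hη : 0 ≤ η) {t : ℝ} (ht : t ∈ Icc τ₁ τ₂)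
    (hσ : ∀ y, σ t y ∈ Ioo τ₁ τ₂) {y : ℝ} (hy : y ∈ Ioo a b)
    (h1 : v t y ≤ f t y) (h2 : f t y ≤ v (σ t y) y) (h3 : v (σ t y) y ≤ v t y + η)
    (hd : DifferentiableAt ℝ (fun t => f t y) t) {δ : ℝ} (hδ : 0 < δ) :
    ∀ᶠ r in 𝓝[>] (0 : ℝ), (deriv (fun t => f t y) t - η * L - δ) * r ^ 2 ≤
      ((f t (y + r) - ∫ x in a..(y + r), f t x ^ 2 / 2)
        + (f t (y - r) - ∫ x in a..(y - r), f t x ^ 2 / 2))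
        - 2 * (f t y - ∫ x in a..y, f t x ^ 2 / 2) := by
  have hfc : Continuous (f t) :=
    (hf.continuous hε h.lip).comp (by fun_prop : Continuous fun x : ℝ => (t, x))
  set s := σ t y with hs
  have hsm : s ∈ Ioo τ₁ τ₂ := hσ y
  have hB0 : 0 ≤ B := (abs_nonneg _).trans (h.bound 0 0)
  have hconv := h.convexOn_supConv hf hε ht hσ
  set d := min (y - a) (b - y) with hdd
  have hd0 : 0 < d := lt_min (by linarith [hy.1]) (by linarith [hy.2])
  have hda : d ≤ y - a := min_le_left _ _
  have hdb : d ≤ b - y := min_le_right _ _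
  have hΛ : 0 ≤ (τ₂ - τ₁) / ε + B * L := by
    have := h.L_nonneg
    have : 0 ≤ τ₂ - τ₁ := by linarith [ht.1, ht.2]
    positivity
  have key := eventually_second_difference_ge_of_touching (a := a) (y := y) (m := vyy s y) hfc hd0 hΛ
    (hconv.subset (Icc_subset_Icc (by linarith) (by linarith)) (convex_Icc _ _))
    (h.eventually_space hsm hy) (h.space₂ s hsm y hy)
    (Eventually.of_forall fun x => hf.touching t x y) hδ
  have hvt := hf.hasDerivAt_eq hε hsm (h.time s hsm y hy)
  have hder := hf.deriv_time hε hd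
  filter_upwards [key] with r hr
  refine le_trans (mul_le_mul_of_nonneg_right ?_ (sq_nonneg r)) hr
  have h5 : |(v s y - f t y) * vy s y| ≤ η * L := by
    rw [abs_mul]
    refine mul_le_mul ?_ (h.abs_space_le hsm hy) (abs_nonneg _) hη
    rw [abs_le]; constructor <;> linarith
  have h6 := (abs_le.1 h5).1
  rw [hder, ← h.pde s hsm y hy, ← hs, ← hvt]
  linarith

/-- The twice integrated equation for sup-convolutions, up to a small error. -/
theorem convexOn_integrated_supConv (h : IsBurgersBox v vt vy vyy τ₁ τ₂ a b B L)
    (hf : IsSupConv v f σ τ₁ τ₂ ε) (hε : 0 < ε) (hη : 0 ≤ η)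
    (h1 : τ₁ < t₁) (h12 : t₁ ≤ t₂) (h2 : t₂ < τ₂)
    (hσ : ∀ t ∈ Icc t₁ t₂, ∀ y, σ t y ∈ Ioo τ₁ τ₂)
    (happ : ∀ t ∈ Icc t₁ t₂, ∀ y ∈ Icc a b,
        v t y ≤ f t y ∧ f t y ≤ v (σ t y) y ∧ v (σ t y) y ≤ v t y + η) :
    ConvexOn ℝ (Icc a b) fun y =>
      ((∫ t in t₁..t₂, (f t y - ∫ x in a..y, f t x ^ 2 / 2))
        - ∫ x in a..y, ∫ z in a..x, (f t₂ z - f t₁ z)) + η * L * (t₂ - t₁) * y ^ 2 / 2 := by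
  have hB0 : 0 ≤ B := (abs_nonneg _).trans (h.bound 0 0)
  have hL0 := h.L_nonneg
  have hfc := hf.continuous hε h.lip
  have hft : ∀ t, Continuous (f t) := fun t =>
    hfc.comp (by fun_prop : Continuous fun x : ℝ => (t, x))
  have hfy : ∀ y, Continuous fun t => f t y := fun y =>
    hfc.comp (by fun_prop : Continuous fun t : ℝ => (t, y))
  have hGc : Continuous fun p : ℝ × ℝ => f p.1 p.2 - ∫ x in a..p.2, f p.1 x ^ 2 / 2 := by
    refine hfc.sub ?_
    refine intervalIntegral.continuous_parametric_intervalIntegral_of_continuous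
      (f := fun p : ℝ × ℝ => fun x => f p.1 x ^ 2 / 2) ?_ continuous_snd
    have : Continuous fun q : (ℝ × ℝ) × ℝ => f q.1.1 q.2 :=
      hfc.comp (by fun_prop : Continuous fun q : (ℝ × ℝ) × ℝ => (q.1.1, q.2))
    show Continuous fun q : (ℝ × ℝ) × ℝ => f q.1.1 q.2 ^ 2 / 2
    fun_prop
  set G : ℝ → ℝ → ℝ := fun t y => f t y - ∫ x in a..y, f t x ^ 2 / 2 with hG
  have hGt : ∀ y, Continuous fun t => G t y := fun y =>
    hGc.comp (by fun_prop : Continuous fun t : ℝ => (t, y))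
  have hIc : Continuous fun y => ∫ t in t₁..t₂, G t y :=
    intervalIntegral.continuous_parametric_intervalIntegral_of_continuous'
      (f := fun y t => G t y)
      (hGc.comp (by fun_prop : Continuous fun q : ℝ × ℝ => (q.2, q.1))) t₁ t₂
  have hkc : Continuous fun z => f t₂ z - f t₁ z := (hft t₂).sub (hft t₁)
  set k : ℝ → ℝ := fun z => f t₂ z - f t₁ z with hk
  have hk1 : ∀ x, HasDerivAt (fun x => ∫ z in a..x, k z) (k x) x := fun x =>
    intervalIntegral.integral_hasDerivAt_right (hkc.intervalIntegrable _ _)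
      (hkc.stronglyMeasurableAtFilter _ _) hkc.continuousAt
  have hkc1 : Continuous fun x => ∫ z in a..x, k z :=
    continuous_iff_continuousAt.2 fun x => (hk1 x).continuousAt
  have hk2 : ∀ x, HasDerivAt (fun y => ∫ x in a..y, ∫ z in a..x, k z) (∫ z in a..x, k z) x :=
    fun x => intervalIntegral.integral_hasDerivAt_right (hkc1.intervalIntegrable _ _)
      (hkc1.stronglyMeasurableAtFilter _ _) hkc1.continuousAt
  have hkc2 : Continuous fun y => ∫ x in a..y, ∫ z in a..x, k z :=
    continuous_iff_continuousAt.2 fun x => (hk2 x).continuousAt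
  refine convexOn_Icc_of_frequently_second_difference
    (Continuous.continuousOn ?_) fun y hy δ hδ => ?_
  · fun_prop
  set W : ℝ → ℝ := fun y => ∫ x in a..y, ∫ z in a..x, k z with hW
  set d := min (y - a) (b - y) with hdd
  have hd0 : 0 < d := lt_min (by linarith [hy.1]) (by linarith [hy.2])
  have hda : d ≤ y - a := min_le_left _ _
  have hdb : d ≤ b - y := min_le_right _ _
  set r : ℕ → ℝ := fun n => d / (n + 1) with hr
  have hr0 : ∀ n, 0 < r n := fun n => by positivity
  have hrd : ∀ n, r n ≤ d := fun n => div_le_self hd0.le (by linarith [Nat.cast_nonneg (α := ℝ) n])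
  have hrt : Tendsto r atTop (𝓝[>] 0) := by
    refine tendsto_nhdsWithin_iff.2 ⟨?_, Eventually.of_forall hr0⟩
    have := tendsto_one_div_add_atTop_nhds_zero_nat (𝕜 := ℝ)
    simpa [hr, div_eq_mul_inv] using this.const_mul d
  set q : ℕ → ℝ → ℝ := fun n t => (G t (y + r n) + G t (y - r n) - 2 * G t y) / r n ^ 2 with hq
  have hqc : ∀ n, Continuous (q n) := fun n => by
    have h1 := hGt (y + r n)
    have h2 := hGt (y - r n)
    have h3 := hGt y
    simp only [hq]
    fun_prop
  set P : ℝ → ℝ := fun t => deriv (fun t => f t y) t - η * L with hP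
  have hAC := hf.absolutelyContinuous hε y t₁ t₂
  have hdi := hAC.intervalIntegrable_deriv
  have hPint : IntervalIntegrable P volume t₁ t₂ := hdi.sub intervalIntegrable_const
  have hPval : ∫ t in t₁..t₂, P t = k y - η * L * (t₂ - t₁) := by
    rw [hP, intervalIntegral.integral_sub hdi intervalIntegrable_const, hAC.integral_deriv_eq_sub,
      intervalIntegral.integral_const, smul_eq_mul]
    ring
  have hlow : ∀ n, ∀ t ∈ Icc t₁ t₂, -((τ₂ - τ₁) / ε + B * L) - 2 * B * L ≤ q n t := by
    intro n t ht
    have ht' : t ∈ Icc τ₁ τ₂ := ⟨by linarith [ht.1], by linarith [ht.2]⟩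
    have e1 := second_difference_ge_of_convexOn_add_sq (y := y) (r := r n)
      (h.convexOn_supConv hf hε ht' (hσ t ht))
      ⟨by linarith [hrd n], by linarith [hr0 n, hy.2]⟩ ⟨by linarith [hr0 n, hy.1], by linarith [hrd n]⟩
    have e2 := abs_second_difference_primitive_le (hft t) (y := y) (B := B) a (hr0 n).le
      (fun x hx => by
        have hx' : x ∈ Icc a b := ⟨by linarith [hx.1, hrd n], by linarith [hx.2, hrd n]⟩
        obtain ⟨c1, c2, -⟩ := happ t ht x hx'
        have c3 := abs_le.1 (h.bound t x)
        have c4 := abs_le.1 (h.bound (σ t x) x)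
        rw [abs_le]; constructor <;> linarith [c3.1, c4.2])
      (fun x z => hf.lipschitz_space h.lip t x z) hL0
    rw [hq, le_div_iff₀ (pow_pos (hr0 n) 2)]
    simp only [hG]
    have e3 := (abs_le.1 e2).2
    linarith
  have hlim : ∀ᵐ t, t ∈ Set.uIoc t₁ t₂ → ∀ δ > 0, ∀ᶠ n in atTop, P t - δ ≤ q n t := by
    filter_upwards [hAC.ae_differentiableAt] with t htd ht δ hδ
    rw [uIoc_of_le h12] at ht
    have ht1 : t ∈ Icc t₁ t₂ := ⟨ht.1.le, ht.2⟩
    have ht' : t ∈ Icc τ₁ τ₂ := ⟨by linarith [ht.1], by linarith [ht.2]⟩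
    obtain ⟨c1, c2, c3⟩ := happ t ht1 y ⟨hy.1.le, hy.2.le⟩
    have hdt : DifferentiableAt ℝ (fun t => f t y) t := htd (by rw [uIcc_of_le h12]; exact ht1)
    have := h.eventually_second_difference_supConv hf hε hη ht' (hσ t ht1) hy c1 c2 c3 hdt hδ
    filter_upwards [hrt.eventually this] with n hn
    rw [hq, le_div_iff₀ (pow_pos (hr0 n) 2)]
    exact hn
  have hev := eventually_integral_ge_of_liminf_ge h12 (fun n => (hqc n).intervalIntegrable _ _)
    hPint hlow hlim (half_pos hδ)
  have hT := eventually_abs_taylor_two_le (Eventually.of_forall hk2) (hk1 y)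
    (show 0 < δ / 4 by linarith)
  have hneg : Tendsto (fun r : ℝ => -r) (𝓝 0) (𝓝 0) := by
    simpa using (tendsto_id (α := ℝ) (x := 𝓝 0)).neg
  have hT1 := hrt.eventually (hT.filter_mono nhdsWithin_le_nhds)
  have hT2 := hrt.eventually ((hneg.eventually hT).filter_mono nhdsWithin_le_nhds)
  refine hrt.frequently (Eventually.frequently ?_)
  filter_upwards [hev, hT1, hT2] with n e1 e2 e3
  have hq' : ∫ t in t₁..t₂, q n t = ((∫ t in t₁..t₂, G t (y + r n)) + (∫ t in t₁..t₂, G t (y - r n))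
      - 2 * ∫ t in t₁..t₂, G t y) / r n ^ 2 := by
    have i1 := (hGt (y + r n)).intervalIntegrable (μ := volume) t₁ t₂
    have i2 := (hGt (y - r n)).intervalIntegrable (μ := volume) t₁ t₂
    have i3 := (hGt y).intervalIntegrable (μ := volume) t₁ t₂
    rw [hq, intervalIntegral.integral_div, intervalIntegral.integral_sub (i1.add i2)
      (i3.const_mul 2), intervalIntegral.integral_add i1 i2, intervalIntegral.integral_const_mul]
  rw [hPval, hq', le_div_iff₀ (pow_pos (hr0 n) 2)] at e1
  rw [← sub_eq_add_neg] at e3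
  have e4 := (abs_le.1 e2).2
  have e5 := (abs_le.1 e3).2
  change W (y + r n) - W y - (∫ z in a..y, k z) * r n - k y * r n ^ 2 / 2 ≤ _ at e4
  change W (y - r n) - W y - (∫ z in a..y, k z) * (-r n) - k y * (-r n) ^ 2 / 2 ≤ _ at e5
  rw [neg_sq] at e5
  have e6 : ∀ A B C D E F' M y r : ℝ, A - D + M * (y + r) ^ 2 / 2 + (B - E + M * (y - r) ^ 2 / 2)
      - 2 * (C - F' + M * y ^ 2 / 2) = (A + B - 2 * C) - (D + E - 2 * F') + M * r ^ 2 := by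
    intros; ring
  rw [e6]
  linarith

end IsBurgersBox

theorem convexOn_of_forall_approx {F : ℝ → ℝ} {s : Set ℝ} (hs : Convex ℝ s)
    (H : ∀ η > 0, ∃ F', ConvexOn ℝ s F' ∧ ∀ x ∈ s, |F' x - F x| ≤ η) : ConvexOn ℝ s F := by
  refine ⟨hs, fun x hx z hz α β hα hβ hαβ => le_of_forall_pos_le_add fun η hη => ?_⟩
  obtain ⟨F', hF', hb⟩ := H (η / 2) (by linarith)
  have h0 := hF'.2 hx hz hα hβ hαβ
  have h1 := abs_le.1 (hb x hx)
  have h2 := abs_le.1 (hb z hz)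
  have h3 := abs_le.1 (hb _ (hs hx hz hα hβ hαβ))
  simp only [smul_eq_mul] at *
  have h4 := mul_le_mul_of_nonneg_left (show F' x ≤ F x + η / 2 by linarith [h1.2]) hα
  have h5 := mul_le_mul_of_nonneg_left (show F' z ≤ F z + η / 2 by linarith [h2.2]) hβ
  have h6 : α * (η / 2) + β * (η / 2) = η / 2 := by rw [← add_mul, hαβ, one_mul]
  linarith [h3.1]

theorem abs_integral_sub_integral_le {f g : ℝ → ℝ} {p q c : ℝ} (hpq : p ≤ q)
    (hf : IntervalIntegrable f volume p q) (hg : IntervalIntegrable g volume p q)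
    (h : ∀ x ∈ Icc p q, |f x - g x| ≤ c) :
    |(∫ x in p..q, f x) - ∫ x in p..q, g x| ≤ c * (q - p) := by
  rw [← intervalIntegral.integral_sub hf hg]
  have := intervalIntegral.norm_integral_le_of_norm_le_const (a := p) (b := q) (C := c)
    (f := fun x => f x - g x) fun x hx => h x (by
      rw [uIoc_of_le hpq] at hx; exact ⟨hx.1.le, hx.2⟩)
  rwa [Real.norm_eq_abs, abs_of_nonneg (sub_nonneg.2 hpq)] at this

theorem continuous_sub_primitive_sq {f : ℝ → ℝ → ℝ} (hfc : Continuous fun p : ℝ × ℝ => f p.1 p.2)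
    (a : ℝ) : Continuous fun p : ℝ × ℝ => f p.1 p.2 - ∫ x in a..p.2, f p.1 x ^ 2 / 2 := by
  refine hfc.sub ?_
  refine intervalIntegral.continuous_parametric_intervalIntegral_of_continuous
    (f := fun p : ℝ × ℝ => fun x => f p.1 x ^ 2 / 2) ?_ continuous_snd
  have : Continuous fun q : (ℝ × ℝ) × ℝ => f q.1.1 q.2 :=
    hfc.comp (by fun_prop : Continuous fun q : (ℝ × ℝ) × ℝ => (q.1.1, q.2))
  show Continuous fun q : (ℝ × ℝ) × ℝ => f q.1.1 q.2 ^ 2 / 2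
  fun_prop

theorem continuous_primitive {f : ℝ → ℝ} (hf : Continuous f) (a : ℝ) :
    Continuous fun y => ∫ x in a..y, f x :=
  intervalIntegral.continuous_primitive (fun _ _ => hf.intervalIntegrable _ _) a

namespace IsBurgersBox

variable {v vt vy vyy f σ : ℝ → ℝ → ℝ} {τ₁ τ₂ t₁ t₂ a b B L ε η : ℝ}

theorem convexOn_integrated (h : IsBurgersBox v vt vy vyy τ₁ τ₂ a b B L)
    (h1 : τ₁ < t₁) (h12 : t₁ ≤ t₂) (h2 : t₂ < τ₂) :
    ConvexOn ℝ (Icc a b) fun y =>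
      (∫ t in t₁..t₂, (v t y - ∫ x in a..y, v t x ^ 2 / 2))
        - ∫ x in a..y, ∫ z in a..x, (v t₂ z - v t₁ z) := by
  have hB0 : 0 ≤ B := (abs_nonneg _).trans (h.bound 0 0)
  have hL0 := h.L_nonneg
  refine convexOn_of_forall_approx (convex_Icc _ _) fun θ hθ => ?_
  set Q := (|a| + |b|) with hQ
  have hQ0 : 0 ≤ Q := by positivity
  set C := (1 + B * (2 * Q)) * (t₂ - t₁) + 2 * (2 * Q) * (2 * Q) + L * (t₂ - t₁) * Q ^ 2 / 2 with hC
  have hC0 : 0 ≤ C := by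
    have : 0 ≤ t₂ - t₁ := by linarith
    positivity
  set η := θ / (C + 1) with hη'
  have hη : 0 < η := by positivity
  have hCη : η * C ≤ θ := by
    rw [hη', div_mul_eq_mul_div, div_le_iff₀ (by linarith)]
    exact mul_le_mul_of_nonneg_left (by linarith) hθ.le
  obtain ⟨ε, hε, f, σ, hf, hσ, happ⟩ := exists_isSupConv_approx h.cont h.bound h1 h12 h2 a b hη
  refine ⟨_, h.convexOn_integrated_supConv hf hε hη.le h1 h12 h2 hσ happ, fun y hy => ?_⟩
  have hfc := hf.continuous hε h.lip
  have hvc := h.cont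
  have sec : ∀ {u : ℝ → ℝ → ℝ}, (Continuous fun p : ℝ × ℝ => u p.1 p.2) → ∀ t, Continuous (u t) :=
    fun hu t => hu.comp (by fun_prop : Continuous fun x : ℝ => (t, x))
  have sect : ∀ {u : ℝ → ℝ → ℝ}, (Continuous fun p : ℝ × ℝ => u p.1 p.2) →
      ∀ y, Continuous fun t => u t y :=
    fun hu y => hu.comp (by fun_prop : Continuous fun t : ℝ => (t, y))
  have hfv : ∀ t ∈ Icc t₁ t₂, ∀ x ∈ Icc a b, |f t x - v t x| ≤ η ∧ |f t x| ≤ B := by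
    intro t ht x hx
    obtain ⟨c1, c2, c3⟩ := happ t ht x hx
    have c4 := abs_le.1 (h.bound t x)
    have c5 := abs_le.1 (h.bound (σ t x) x)
    constructor <;> rw [abs_le] <;> constructor <;> linarith [c4.1, c5.2]
  have ha := neg_abs_le a
  have hb := le_abs_self b
  have hb' := abs_nonneg b
  have ha' := abs_nonneg a
  have hlen : ∀ x ∈ Icc a b, x - a ≤ 2 * Q ∧ |x| ≤ Q := fun x hx => by
    refine ⟨by linarith [hx.2], abs_le.2 ⟨by linarith [hx.1], by linarith [hx.2]⟩⟩
  have hd1 : |(∫ t in t₁..t₂, (f t y - ∫ x in a..y, f t x ^ 2 / 2))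
      - ∫ t in t₁..t₂, (v t y - ∫ x in a..y, v t x ^ 2 / 2)|
      ≤ (η + (B * η) * (2 * Q)) * (t₂ - t₁) := by
    refine abs_integral_sub_integral_le h12
      ((sect (u := fun t y => f t y - ∫ x in a..y, f t x ^ 2 / 2)
        (continuous_sub_primitive_sq hfc a) y).intervalIntegrable _ _)
      ((sect (u := fun t y => v t y - ∫ x in a..y, v t x ^ 2 / 2)
        (continuous_sub_primitive_sq hvc a) y).intervalIntegrable _ _) fun t ht => ?_
    have c1 := (hfv t ht y hy).1
    have hf1 := sec hfc t
    have hv1 := sec hvc t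
    have c2 : |(∫ x in a..y, f t x ^ 2 / 2) - ∫ x in a..y, v t x ^ 2 / 2| ≤ (B * η) * (y - a) := by
      refine abs_integral_sub_integral_le hy.1
        (Continuous.intervalIntegrable (by fun_prop) _ _)
        (Continuous.intervalIntegrable (by fun_prop) _ _) fun x hx => ?_
      obtain ⟨d1, d2⟩ := hfv t ht x ⟨hx.1, hx.2.trans hy.2⟩
      have d3 := h.bound t x
      rw [show f t x ^ 2 / 2 - v t x ^ 2 / 2 = (f t x + v t x) / 2 * (f t x - v t x) by ring,
        abs_mul]
      refine mul_le_mul ?_ d1 (abs_nonneg _) hB0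
      rw [abs_le] at *; constructor <;> linarith [d2.1, d2.2, d3.1, d3.2]
    have c3 := mul_le_mul_of_nonneg_left (hlen y hy).1 (show 0 ≤ B * η by positivity)
    have c4 := abs_le.1 c1
    have c5 := abs_le.1 (c2.trans c3)
    rw [abs_le]; constructor <;> linarith [c4.1, c4.2, c5.1, c5.2]
  have hkf : Continuous fun z => f t₂ z - f t₁ z := (sec hfc t₂).sub (sec hfc t₁)
  have hkv : Continuous fun z => v t₂ z - v t₁ z := (sec hvc t₂).sub (sec hvc t₁)
  have hd2 : |(∫ x in a..y, ∫ z in a..x, (f t₂ z - f t₁ z))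
      - ∫ x in a..y, ∫ z in a..x, (v t₂ z - v t₁ z)| ≤ (2 * η) * (2 * Q) * (y - a) := by
    refine abs_integral_sub_integral_le hy.1
      ((continuous_primitive hkf a).intervalIntegrable _ _)
      ((continuous_primitive hkv a).intervalIntegrable _ _) fun x hx => ?_
    have hx' : x ∈ Icc a b := ⟨hx.1, hx.2.trans hy.2⟩
    have c2 : |(∫ z in a..x, (f t₂ z - f t₁ z)) - ∫ z in a..x, (v t₂ z - v t₁ z)|
        ≤ (2 * η) * (x - a) := by
      refine abs_integral_sub_integral_le hx.1 (hkf.intervalIntegrable _ _)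
        (hkv.intervalIntegrable _ _) fun z hz => ?_
      have hz' : z ∈ Icc a b := ⟨hz.1, hz.2.trans hx'.2⟩
      have c4 := abs_le.1 (hfv t₂ ⟨h12, le_rfl⟩ z hz').1
      have c5 := abs_le.1 (hfv t₁ ⟨le_rfl, h12⟩ z hz').1
      rw [abs_le]; constructor <;> linarith [c4.1, c4.2, c5.1, c5.2]
    exact c2.trans (mul_le_mul_of_nonneg_left (hlen x hx').1 (by positivity))
  have hd2' := hd2.trans (mul_le_mul_of_nonneg_left (hlen y hy).1
    (show 0 ≤ (2 * η) * (2 * Q) by positivity))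
  have hd3 : |η * L * (t₂ - t₁) * y ^ 2 / 2| ≤ η * L * (t₂ - t₁) * Q ^ 2 / 2 := by
    have h0 : 0 ≤ t₂ - t₁ := by linarith
    rw [abs_of_nonneg (by positivity)]
    have : y ^ 2 ≤ Q ^ 2 := sq_le_sq.2 (by rw [abs_of_nonneg hQ0]; exact (hlen y hy).2)
    have := mul_le_mul_of_nonneg_left this (show 0 ≤ η * L * (t₂ - t₁) by positivity)
    linarith
  have e1 := abs_le.1 hd1
  have e2 := abs_le.1 hd2'
  have e3 := abs_le.1 hd3
  have e4 : η * C = (η + (B * η) * (2 * Q)) * (t₂ - t₁) + (2 * η) * (2 * Q) * (2 * Q)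
      + η * L * (t₂ - t₁) * Q ^ 2 / 2 := by rw [hC]; ring
  rw [abs_le]; constructor <;> linarith [e1.1, e1.2, e2.1, e2.2, e3.1, e3.2]

end IsBurgersBox

theorem aestronglyMeasurable_of_hasDerivAt {α : Type*} [MeasurableSpace α] {μ : Measure α}
    {F : ℝ → α → ℝ} {F' : α → ℝ} {x₀ : ℝ} (hF : ∀ x, AEStronglyMeasurable (F x) μ)
    (hd : ∀ᵐ p ∂μ, HasDerivAt (fun x => F x p) (F' p) x₀) : AEStronglyMeasurable F' μ := by
  have h0 : Tendsto (fun n : ℕ => (1 : ℝ) / (n + 1)) atTop (𝓝[≠] 0) :=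
    tendsto_nhdsWithin_iff.2 ⟨tendsto_one_div_add_atTop_nhds_zero_nat,
      Eventually.of_forall fun n => (by positivity : (1 : ℝ) / (n + 1) ≠ 0)⟩
  refine aestronglyMeasurable_of_tendsto_ae atTop
    (f := fun (n : ℕ) p => ((1 : ℝ) / (n + 1))⁻¹ • (F (x₀ + 1 / (n + 1)) p - F x₀ p))
    (fun n => ((hF (x₀ + 1 / (n + 1))).sub (hF x₀)).const_smul ((1 : ℝ) / (n + 1))⁻¹) ?_
  filter_upwards [hd] with p hp
  exact (hasDerivAt_iff_tendsto_slope_zero.1 hp).comp h0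

namespace IsBurgersBox

variable {v vt vy vyy f σ : ℝ → ℝ → ℝ} {τ₁ τ₂ t₁ t₂ a b B L ε η : ℝ}

theorem reflect (h : IsBurgersBox v vt vy vyy τ₁ τ₂ a b B L) :
    IsBurgersBox (fun t y => -v t (-y)) (fun t y => -vt t (-y)) (fun t y => vy t (-y))
      (fun t y => -vyy t (-y)) τ₁ τ₂ (-b) (-a) B L where
  cont := (h.cont.comp (by fun_prop : Continuous fun p : ℝ × ℝ => (p.1, -p.2))).neg
  bound t y := by rw [abs_neg]; exact h.bound _ _
  lip t x y := by
    have := h.lip t (-y) (-x)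
    rw [show -y - -x = x - y by ring] at this
    rwa [show -v t (-x) - -v t (-y) = v t (-y) - v t (-x) by ring]
  L_nonneg := h.L_nonneg
  time t ht y hy := (h.time t ht (-y) ⟨by linarith [hy.2], by linarith [hy.1]⟩).neg
  space t ht y hy := by
    have := (h.space t ht (-y) ⟨by linarith [hy.2], by linarith [hy.1]⟩).neg.comp y (hasDerivAt_neg y)
    exact this.congr_deriv (by ring)
  space₂ t ht y hy := by
    have := (h.space₂ t ht (-y) ⟨by linarith [hy.2], by linarith [hy.1]⟩).comp y (hasDerivAt_neg y)
    exact this.congr_deriv (by ring)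
  pde t ht y hy := by
    have := h.pde t ht (-y) ⟨by linarith [hy.2], by linarith [hy.1]⟩
    linarith

theorem integrable_flux (h : IsBurgersBox v vt vy vyy τ₁ τ₂ a b B L)
    (h1 : τ₁ < t₁) (h12 : t₁ ≤ t₂) (h2 : t₂ < τ₂) {y : ℝ} (hy : y ∈ Ioo a b) :
    IntervalIntegrable (fun t => vy t y - v t y ^ 2 / 2) volume t₁ t₂ ∧
    HasDerivAt (fun y => ∫ t in t₁..t₂, (v t y - ∫ x in a..y, v t x ^ 2 / 2))
      (∫ t in t₁..t₂, (vy t y - v t y ^ 2 / 2)) y := by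
  have hmem : ∀ t ∈ Set.uIoc t₁ t₂, t ∈ Ioo τ₁ τ₂ := fun t ht => by
    rw [uIoc_of_le h12] at ht
    exact ⟨by linarith [ht.1], by linarith [ht.2]⟩
  have hsec : ∀ t, Continuous (v t) := fun t =>
    h.cont.comp (by fun_prop : Continuous fun x : ℝ => (t, x))
  have hsect : ∀ y, Continuous fun t => v t y := fun y =>
    h.cont.comp (by fun_prop : Continuous fun t : ℝ => (t, y))
  have hc := continuous_sub_primitive_sq h.cont a
  have hcy : ∀ y, Continuous fun t => v t y - ∫ x in a..y, v t x ^ 2 / 2 := fun y =>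
    hc.comp (by fun_prop : Continuous fun t : ℝ => (t, y))
  have hder : ∀ t ∈ Ioo τ₁ τ₂, ∀ y ∈ Ioo a b,
      HasDerivAt (fun y => v t y - ∫ x in a..y, v t x ^ 2 / 2) (vy t y - v t y ^ 2 / 2) y := by
    intro t ht y hy
    have hc2 : Continuous fun x => v t x ^ 2 / 2 := by have := hsec t; fun_prop
    exact (h.space t ht y hy).sub (intervalIntegral.integral_hasDerivAt_right
      (hc2.intervalIntegrable _ _) (hc2.stronglyMeasurableAtFilter _ _) hc2.continuousAt)
  have hB0 : 0 ≤ B := (abs_nonneg _).trans (h.bound 0 0)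
  refine intervalIntegral.hasDerivAt_integral_of_dominated_loc_of_deriv_le
    (F := fun y t => v t y - ∫ x in a..y, v t x ^ 2 / 2) (F' := fun y t => vy t y - v t y ^ 2 / 2)
    (bound := fun _ => L + B ^ 2) (Ioo_mem_nhds hy.1 hy.2)
    (Eventually.of_forall fun y => (hcy y).aestronglyMeasurable)
    ((hcy y).intervalIntegrable _ _) ?_ ?_ intervalIntegrable_const ?_
  · refine aestronglyMeasurable_of_hasDerivAt (x₀ := y)
      (F := fun y t => v t y - ∫ x in a..y, v t x ^ 2 / 2)
      (fun y => (hcy y).aestronglyMeasurable) ?_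
    rw [ae_restrict_iff' measurableSet_uIoc]
    exact Eventually.of_forall fun t ht => hder t (hmem t ht) y hy
  · refine Eventually.of_forall fun t ht x hx => ?_
    have h3 := h.abs_space_le (hmem t ht) hx
    have h4 : v t x ^ 2 ≤ B ^ 2 := sq_le_sq.2 (by rw [abs_of_nonneg hB0]; exact h.bound t x)
    have h5 := abs_le.1 h3
    rw [Real.norm_eq_abs, abs_le]
    have := sq_nonneg (v t x)
    constructor <;> linarith [h5.1, h5.2]
  · exact Eventually.of_forall fun t ht x hx => hder t (hmem t ht) x hx

theorem flux_le (h : IsBurgersBox v vt vy vyy τ₁ τ₂ a b B L)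
    (h1 : τ₁ < t₁) (h12 : t₁ ≤ t₂) (h2 : t₂ < τ₂) {x y : ℝ} (hax : a < x) (hxy : x < y)
    (hyb : y < b) :
    (∫ t in t₁..t₂, (vy t x - v t x ^ 2 / 2)) + ∫ z in x..y, (v t₂ z - v t₁ z)
      ≤ ∫ t in t₁..t₂, (vy t y - v t y ^ 2 / 2) := by
  have hF := h.convexOn_integrated h1 h12 h2
  have hkc : Continuous fun z => v t₂ z - v t₁ z :=
    (h.cont.comp (by fun_prop : Continuous fun x : ℝ => (t₂, x))).sub
      (h.cont.comp (by fun_prop : Continuous fun x : ℝ => (t₁, x)))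
  have hkc1 := continuous_primitive hkc a
  have hd : ∀ y ∈ Ioo a b, HasDerivAt (fun y =>
      (∫ t in t₁..t₂, (v t y - ∫ x in a..y, v t x ^ 2 / 2))
        - ∫ x in a..y, ∫ z in a..x, (v t₂ z - v t₁ z))
      ((∫ t in t₁..t₂, (vy t y - v t y ^ 2 / 2)) - ∫ z in a..y, (v t₂ z - v t₁ z)) y :=
    fun y hy => (h.integrable_flux h1 h12 h2 hy).2.sub (intervalIntegral.integral_hasDerivAt_right
      (hkc1.intervalIntegrable _ _) (hkc1.stronglyMeasurableAtFilter _ _) hkc1.continuousAt)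
  have hx' : x ∈ Ioo a b := ⟨hax, hxy.trans hyb⟩
  have hy' : y ∈ Ioo a b := ⟨hax.trans hxy, hyb⟩
  have l1 := hF.le_slope_of_hasDerivAt (Ioo_subset_Icc_self hx') (Ioo_subset_Icc_self hy') hxy
    (hd x hx')
  have l2 := hF.slope_le_of_hasDerivAt (Ioo_subset_Icc_self hx') (Ioo_subset_Icc_self hy') hxy
    (hd y hy')
  have l3 := l1.trans l2
  have e := intervalIntegral.integral_add_adjacent_intervals (hkc.intervalIntegrable (μ := volume) a x)
    (hkc.intervalIntegrable x y)
  linarith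

/-- The conservation law on interior rectangles. -/
theorem flux_eq (h : IsBurgersBox v vt vy vyy τ₁ τ₂ a b B L)
    (h1 : τ₁ < t₁) (h12 : t₁ ≤ t₂) (h2 : t₂ < τ₂) {x y : ℝ} (hax : a < x) (hxy : x ≤ y)
    (hyb : y < b) :
    (∫ t in t₁..t₂, (vy t x - v t x ^ 2 / 2)) + ∫ z in x..y, (v t₂ z - v t₁ z)
      = ∫ t in t₁..t₂, (vy t y - v t y ^ 2 / 2) := by
  rcases hxy.eq_or_lt with rfl | hxy
  · simp
  refine le_antisymm (h.flux_le h1 h12 h2 hax hxy hyb) ?_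
  have := h.reflect.flux_le h1 h12 h2 (x := -y) (y := -x) (by linarith) (by linarith) (by linarith)
  simp only [neg_neg, neg_sq] at this
  rw [intervalIntegral.integral_comp_neg (fun z => -v t₂ z - -v t₁ z)] at this
  simp only [neg_neg] at this
  have e : ∫ z in x..y, (-v t₂ z - -v t₁ z) = -∫ z in x..y, (v t₂ z - v t₁ z) := by
    rw [← intervalIntegral.integral_neg]; congr 1; ext z; ring
  linarith

end IsBurgersBox

/-- The retraction of the line onto `[a, b]`. -/
def clampIcc (a b x : ℝ) : ℝ := max a (min b x)

theorem clampIcc_mem {a b : ℝ} (h : a ≤ b) (x : ℝ) : clampIcc a b x ∈ Icc a b :=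
  ⟨le_max_left _ _, max_le h (min_le_left _ _)⟩

theorem clampIcc_of_mem {a b x : ℝ} (h : x ∈ Icc a b) : clampIcc a b x = x := by
  rw [clampIcc, min_eq_right h.2, max_eq_right h.1]

theorem continuous_clampIcc (a b : ℝ) : Continuous (clampIcc a b) := by
  unfold clampIcc; fun_prop

theorem abs_clampIcc_sub_le (a b x y : ℝ) : |clampIcc a b x - clampIcc a b y| ≤ |x - y| := by
  unfold clampIcc
  rw [max_comm a, max_comm a, min_comm b, min_comm b]
  refine (abs_max_sub_max_le_abs _ _ _).trans ?_
  simpa using abs_min_sub_min_le_max x b y b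

theorem clampIcc_eventuallyEq {a b x : ℝ} (h : x ∈ Ioo a b) :
    ∀ᶠ y in 𝓝 x, clampIcc a b y = y := by
  filter_upwards [Icc_mem_nhds h.1 h.2] with y hy using clampIcc_of_mem hy

/-- A function on a closed rectangle, continuous, Lipschitz in space, which solves the viscous
Burgers equation classically in the interior. -/
structure IsBurgersOn (v vt vy vyy : ℝ → ℝ → ℝ) (τ₁ τ₂ a b L : ℝ) : Prop where
  cont : ContinuousOn (fun p : ℝ × ℝ => v p.1 p.2) (Icc τ₁ τ₂ ×ˢ Icc a b)
  lip : ∀ t ∈ Icc τ₁ τ₂, ∀ x ∈ Icc a b, ∀ y ∈ Icc a b, |v t x - v t y| ≤ L * |x - y|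
  time : ∀ t ∈ Ioo τ₁ τ₂, ∀ y ∈ Ioo a b, HasDerivAt (fun s => v s y) (vt t y) t
  space : ∀ t ∈ Ioo τ₁ τ₂, ∀ y ∈ Ioo a b, HasDerivAt (fun x => v t x) (vy t y) y
  space₂ : ∀ t ∈ Ioo τ₁ τ₂, ∀ y ∈ Ioo a b, HasDerivAt (fun x => vy t x) (vyy t y) y
  pde : ∀ t ∈ Ioo τ₁ τ₂, ∀ y ∈ Ioo a b, vt t y + v t y * vy t y = vyy t y

namespace IsBurgersOn

variable {v vt vy vyy : ℝ → ℝ → ℝ} {τ₁ τ₂ a b L : ℝ}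

theorem exists_isBurgersBox (h : IsBurgersOn v vt vy vyy τ₁ τ₂ a b L) (hτ : τ₁ < τ₂) (hab : a < b) :
    ∃ B, IsBurgersBox (fun t y => v (clampIcc τ₁ τ₂ t) (clampIcc a b y)) vt vy vyy τ₁ τ₂ a b B L := by
  have hc : Continuous fun p : ℝ × ℝ => v (clampIcc τ₁ τ₂ p.1) (clampIcc a b p.2) := by
    have c1 := continuous_clampIcc τ₁ τ₂
    have c2 := continuous_clampIcc a b
    exact h.cont.comp_continuous
      (by fun_prop : Continuous fun p : ℝ × ℝ => (clampIcc τ₁ τ₂ p.1, clampIcc a b p.2))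
      fun p => ⟨clampIcc_mem hτ.le _, clampIcc_mem hab.le _⟩
  obtain ⟨B, hB⟩ := (isCompact_Icc.prod isCompact_Icc).exists_bound_of_continuousOn h.cont
  have hL : 0 ≤ L := by
    have := h.lip τ₁ ⟨le_rfl, hτ.le⟩ a ⟨le_rfl, hab.le⟩ b ⟨hab.le, le_rfl⟩
    exact nonneg_of_mul_nonneg_left ((abs_nonneg _).trans this) (abs_pos.2 (by linarith))
  have hid : ∀ t ∈ Ioo τ₁ τ₂, clampIcc τ₁ τ₂ t = t := fun t ht =>
    clampIcc_of_mem (Ioo_subset_Icc_self ht)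
  have hid' : ∀ y ∈ Ioo a b, clampIcc a b y = y := fun t ht =>
    clampIcc_of_mem (Ioo_subset_Icc_self ht)
  refine ⟨B, hc, fun t y => hB (clampIcc τ₁ τ₂ t, clampIcc a b y)
    ⟨clampIcc_mem hτ.le _, clampIcc_mem hab.le _⟩, fun t x y => ?_, hL, ?_, ?_, h.space₂, ?_⟩
  · exact (h.lip _ (clampIcc_mem hτ.le t) _ (clampIcc_mem hab.le x) _ (clampIcc_mem hab.le y)).trans
      (mul_le_mul_of_nonneg_left (abs_clampIcc_sub_le a b x y) hL)
  · intro t ht y hy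
    refine (h.time t ht y hy).congr_of_eventuallyEq ?_
    filter_upwards [clampIcc_eventuallyEq ht] with s hs
    rw [hs, hid' y hy]
  · intro t ht y hy
    refine (h.space t ht y hy).congr_of_eventuallyEq ?_
    filter_upwards [clampIcc_eventuallyEq hy] with s hs
    rw [hs, hid t ht]
  · intro t ht y hy
    rw [hid t ht, hid' y hy]
    exact h.pde t ht y hy

theorem abs_space_le (h : IsBurgersOn v vt vy vyy τ₁ τ₂ a b L) {t y : ℝ} (ht : t ∈ Ioo τ₁ τ₂)
    (hy : y ∈ Ioo a b) : |vy t y| ≤ L := by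
  obtain ⟨B, hB⟩ := h.exists_isBurgersBox (ht.1.trans ht.2) (hy.1.trans hy.2)
  exact hB.abs_space_le ht hy

/-- The conservation law on rectangles which are closed in time. -/
theorem flux_eq (h : IsBurgersOn v vt vy vyy τ₁ τ₂ a b L) (hτ : τ₁ < τ₂)
    {x y : ℝ} (hax : a < x) (hxy : x ≤ y) (hyb : y < b) :
    (∫ t in τ₁..τ₂, (vy t x - v t x ^ 2 / 2)) + ∫ z in x..y, (v τ₂ z - v τ₁ z)
      = ∫ t in τ₁..τ₂, (vy t y - v t y ^ 2 / 2) := by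
  obtain ⟨B, hB⟩ := h.exists_isBurgersBox hτ (by linarith : a < b)
  set w : ℝ → ℝ → ℝ := fun t y => v (clampIcc τ₁ τ₂ t) (clampIcc a b y) with hw
  have hintg : ∀ y ∈ Ioo a b, IntervalIntegrable (fun t => vy t y - w t y ^ 2 / 2) volume τ₁ τ₂ := by
    intro y hy
    have hwc : ∀ y, Continuous fun t => w t y := fun y =>
      hB.cont.comp (by fun_prop : Continuous fun t : ℝ => (t, y))
    have hm : AEStronglyMeasurable (fun t => vy t y) (volume.restrict (Ioo τ₁ τ₂)) := by
      refine aestronglyMeasurable_of_hasDerivAt (x₀ := y) (F := fun y t => w t y)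
        (fun y => (hwc y).aestronglyMeasurable) ?_
      rw [ae_restrict_iff' measurableSet_Ioo]
      exact Eventually.of_forall fun t ht => hB.space t ht y hy
    have hi : IntervalIntegrable (fun t => vy t y) volume τ₁ τ₂ := by
      rw [intervalIntegrable_iff_integrableOn_Ioo_of_le hτ.le]
      refine Integrable.of_bound hm L ?_
      rw [ae_restrict_iff' measurableSet_Ioo]
      exact Eventually.of_forall fun t ht => hB.abs_space_le ht hy
    have := hwc y
    exact hi.sub (Continuous.intervalIntegrable (by fun_prop) _ _)
  have hx' : x ∈ Ioo a b := ⟨hax, by linarith⟩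
  have hy' : y ∈ Ioo a b := ⟨by linarith, hyb⟩
  set δ : ℕ → ℝ := fun n => (τ₂ - τ₁) / 2 * (1 / ((n : ℝ) + 1)) with hδ
  have hδ0 : Tendsto δ atTop (𝓝 0) := by
    have := (tendsto_one_div_add_atTop_nhds_zero_nat (𝕜 := ℝ)).const_mul ((τ₂ - τ₁) / 2)
    rwa [mul_zero] at this
  have hδp : ∀ n, 0 < δ n := fun n => by
    have : 0 < τ₂ - τ₁ := by linarith
    positivity
  have hδh : ∀ n, δ n ≤ (τ₂ - τ₁) / 2 := fun n =>
    mul_le_of_le_one_right (by linarith) (by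
      rw [div_le_one (by positivity)]; linarith [Nat.cast_nonneg (α := ℝ) n])
  have t1 : Tendsto (fun n => τ₁ + δ n) atTop (𝓝 τ₁) := by simpa using hδ0.const_add τ₁
  have t2 : Tendsto (fun n => τ₂ - δ n) atTop (𝓝 τ₂) := by simpa using hδ0.const_sub τ₂
  have hmem1 : ∀ n, τ₁ + δ n ∈ Icc τ₁ τ₂ := fun n => ⟨by linarith [hδp n], by linarith [hδh n]⟩
  have hmem2 : ∀ n, τ₂ - δ n ∈ Icc τ₁ τ₂ := fun n => ⟨by linarith [hδh n], by linarith [hδp n]⟩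
  have hlim : ∀ y ∈ Ioo a b, Tendsto (fun n => ∫ t in (τ₁ + δ n)..(τ₂ - δ n),
      (vy t y - w t y ^ 2 / 2)) atTop (𝓝 (∫ t in τ₁..τ₂, (vy t y - w t y ^ 2 / 2))) := by
    intro y hy
    have hi := hintg y hy
    have hcp := intervalIntegral.continuousOn_primitive_interval (μ := volume) (a := τ₁) (b := τ₂)
      (f := fun t => vy t y - w t y ^ 2 / 2) (by
        rw [uIcc_of_le hτ.le]; exact (intervalIntegrable_iff_integrableOn_Icc_of_le hτ.le).1 hi)
    rw [uIcc_of_le hτ.le] at hcp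
    have l2 := (hcp τ₂ ⟨hτ.le, le_rfl⟩).tendsto.comp
      (tendsto_nhdsWithin_iff.2 ⟨t2, Eventually.of_forall hmem2⟩)
    have l1 := (hcp τ₁ ⟨le_rfl, hτ.le⟩).tendsto.comp
      (tendsto_nhdsWithin_iff.2 ⟨t1, Eventually.of_forall hmem1⟩)
    have l3 := l2.sub l1
    rw [intervalIntegral.integral_same, sub_zero] at l3
    refine l3.congr fun n => ?_
    simp only [Function.comp]
    have hsub : ∀ s ∈ Icc τ₁ τ₂, IntervalIntegrable (fun t => vy t y - w t y ^ 2 / 2) volume τ₁ s :=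
      fun s hs => hi.mono_set (by
        rw [uIcc_of_le hs.1, uIcc_of_le hτ.le]; exact Icc_subset_Icc_right hs.2)
    exact intervalIntegral.integral_interval_sub_left (hsub _ (hmem2 n)) (hsub _ (hmem1 n))
  have hk : Tendsto (fun n => ∫ z in x..y, (w (τ₂ - δ n) z - w (τ₁ + δ n) z)) atTop
      (𝓝 (∫ z in x..y, (w τ₂ z - w τ₁ z))) := by
    have hc : Continuous fun p : ℝ × ℝ => ∫ z in x..y, (w p.2 z - w p.1 z) := by
      refine intervalIntegral.continuous_parametric_intervalIntegral_of_continuous'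
        (f := fun (p : ℝ × ℝ) z => w p.2 z - w p.1 z) ?_ x y
      exact (hB.cont.comp (by fun_prop : Continuous fun q : (ℝ × ℝ) × ℝ => (q.1.2, q.2))).sub
        (hB.cont.comp (by fun_prop : Continuous fun q : (ℝ × ℝ) × ℝ => (q.1.1, q.2)))
    exact (hc.tendsto (τ₁, τ₂)).comp (t1.prodMk_nhds t2)
  have hmain := tendsto_nhds_unique ((hlim x hx').add hk) ((hlim y hy').congr fun n =>
    (hB.flux_eq (t₁ := τ₁ + δ n) (t₂ := τ₂ - δ n) (by linarith [hδp n]) (by linarith [hδh n])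
      (by linarith [hδp n]) hax hxy hyb).symm)
  have hwv : ∀ t ∈ Icc τ₁ τ₂, ∀ z ∈ Icc a b, w t z = v t z := fun t ht z hz => by
    simp only [hw]; rw [clampIcc_of_mem ht, clampIcc_of_mem hz]
  have e1 : ∀ y ∈ Ioo a b, ∫ t in τ₁..τ₂, (vy t y - w t y ^ 2 / 2)
      = ∫ t in τ₁..τ₂, (vy t y - v t y ^ 2 / 2) := fun y hy =>
    intervalIntegral.integral_congr fun t ht => by
      rw [uIcc_of_le hτ.le] at ht
      simp only [hwv t ht y (Ioo_subset_Icc_self hy)]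
  have e2 : ∫ z in x..y, (w τ₂ z - w τ₁ z) = ∫ z in x..y, (v τ₂ z - v τ₁ z) :=
    intervalIntegral.integral_congr fun z hz => by
      rw [uIcc_of_le hxy] at hz
      have hz' : z ∈ Icc a b := ⟨by linarith [hz.1], by linarith [hz.2]⟩
      simp only [hwv τ₂ ⟨hτ.le, le_rfl⟩ z hz', hwv τ₁ ⟨le_rfl, hτ.le⟩ z hz']
  rw [e1 x hx', e1 y hy', e2] at hmain
  exact hmain

end IsBurgersOn

/-- The concave barrier `x ↦ Λ (1 - exp (-λ x))`. -/
noncomputable def expBarrier (Λ r x : ℝ) : ℝ := Λ * (1 - exp (-(r * x)))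

theorem hasDerivAt_expBarrier (Λ r x : ℝ) :
    HasDerivAt (expBarrier Λ r) (Λ * r * exp (-(r * x))) x := by
  have h1 := ((((hasDerivAt_id x).const_mul r).neg.exp).const_sub 1).const_mul Λ
  refine h1.congr_deriv ?_
  simp; ring

theorem hasDerivAt_deriv_expBarrier (Λ r x : ℝ) :
    HasDerivAt (fun x => Λ * r * exp (-(r * x))) (-(r * (Λ * r * exp (-(r * x))))) x := by
  have h1 := (((hasDerivAt_id x).const_mul r).neg.exp).const_mul (Λ * r)
  refine h1.congr_deriv ?_
  simp; ring

theorem continuous_expBarrier (Λ r : ℝ) : Continuous (expBarrier Λ r) := by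
  unfold expBarrier; fun_prop

theorem expBarrier_le {Λ r x : ℝ} (hΛ : 0 ≤ Λ) : expBarrier Λ r x ≤ Λ * r * x := by
  have := add_one_le_exp (-(r * x))
  have h := mul_le_mul_of_nonneg_left (show 1 - exp (-(r * x)) ≤ r * x by linarith) hΛ
  unfold expBarrier
  linarith

theorem le_expBarrier {Λ r x d : ℝ} (hΛ : 0 ≤ Λ) (hr : 0 ≤ r) (hx : 0 ≤ x) (hxd : x ≤ d) :
    Λ * r * exp (-(r * d)) * x ≤ expBarrier Λ r x := by
  have h1 : exp (-(r * d)) ≤ exp (-(r * x)) :=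
    exp_le_exp.2 (neg_le_neg (mul_le_mul_of_nonneg_left hxd hr))
  have h2 := add_one_le_exp (r * x)
  have h3 : (r * x) * exp (-(r * x)) ≤ 1 - exp (-(r * x)) := by
    have := mul_le_mul_of_nonneg_right h2 (exp_pos (-(r * x))).le
    rw [← exp_add, add_neg_cancel, exp_zero] at this
    linarith
  have h4 := mul_le_mul_of_nonneg_left h1 (mul_nonneg hr hx)
  have h5 := mul_le_mul_of_nonneg_left (h4.trans h3) hΛ
  unfold expBarrier
  linarith

theorem HasDerivAt.nonneg_of_eventually_le_left {f : ℝ → ℝ} {d t : ℝ} (hf : HasDerivAt f d t)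
    (h : ∀ᶠ s in 𝓝[<] t, f s ≤ f t) : 0 ≤ d := by
  have h1 : Tendsto (slope f t) (𝓝[<] t) (𝓝 d) :=
    (hasDerivAt_iff_tendsto_slope.1 hf).mono_left (nhdsLT_le_nhdsNE t)
  refine ge_of_tendsto h1 ?_
  filter_upwards [h, self_mem_nhdsWithin] with s hs hst
  rw [slope_def_field]
  exact div_nonneg_of_nonpos (by linarith) (by linarith [show s < t from hst])

/-- Solutions of `v_t + c v_y = v_yy` between two moving curves. -/
structure IsDriftSol (v c vt vy vyy : ℝ → ℝ → ℝ) (a b : ℝ → ℝ) (T B : ℝ) : Prop where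
  cont_left : Continuous a
  cont_right : Continuous b
  le_left : ∀ t ∈ Icc 0 T, -1 ≤ a t
  lt : ∀ t ∈ Icc 0 T, a t < b t
  right_le : ∀ t ∈ Icc 0 T, b t ≤ 1
  cont : ContinuousOn (fun p : ℝ × ℝ => v p.1 p.2) (Icc 0 T ×ˢ Icc (-1) 1)
  bound : ∀ t ∈ Icc 0 T, ∀ y ∈ Icc (-1 : ℝ) 1, |v t y| ≤ B
  drift : ∀ t ∈ Icc 0 T, ∀ y ∈ Icc (-1 : ℝ) 1, |c t y| ≤ B
  time : ∀ t ∈ Icc 0 T, ∀ y ∈ Ioo (a t) (b t), HasDerivAt (fun s => v s y) (vt t y) t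
  space : ∀ t ∈ Icc 0 T, ∀ y ∈ Ioo (a t) (b t), HasDerivAt (fun x => v t x) (vy t y) y
  space₂ : ∀ t ∈ Icc 0 T, ∀ y ∈ Ioo (a t) (b t), HasDerivAt (fun x => vy t x) (vyy t y) y
  pde : ∀ t ∈ Icc 0 T, ∀ y ∈ Ioo (a t) (b t), vt t y + c t y * vy t y = vyy t y

namespace IsDriftSol

variable {v c vt vy vyy : ℝ → ℝ → ℝ} {a b : ℝ → ℝ} {T B : ℝ}

theorem neg (h : IsDriftSol v c vt vy vyy a b T B) :
    IsDriftSol (fun t y => -v t y) c (fun t y => -vt t y) (fun t y => -vy t y)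
      (fun t y => -vyy t y) a b T B where
  cont_left := h.cont_left
  cont_right := h.cont_right
  le_left := h.le_left
  lt := h.lt
  right_le := h.right_le
  cont := h.cont.neg
  bound t ht y hy := by rw [abs_neg]; exact h.bound t ht y hy
  drift := h.drift
  time t ht y hy := (h.time t ht y hy).neg
  space t ht y hy := (h.space t ht y hy).neg
  space₂ t ht y hy := (h.space₂ t ht y hy).neg
  pde t ht y hy := by have := h.pde t ht y hy; linarith

theorem reflect (h : IsDriftSol v c vt vy vyy a b T B) :
    IsDriftSol (fun t y => v t (-y)) (fun t y => -c t (-y)) (fun t y => vt t (-y))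
      (fun t y => -vy t (-y)) (fun t y => vyy t (-y)) (fun t => -b t) (fun t => -a t) T B where
  cont_left := h.cont_right.neg
  cont_right := h.cont_left.neg
  le_left t ht := by linarith [h.right_le t ht]
  lt t ht := by linarith [h.lt t ht]
  right_le t ht := by linarith [h.le_left t ht]
  cont := h.cont.comp (by fun_prop : Continuous fun p : ℝ × ℝ => (p.1, -p.2)).continuousOn
    fun p hp => ⟨hp.1, by linarith [hp.2.2], by linarith [hp.2.1]⟩
  bound t ht y hy := h.bound t ht (-y) ⟨by linarith [hy.2], by linarith [hy.1]⟩
  drift t ht y hy := by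
    rw [abs_neg]; exact h.drift t ht (-y) ⟨by linarith [hy.2], by linarith [hy.1]⟩
  time t ht y hy := h.time t ht (-y) ⟨by linarith [hy.2], by linarith [hy.1]⟩
  space t ht y hy := by
    have := (h.space t ht (-y) ⟨by linarith [hy.2], by linarith [hy.1]⟩).comp y (hasDerivAt_neg y)
    exact this.congr_deriv (by ring)
  space₂ t ht y hy := by
    have := ((h.space₂ t ht (-y) ⟨by linarith [hy.2], by linarith [hy.1]⟩).comp y
      (hasDerivAt_neg y)).neg
    exact this.congr_deriv (by ring)
  pde t ht y hy := by
    have := h.pde t ht (-y) ⟨by linarith [hy.2], by linarith [hy.1]⟩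
    linarith

theorem mem_Icc (h : IsDriftSol v c vt vy vyy a b T B) {t y : ℝ} (ht : t ∈ Icc 0 T)
    (hy : y ∈ Icc (a t) (b t)) : y ∈ Icc (-1 : ℝ) 1 :=
  ⟨(h.le_left t ht).trans hy.1, hy.2.trans (h.right_le t ht)⟩

theorem eventually_space (h : IsDriftSol v c vt vy vyy a b T B) {t y : ℝ} (ht : t ∈ Icc 0 T)
    (hy : y ∈ Ioo (a t) (b t)) : ∀ᶠ x in 𝓝 y, HasDerivAt (fun x => v t x) (vy t x) x := by
  filter_upwards [Ioo_mem_nhds hy.1 hy.2] with x hx using h.space t ht x hx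

theorem eventually_mem (h : IsDriftSol v c vt vy vyy a b T B) {t y : ℝ}
    (hy : y ∈ Ioo (a t) (b t)) : ∀ᶠ s in 𝓝 t, y ∈ Ioo (a s) (b s) :=
  (h.cont_left.continuousAt.eventually (gt_mem_nhds hy.1)).and
    (h.cont_right.continuousAt.eventually (lt_mem_nhds hy.2))

/-- The barrier estimate at the left curve. -/
theorem sub_le_expBarrier (h : IsDriftSol v c vt vy vyy a b T B) {a' α α' : ℝ → ℝ} {G L₀ Λ r : ℝ}
    (ha : ∀ t ∈ Icc 0 T, HasDerivAt a (a' t) t) (hα : ∀ t ∈ Icc 0 T, HasDerivAt α (α' t) t)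
    (ha' : ∀ t ∈ Icc 0 T, |a' t| ≤ B) (hα' : ∀ t ∈ Icc 0 T, |α' t| ≤ G)
    (hval : ∀ t ∈ Icc 0 T, v t (a t) = α t)
    (hinit : ∀ y ∈ Icc (a 0) (b 0), v 0 y - α 0 ≤ L₀ * (y - a 0))
    (hd : ∀ t ∈ Icc 0 T, 2 * B ≤ expBarrier Λ r (b t - a t))
    (hΛ : 0 < Λ) (hr : r = 2 * B + 1) (hL₀ : L₀ ≤ Λ * r * exp (-(r * 2)))
    (hG : G < Λ * r * exp (-(r * 2))) {t y : ℝ} (ht : t ∈ Icc 0 T) (hy : y ∈ Icc (a t) (b t)) :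
    v t y - α t ≤ expBarrier Λ r (y - a t) := by
  have hB0 : 0 ≤ B := (abs_nonneg _).trans (ha' t ht)
  have hr0 : 0 < r := by linarith
  have hαc : ContinuousOn α (Icc 0 T) := fun t ht => (hα t ht).continuousAt.continuousWithinAt
  set w : ℝ × ℝ → ℝ := fun p => v p.1 p.2 - α p.1 - expBarrier Λ r (p.2 - a p.1) with hw
  set R : Set (ℝ × ℝ) := {p | p ∈ Icc 0 T ×ˢ Icc (-1 : ℝ) 1 ∧ a p.1 ≤ p.2 ∧ p.2 ≤ b p.1} with hR
  have hac := h.cont_left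
  have hbc := h.cont_right
  have hRc : IsCompact R := by
    refine (isCompact_Icc.prod isCompact_Icc).inter_right (t := {p : ℝ × ℝ | a p.1 ≤ p.2 ∧ p.2 ≤ b p.1}) ?_
    exact (isClosed_le (f := fun p : ℝ × ℝ => a p.1) (g := fun p => p.2)
      (by fun_prop) (by fun_prop)).inter
      (isClosed_le (f := fun p : ℝ × ℝ => p.2) (g := fun p => b p.1) (by fun_prop) (by fun_prop))
  have hwc : ContinuousOn w R := by
    refine ((h.cont.mono fun p hp => hp.1).sub (hαc.comp continuousOn_fst fun p hp => hp.1.1)).sub ?_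
    have := continuous_expBarrier Λ r
    exact Continuous.continuousOn (by fun_prop)
  have hmemR : (t, y) ∈ R := ⟨⟨ht, h.mem_Icc ht hy⟩, hy.1, hy.2⟩
  obtain ⟨⟨t₀, y₀⟩, hp, hmax⟩ := hRc.exists_isMaxOn ⟨_, hmemR⟩ hwc
  by_contra! hcon
  have hpos : 0 < w (t₀, y₀) := lt_of_lt_of_le (by simp only [hw]; linarith) (hmax hmemR)
  obtain ⟨⟨ht₀, hy₁⟩, hya, hyb⟩ := hp
  simp only at ht₀ hy₁ hya hyb
  have hlen : y₀ - a t₀ ≤ 2 := by linarith [h.le_left t₀ ht₀, hy₁.2]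
  have hya' : a t₀ < y₀ := by
    refine lt_of_le_of_ne hya fun e => ?_
    simp only [hw, ← e, hval t₀ ht₀, sub_self] at hpos
    simp [expBarrier] at hpos
  have hyb' : y₀ < b t₀ := by
    refine lt_of_le_of_ne hyb fun e => ?_
    have h1 := hd t₀ ht₀
    have h2 := abs_le.1 (h.bound t₀ ht₀ y₀ hy₁)
    have h3 := abs_le.1 (h.bound t₀ ht₀ (a t₀) (h.mem_Icc ht₀ ⟨le_rfl, (h.lt t₀ ht₀).le⟩))
    rw [hval t₀ ht₀] at h3
    rw [← e] at h1
    simp only [hw] at hpos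
    linarith [h2.2, h3.1]
  have ht₀' : 0 < t₀ := by
    refine lt_of_le_of_ne ht₀.1 fun e => ?_
    subst e
    have h1 := hinit y₀ ⟨hya, hyb⟩
    have h2 := le_expBarrier (x := y₀ - a 0) hΛ.le hr0.le (by linarith) hlen
    have h3 := mul_le_mul_of_nonneg_right hL₀ (show 0 ≤ y₀ - a 0 by linarith)
    simp only [hw] at hpos
    linarith
  have hy₀ : y₀ ∈ Ioo (a t₀) (b t₀) := ⟨hya', hyb'⟩
  set D := Λ * r * exp (-(r * (y₀ - a t₀))) with hD
  have hφ := hasDerivAt_expBarrier Λ r (y₀ - a t₀)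
  have hφ' : ∀ x, HasDerivAt (fun x => expBarrier Λ r (x - a t₀))
      (Λ * r * exp (-(r * (x - a t₀)))) x := fun x => by
    have e := (hasDerivAt_expBarrier Λ r (x - a t₀)).comp x ((hasDerivAt_id x).sub_const (a t₀))
    rwa [mul_one] at e
  have hφ'' : HasDerivAt (fun x => Λ * r * exp (-(r * (x - a t₀)))) (-(r * D)) y₀ := by
    have e := (hasDerivAt_deriv_expBarrier Λ r (y₀ - a t₀)).comp y₀
      ((hasDerivAt_id y₀).sub_const (a t₀))
    rwa [mul_one] at e
  have hmaxy : IsLocalMax (fun x => v t₀ x - expBarrier Λ r (x - a t₀)) y₀ := by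
    filter_upwards [Ioo_mem_nhds hya' hyb'] with x hx
    have : w (t₀, x) ≤ w (t₀, y₀) := hmax (show (t₀, x) ∈ R from
      ⟨⟨ht₀, h.mem_Icc ht₀ ⟨hx.1.le, hx.2.le⟩⟩, hx.1.le, hx.2.le⟩)
    simp only [hw] at this
    linarith
  have hvy : vy t₀ y₀ = D := by
    have := hmaxy.hasDerivAt_eq_zero ((h.space t₀ ht₀ y₀ hy₀).sub (hφ' y₀))
    linarith
  have hvyy : vyy t₀ y₀ ≤ -(r * D) := by
    have := secondDeriv_nonpos_of_isLocalMax hmaxy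
      (F' := fun x => vy t₀ x - Λ * r * exp (-(r * (x - a t₀))))
      ((h.eventually_space ht₀ hy₀).mono fun x hx => hx.sub (hφ' x))
      ((h.space₂ t₀ ht₀ y₀ hy₀).sub hφ'')
    linarith
  have htime : 0 ≤ vt t₀ y₀ - α' t₀ + D * a' t₀ := by
    have hder : HasDerivAt (fun s => v s y₀ - α s - expBarrier Λ r (y₀ - a s))
        (vt t₀ y₀ - α' t₀ + D * a' t₀) t₀ := by
      have e := (hφ.comp t₀ ((ha t₀ ht₀).const_sub y₀))
      exact (((h.time t₀ ht₀ y₀ hy₀).sub (hα t₀ ht₀)).sub e).congr_deriv (by rw [hD]; ring)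
    refine hder.nonneg_of_eventually_le_left ?_
    filter_upwards [(h.eventually_mem hy₀).filter_mono nhdsWithin_le_nhds,
      Ioo_mem_nhdsLT ht₀'] with s hs hs'
    exact hmax (show (s, y₀) ∈ R from ⟨⟨⟨hs'.1.le, hs'.2.le.trans ht₀.2⟩, hy₁⟩, hs.1.le, hs.2.le⟩)
  have hDge : Λ * r * exp (-(r * 2)) ≤ D := by
    refine mul_le_mul_of_nonneg_left (exp_le_exp.2 ?_) (by positivity)
    linarith [mul_le_mul_of_nonneg_left hlen hr0.le]
  have hD0 : 0 < D := lt_of_lt_of_le (by positivity) hDge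
  have hpde := h.pde t₀ ht₀ y₀ hy₀
  rw [hvy] at hpde
  have k1 := mul_le_mul_of_nonneg_right (abs_le.1 (h.drift t₀ ht₀ y₀ hy₁)).1 hD0.le
  have k2 := mul_le_mul_of_nonneg_left (abs_le.1 (ha' t₀ ht₀)).2 hD0.le
  have k3 := (abs_le.1 (hα' t₀ ht₀)).1
  rw [hr] at hvyy
  linarith

theorem exists_left_bound (h : IsDriftSol v c vt vy vyy a b T B) {a' α α' : ℝ → ℝ} {L₀ : ℝ}
    (hT : 0 ≤ T)
    (ha : ∀ t ∈ Icc 0 T, HasDerivAt a (a' t) t) (hα : ∀ t ∈ Icc 0 T, HasDerivAt α (α' t) t)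
    (ha' : ∀ t ∈ Icc 0 T, |a' t| ≤ B) (hα' : Continuous α')
    (hval : ∀ t ∈ Icc 0 T, v t (a t) = α t)
    (hinit : ∀ y ∈ Icc (a 0) (b 0), v 0 y - α 0 ≤ L₀ * (y - a 0)) :
    ∃ L, 0 ≤ L ∧ ∀ t ∈ Icc 0 T, ∀ y ∈ Icc (a t) (b t), v t y - v t (a t) ≤ L * (y - a t) := by
  have h0 : (0 : ℝ) ∈ Icc 0 T := ⟨le_rfl, hT⟩
  have hB0 : 0 ≤ B := (abs_nonneg _).trans (ha' 0 h0)
  obtain ⟨G, hG⟩ := isCompact_Icc.exists_bound_of_continuousOn (hα'.continuousOn (s := Icc 0 T))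
  have hG0 : 0 ≤ G := (norm_nonneg _).trans (hG 0 h0)
  obtain ⟨s, hs, hmin⟩ := isCompact_Icc.exists_isMinOn ⟨0, h0⟩
    ((h.cont_right.sub h.cont_left).continuousOn (s := Icc 0 T))
  set d := b s - a s with hd
  have hd0 : 0 < d := sub_pos.2 (h.lt s hs)
  set r := 2 * B + 1 with hr
  have hr0 : 0 < r := by linarith
  have hexp : exp (-(r * d)) < 1 := by
    rw [← Real.exp_zero]; exact Real.exp_lt_exp.2 (by linarith [mul_pos hr0 hd0])
  set E := r * exp (-(r * 2)) with hE
  have hE0 : 0 < E := mul_pos hr0 (exp_pos _)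
  set Λ := (|L₀| + G + 1) / E + 2 * B / (1 - exp (-(r * d))) with hΛ
  have hq0 : 0 ≤ 2 * B / (1 - exp (-(r * d))) := div_nonneg (by linarith) (by linarith)
  have hp0 : 0 < (|L₀| + G + 1) / E := by positivity
  have hΛ0 : 0 < Λ := by linarith
  have hΛE : |L₀| + G + 1 ≤ Λ * r * exp (-(r * 2)) := by
    have : (|L₀| + G + 1) / E * E ≤ Λ * E := mul_le_mul_of_nonneg_right (by linarith) hE0.le
    rw [div_mul_cancel₀ _ hE0.ne', hE] at this
    linarith
  have hbar : ∀ t ∈ Icc 0 T, 2 * B ≤ expBarrier Λ r (b t - a t) := by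
    intro t ht
    have h1 : d ≤ b t - a t := hmin ht
    have h2 : exp (-(r * (b t - a t))) ≤ exp (-(r * d)) :=
      exp_le_exp.2 (neg_le_neg (mul_le_mul_of_nonneg_left h1 hr0.le))
    have h3 : 2 * B / (1 - exp (-(r * d))) * (1 - exp (-(r * d)))
        ≤ Λ * (1 - exp (-(r * (b t - a t)))) :=
      mul_le_mul (by linarith) (by linarith) (by linarith) hΛ0.le
    rwa [div_mul_cancel₀ _ (by linarith)] at h3
  refine ⟨Λ * r, by positivity, fun t ht y hy => ?_⟩
  have := h.sub_le_expBarrier (G := G) (L₀ := L₀) (Λ := Λ) ha hα ha' hG hval hinit hbar hΛ0 hr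
    (by linarith [le_abs_self L₀]) (by linarith [abs_nonneg L₀]) ht hy
  rw [hval t ht]
  exact this.trans (expBarrier_le hΛ0.le)

/-- Doubling of variables: boundary and initial one-sided Lipschitz bounds propagate inside. -/
theorem sub_le_expBarrier_of_boundary (h : IsDriftSol v c vt vy vyy a b T B) {L₀ Λ r : ℝ}
    (hB0 : 0 ≤ B) (hΛ : 0 < Λ) (hr : r = 2 * B + 1) (hL₀ : L₀ ≤ Λ * r * exp (-(r * 2)))
    (hleft : ∀ t ∈ Icc 0 T, ∀ y ∈ Icc (a t) (b t), v t y - v t (a t) ≤ L₀ * (y - a t))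
    (hright : ∀ t ∈ Icc 0 T, ∀ y ∈ Icc (a t) (b t), v t (b t) - v t y ≤ L₀ * (b t - y))
    (hinit : ∀ x ∈ Icc (a 0) (b 0), ∀ y ∈ Icc (a 0) (b 0), x ≤ y → v 0 y - v 0 x ≤ L₀ * (y - x))
    {t x y : ℝ} (ht : t ∈ Icc 0 T) (hx : a t ≤ x) (hxy : x ≤ y) (hy : y ≤ b t) :
    v t y - v t x ≤ expBarrier Λ r (y - x) := by
  have hr0 : 0 < r := by linarith
  set w : ℝ × ℝ × ℝ → ℝ := fun p => v p.1 p.2.2 - v p.1 p.2.1 - expBarrier Λ r (p.2.2 - p.2.1)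
    with hw
  set R : Set (ℝ × ℝ × ℝ) := {p | p ∈ Icc 0 T ×ˢ Icc (-1 : ℝ) 1 ×ˢ Icc (-1 : ℝ) 1 ∧
    a p.1 ≤ p.2.1 ∧ p.2.1 ≤ p.2.2 ∧ p.2.2 ≤ b p.1} with hR
  have hac := h.cont_left
  have hbc := h.cont_right
  have hRc : IsCompact R := by
    refine (isCompact_Icc.prod (isCompact_Icc.prod isCompact_Icc)).inter_right
      (t := {p : ℝ × ℝ × ℝ | a p.1 ≤ p.2.1 ∧ p.2.1 ≤ p.2.2 ∧ p.2.2 ≤ b p.1}) ?_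
    exact (isClosed_le (f := fun p : ℝ × ℝ × ℝ => a p.1) (g := fun p => p.2.1)
      (by fun_prop) (by fun_prop)).inter
      ((isClosed_le (f := fun p : ℝ × ℝ × ℝ => p.2.1) (g := fun p => p.2.2)
        (by fun_prop) (by fun_prop)).inter
      (isClosed_le (f := fun p : ℝ × ℝ × ℝ => p.2.2) (g := fun p => b p.1)
        (by fun_prop) (by fun_prop)))
  have hwc : ContinuousOn w R := by
    refine ((h.cont.comp (f := fun p : ℝ × ℝ × ℝ => (p.1, p.2.2)) (by fun_prop)
      fun p hp => ⟨hp.1.1, hp.1.2.2⟩).sub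
      (h.cont.comp (f := fun p : ℝ × ℝ × ℝ => (p.1, p.2.1)) (by fun_prop)
      fun p hp => ⟨hp.1.1, hp.1.2.1⟩)).sub ?_
    have := continuous_expBarrier Λ r
    exact Continuous.continuousOn (by fun_prop)
  have hmk : ∀ {t x y}, t ∈ Icc 0 T → a t ≤ x → x ≤ y → y ≤ b t → (t, x, y) ∈ R :=
    fun ht hx hxy hy => ⟨⟨ht, h.mem_Icc ht ⟨hx, hxy.trans hy⟩, h.mem_Icc ht ⟨hx.trans hxy, hy⟩⟩,
      hx, hxy, hy⟩
  have hmemR := hmk ht hx hxy hy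
  obtain ⟨⟨t₀, x₀, y₀⟩, hp, hmax⟩ := hRc.exists_isMaxOn ⟨_, hmemR⟩ hwc
  by_contra! hcon
  have hpos : 0 < w (t₀, x₀, y₀) := lt_of_lt_of_le (by simp only [hw]; linarith) (hmax hmemR)
  obtain ⟨⟨ht₀, hx₁, hy₁⟩, hxa, hxy₀, hyb⟩ := hp
  simp only at ht₀ hx₁ hy₁ hxa hxy₀ hyb
  have hlen : y₀ - x₀ ≤ 2 := by linarith [hx₁.1, hy₁.2]
  have hle : L₀ * (y₀ - x₀) ≤ expBarrier Λ r (y₀ - x₀) :=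
    (mul_le_mul_of_nonneg_right hL₀ (by linarith)).trans
      (le_expBarrier hΛ.le hr0.le (by linarith) hlen)
  have hpos' : expBarrier Λ r (y₀ - x₀) < v t₀ y₀ - v t₀ x₀ := by
    simp only [hw] at hpos; linarith
  have hne : x₀ < y₀ := by
    refine lt_of_le_of_ne hxy₀ fun e => ?_
    rw [e] at hpos'
    simp [expBarrier] at hpos'
  have hxa' : a t₀ < x₀ := by
    refine lt_of_le_of_ne hxa fun e => ?_
    have := hleft t₀ ht₀ y₀ ⟨hxa.trans hxy₀, hyb⟩
    rw [e] at this
    linarith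
  have hyb' : y₀ < b t₀ := by
    refine lt_of_le_of_ne hyb fun e => ?_
    have := hright t₀ ht₀ x₀ ⟨hxa, hxy₀.trans hyb⟩
    rw [← e] at this
    linarith
  have ht₀' : 0 < t₀ := by
    refine lt_of_le_of_ne ht₀.1 fun e => ?_
    subst e
    have := hinit x₀ ⟨hxa, hxy₀.trans hyb⟩ y₀ ⟨hxa.trans hxy₀, hyb⟩ hxy₀
    linarith
  have hx₀ : x₀ ∈ Ioo (a t₀) (b t₀) := ⟨hxa', hne.trans hyb'⟩
  have hy₀ : y₀ ∈ Ioo (a t₀) (b t₀) := ⟨hxa'.trans hne, hyb'⟩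
  set D := Λ * r * exp (-(r * (y₀ - x₀))) with hD
  have hD0 : 0 < D := by positivity
  have hmaxy : IsLocalMax (fun y => v t₀ y - expBarrier Λ r (y - x₀)) y₀ := by
    filter_upwards [Ioo_mem_nhds hne hyb'] with y hy
    have : w (t₀, x₀, y) ≤ w (t₀, x₀, y₀) := hmax (hmk ht₀ hxa hy.1.le hy.2.le)
    simp only [hw] at this
    linarith
  have hmaxx : IsLocalMax (fun x => -v t₀ x - expBarrier Λ r (y₀ - x)) x₀ := by
    filter_upwards [Ioo_mem_nhds hxa' hne] with x hx
    have : w (t₀, x, y₀) ≤ w (t₀, x₀, y₀) := hmax (hmk ht₀ hx.1.le hx.2.le hyb)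
    simp only [hw] at this
    linarith
  have dy1 : ∀ y, HasDerivAt (fun y => expBarrier Λ r (y - x₀))
      (Λ * r * exp (-(r * (y - x₀)))) y := fun y => by
    have e := (hasDerivAt_expBarrier Λ r (y - x₀)).comp y ((hasDerivAt_id y).sub_const x₀)
    rwa [mul_one] at e
  have dy2 : HasDerivAt (fun y => Λ * r * exp (-(r * (y - x₀)))) (-(r * D)) y₀ := by
    have e := (hasDerivAt_deriv_expBarrier Λ r (y₀ - x₀)).comp y₀ ((hasDerivAt_id y₀).sub_const x₀)
    rwa [mul_one] at e
  have dx1 : ∀ x, HasDerivAt (fun x => expBarrier Λ r (y₀ - x))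
      (-(Λ * r * exp (-(r * (y₀ - x))))) x := fun x => by
    have e := (hasDerivAt_expBarrier Λ r (y₀ - x)).comp x ((hasDerivAt_id x).const_sub y₀)
    rwa [mul_neg_one] at e
  have dx2 : HasDerivAt (fun x => -(Λ * r * exp (-(r * (y₀ - x))))) (-(r * D)) x₀ := by
    have e := ((hasDerivAt_deriv_expBarrier Λ r (y₀ - x₀)).comp x₀
      ((hasDerivAt_id x₀).const_sub y₀)).neg
    rwa [mul_neg_one, neg_neg] at e
  have hvy : vy t₀ y₀ = D := by
    have := hmaxy.hasDerivAt_eq_zero ((h.space t₀ ht₀ y₀ hy₀).sub (dy1 y₀))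
    linarith
  have hvx : vy t₀ x₀ = D := by
    have := hmaxx.hasDerivAt_eq_zero ((h.space t₀ ht₀ x₀ hx₀).neg.sub (dx1 x₀))
    linarith
  have hvyy : vyy t₀ y₀ ≤ -(r * D) := by
    have := secondDeriv_nonpos_of_isLocalMax hmaxy
      ((h.eventually_space ht₀ hy₀).mono fun y hy => hy.sub (dy1 y))
      ((h.space₂ t₀ ht₀ y₀ hy₀).sub dy2)
    linarith
  have hvxx : r * D ≤ vyy t₀ x₀ := by
    have := secondDeriv_nonpos_of_isLocalMax hmaxx
      ((h.eventually_space ht₀ hx₀).mono fun x hx => hx.neg.sub (dx1 x))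
      ((h.space₂ t₀ ht₀ x₀ hx₀).neg.sub dx2)
    linarith
  have htime : 0 ≤ vt t₀ y₀ - vt t₀ x₀ := by
    refine ((h.time t₀ ht₀ y₀ hy₀).sub (h.time t₀ ht₀ x₀ hx₀)).nonneg_of_eventually_le_left ?_
    filter_upwards [(h.eventually_mem hy₀).filter_mono nhdsWithin_le_nhds,
      (h.eventually_mem hx₀).filter_mono nhdsWithin_le_nhds, Ioo_mem_nhdsLT ht₀'] with s hs hs' hs''
    have : w (s, x₀, y₀) ≤ w (t₀, x₀, y₀) :=
      hmax (hmk ⟨hs''.1.le, hs''.2.le.trans ht₀.2⟩ hs'.1.le hxy₀ hs.2.le)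
    simp only [hw] at this
    simp only [Pi.sub_apply]
    linarith
  have p1 := h.pde t₀ ht₀ y₀ hy₀
  have p2 := h.pde t₀ ht₀ x₀ hx₀
  rw [hvy] at p1
  rw [hvx] at p2
  have k1 := mul_le_mul_of_nonneg_right (abs_le.1 (h.drift t₀ ht₀ y₀ hy₁)).1 hD0.le
  have k2 := mul_le_mul_of_nonneg_right (abs_le.1 (h.drift t₀ ht₀ x₀ hx₁)).2 hD0.le
  have k3 := mul_nonneg hB0 hD0.le
  rw [hr] at hvyy hvxx
  linarith

/-- Uniform spatial Lipschitz bound. -/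
theorem exists_lipschitz (h : IsDriftSol v c vt vy vyy a b T B) {a' b' α β α' β' : ℝ → ℝ} {L₀ : ℝ}
    (hT : 0 ≤ T)
    (ha : ∀ t ∈ Icc 0 T, HasDerivAt a (a' t) t) (hb : ∀ t ∈ Icc 0 T, HasDerivAt b (b' t) t)
    (hα : ∀ t ∈ Icc 0 T, HasDerivAt α (α' t) t) (hβ : ∀ t ∈ Icc 0 T, HasDerivAt β (β' t) t)
    (ha' : ∀ t ∈ Icc 0 T, |a' t| ≤ B) (hb' : ∀ t ∈ Icc 0 T, |b' t| ≤ B)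
    (hα' : Continuous α') (hβ' : Continuous β')
    (hvala : ∀ t ∈ Icc 0 T, v t (a t) = α t) (hvalb : ∀ t ∈ Icc 0 T, v t (b t) = β t)
    (hinit : ∀ x ∈ Icc (a 0) (b 0), ∀ y ∈ Icc (a 0) (b 0), |v 0 x - v 0 y| ≤ L₀ * |x - y|) :
    ∃ L, 0 ≤ L ∧ ∀ t ∈ Icc 0 T, ∀ x ∈ Icc (a t) (b t), ∀ y ∈ Icc (a t) (b t),
      |v t x - v t y| ≤ L * |x - y| := by
  have h0 : (0 : ℝ) ∈ Icc 0 T := ⟨le_rfl, hT⟩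
  have hB0 : 0 ≤ B := (abs_nonneg _).trans (ha' 0 h0)
  have hab := (h.lt 0 h0).le
  have i1 : ∀ y ∈ Icc (a 0) (b 0), |v 0 y - v 0 (a 0)| ≤ L₀ * (y - a 0) := fun y hy => by
    have := hinit y hy (a 0) ⟨le_rfl, hab⟩
    rwa [abs_of_nonneg (sub_nonneg.2 hy.1)] at this
  have i2 : ∀ y ∈ Icc (a 0) (b 0), |v 0 (b 0) - v 0 y| ≤ L₀ * (b 0 - y) := fun y hy => by
    have := hinit (b 0) ⟨hab, le_rfl⟩ y hy
    rwa [abs_of_nonneg (sub_nonneg.2 hy.2)] at this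
  obtain ⟨L1, hL1, H1⟩ := h.exists_left_bound (L₀ := L₀) hT ha hα ha' hα' hvala
    fun y hy => by rw [← hvala 0 h0]; exact (abs_le.1 (i1 y hy)).2
  obtain ⟨L2, hL2, H2⟩ := h.neg.exists_left_bound (L₀ := L₀) (α := fun t => -α t) hT ha
    (fun t ht => (hα t ht).neg) ha' hα'.neg (fun t ht => by rw [hvala t ht])
    fun y hy => by rw [← hvala 0 h0]; linarith [(abs_le.1 (i1 y hy)).1]
  have hnb : ∀ t ∈ Icc 0 T, |(-b') t| ≤ B := fun t ht => by
    rw [Pi.neg_apply, abs_neg]; exact hb' t ht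
  obtain ⟨L3, hL3, H3⟩ := h.reflect.exists_left_bound (L₀ := L₀) (a' := -b') (α := β) hT
    (fun t ht => (hb t ht).neg) hβ hnb hβ'
    (fun t ht => by rw [neg_neg, hvalb t ht])
    fun y hy => by
      rw [← hvalb 0 h0]
      linarith [(abs_le.1 (i2 (-y) ⟨by linarith [hy.2], by linarith [hy.1]⟩)).1]
  obtain ⟨L4, hL4, H4⟩ := h.reflect.neg.exists_left_bound (L₀ := L₀) (a' := -b')
    (α := fun t => -β t) hT
    (fun t ht => (hb t ht).neg) (fun t ht => (hβ t ht).neg) hnb hβ'.neg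
    (fun t ht => by rw [neg_neg, hvalb t ht])
    fun y hy => by
      rw [← hvalb 0 h0]
      linarith [(abs_le.1 (i2 (-y) ⟨by linarith [hy.2], by linarith [hy.1]⟩)).2]
  set Q := |L₀| + L1 + L2 + L3 + L4 + 1 with hQ
  have hQ0 : 0 < Q := by positivity
  set r := 2 * B + 1 with hr
  have hr0 : 0 < r := by linarith
  set Λ := Q / (r * exp (-(r * 2))) with hΛ
  have hE0 : 0 < r * exp (-(r * 2)) := by positivity
  have hΛ0 : 0 < Λ := by positivity
  have hQΛ : Q ≤ Λ * r * exp (-(r * 2)) := by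
    rw [mul_assoc, hΛ, div_mul_cancel₀ _ hE0.ne']
  have mono : ∀ {M z : ℝ}, M ≤ Q → 0 ≤ z → M * z ≤ Q * z := fun h1 h2 =>
    mul_le_mul_of_nonneg_right h1 h2
  have l0 : L₀ ≤ Q := by linarith [le_abs_self L₀]
  have aL := abs_nonneg L₀
  have key : ∀ t ∈ Icc 0 T, ∀ x y, a t ≤ x → x ≤ y → y ≤ b t →
      |v t y - v t x| ≤ Λ * r * (y - x) := by
    intro t ht x y hx hxy hy
    have u1 := h.sub_le_expBarrier_of_boundary (L₀ := Q) hB0 hΛ0 hr hQΛ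
      (fun t ht y hy => (H1 t ht y hy).trans (mono (by linarith) (by linarith [hy.1])))
      (fun t ht y hy => by
        have := H4 t ht (-y) ⟨by linarith [hy.2], by linarith [hy.1]⟩
        simp only [neg_neg] at this
        have k := mono (M := L4) (z := b t - y) (by linarith) (by linarith [hy.2])
        linarith)
      (fun x hx y hy hxy => by
        have := (abs_le.1 (hinit y hy x hx)).2
        rw [abs_of_nonneg (by linarith)] at this
        exact this.trans (mono l0 (by linarith))) ht hx hxy hy
    have u2 := h.neg.sub_le_expBarrier_of_boundary (L₀ := Q) hB0 hΛ0 hr hQΛ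
      (fun t ht y hy => (H2 t ht y hy).trans (mono (by linarith) (by linarith [hy.1])))
      (fun t ht y hy => by
        have := H3 t ht (-y) ⟨by linarith [hy.2], by linarith [hy.1]⟩
        simp only [neg_neg] at this
        have k := mono (M := L3) (z := b t - y) (by linarith) (by linarith [hy.2])
        linarith)
      (fun x hx y hy hxy => by
        have := (abs_le.1 (hinit y hy x hx)).1
        rw [abs_of_nonneg (by linarith)] at this
        have k := mono (M := L₀) (z := y - x) l0 (by linarith)
        linarith) ht hx hxy hy
    have u3 := expBarrier_le (r := r) (x := y - x) hΛ0.le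
    rw [abs_le]
    constructor <;> linarith
  refine ⟨Λ * r, by positivity, fun t ht x hx y hy => ?_⟩
  rcases le_total x y with hxy | hxy
  · rw [abs_sub_comm, abs_sub_comm x, abs_of_nonneg (sub_nonneg.2 hxy)]
    exact key t ht x y hx.1 hxy hy.2
  · rw [abs_of_nonneg (sub_nonneg.2 hxy)]
    exact key t ht y x hy.1 hxy hx.2

end IsDriftSol

/-- The increments `D s t` over short intervals of `[0, T]` are integrals of uniformly bounded
functions which converge pointwise to `G` when the interval shrinks to a point. -/
def HasIncrementDensity (D : ℝ → ℝ → ℝ) (G : ℝ → ℝ) (T : ℝ) : Prop :=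
  ∃ δ > 0, ∃ (C : ℝ) (Ψ : ℝ → ℝ → ℝ → ℝ),
    (∀ s t, 0 ≤ s → s < t → t ≤ T → t - s ≤ δ →
      IntervalIntegrable (Ψ s t) volume s t ∧ D s t = ∫ σ in s..t, Ψ s t σ ∧
        ∀ σ ∈ Ico s t, |Ψ s t σ| ≤ C) ∧
    ∀ σ ∈ Ioo 0 T, Tendsto (fun p : ℝ × ℝ => Ψ p.1 p.2 σ)
      (𝓝[{p | 0 ≤ p.1 ∧ p.1 ≤ σ ∧ σ < p.2 ∧ p.2 ≤ T}] (σ, σ)) (𝓝 (G σ))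

namespace HasIncrementDensity

variable {D D₁ D₂ : ℝ → ℝ → ℝ} {G G₁ G₂ X : ℝ → ℝ} {T : ℝ}

theorem add (h₁ : HasIncrementDensity D₁ G₁ T) (h₂ : HasIncrementDensity D₂ G₂ T) :
    HasIncrementDensity (fun s t => D₁ s t + D₂ s t) (fun σ => G₁ σ + G₂ σ) T := by
  obtain ⟨δ₁, hδ₁, C₁, Ψ₁, h₁, l₁⟩ := h₁
  obtain ⟨δ₂, hδ₂, C₂, Ψ₂, h₂, l₂⟩ := h₂
  refine ⟨min δ₁ δ₂, lt_min hδ₁ hδ₂, C₁ + C₂, fun s t σ => Ψ₁ s t σ + Ψ₂ s t σ, ?_,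
    fun σ hσ => (l₁ σ hσ).add (l₂ σ hσ)⟩
  intro s t hs hst ht hδ
  obtain ⟨i₁, e₁, b₁⟩ := h₁ s t hs hst ht (hδ.trans (min_le_left _ _))
  obtain ⟨i₂, e₂, b₂⟩ := h₂ s t hs hst ht (hδ.trans (min_le_right _ _))
  refine ⟨i₁.add i₂, ?_, fun σ hσ => (abs_add_le _ _).trans (add_le_add (b₁ σ hσ) (b₂ σ hσ))⟩
  simp only [e₁, e₂]
  rw [intervalIntegral.integral_add i₁ i₂]

theorem congr_density (h : HasIncrementDensity D G₁ T) (hG : ∀ σ ∈ Ioo 0 T, G₁ σ = G₂ σ) :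
    HasIncrementDensity D G₂ T := by
  obtain ⟨δ, hδ, C, Ψ, h, l⟩ := h
  exact ⟨δ, hδ, C, Ψ, h, fun σ hσ => hG σ hσ ▸ l σ hσ⟩

theorem congr_of_le (h : HasIncrementDensity D₁ G T) {δ : ℝ} (hδ : 0 < δ)
    (hD : ∀ s t, 0 ≤ s → s < t → t ≤ T → t - s ≤ δ → D₂ s t = D₁ s t) :
    HasIncrementDensity D₂ G T := by
  obtain ⟨δ', hδ', C, Ψ, h, l⟩ := h
  refine ⟨min δ δ', lt_min hδ hδ', C, Ψ, fun s t hs hst ht hd => ?_, l⟩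
  rw [hD s t hs hst ht (hd.trans (min_le_left _ _))]
  exact h s t hs hst ht (hd.trans (min_le_right _ _))

theorem of_isLittleO
    (h : ∀ ε > 0, ∃ δ > 0, ∀ s t, 0 ≤ s → s < t → t ≤ T → t - s ≤ δ → |D s t| ≤ ε * (t - s)) :
    HasIncrementDensity D (fun _ => 0) T := by
  obtain ⟨δ, hδ, hD⟩ := h 1 one_pos
  refine ⟨δ, hδ, 1, fun s t _ => D s t / (t - s), ?_, ?_⟩
  · intro s t hs hst ht hd
    have h0 : 0 < t - s := sub_pos.2 hst
    refine ⟨intervalIntegrable_const, ?_, fun σ _ => ?_⟩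
    · rw [intervalIntegral.integral_const, smul_eq_mul, mul_div_cancel₀ _ h0.ne']
    · rw [abs_div, abs_of_pos h0, div_le_iff₀ h0]
      exact hD s t hs hst ht hd
  · intro σ hσ
    rw [Metric.tendsto_nhds]
    intro ε hε
    obtain ⟨δ, hδ, hD⟩ := h (ε / 2) (by linarith)
    have hn : ∀ᶠ p : ℝ × ℝ in 𝓝 (σ, σ), p.2 - p.1 < δ := by
      have : ContinuousAt (fun p : ℝ × ℝ => p.2 - p.1) (σ, σ) := by fun_prop
      exact this.eventually_lt continuousAt_const (by simpa using hδ)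
    filter_upwards [nhdsWithin_le_nhds hn, self_mem_nhdsWithin] with p hp hq
    obtain ⟨q1, q2, q3, q4⟩ := hq
    have h0 : 0 < p.2 - p.1 := by linarith
    have := hD p.1 p.2 q1 (by linarith) q4 hp.le
    rw [Real.dist_eq, sub_zero, abs_div, abs_of_pos h0, div_lt_iff₀ h0]
    linarith [mul_pos hε h0]

theorem integral_eq (hX : HasIncrementDensity (fun s t => X t - X s) G T) (hT : 0 < T) :
    IntervalIntegrable G volume 0 T ∧ ∫ σ in (0 : ℝ)..T, G σ = X T - X 0 := by
  obtain ⟨δ, hδ, C, Ψ, h, l⟩ := hX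
  set m : ℕ → ℕ → ℝ := fun n i => i * (T / (n + 1)) with hm
  have hn0 : ∀ n : ℕ, (0 : ℝ) < T / (n + 1) := fun n => by positivity
  have hm0 : ∀ n, m n 0 = 0 := fun n => by simp [hm]
  have hmT : ∀ n, m n (n + 1) = T := fun n => by
    simp only [hm]; push_cast; field_simp
  have hms : ∀ n i, m n (i + 1) = m n i + T / (n + 1) := fun n i => by
    simp only [hm]; push_cast; ring
  have hmi : ∀ n i, 0 ≤ m n i := fun n i => by positivity
  have hmle : ∀ n i, i < n + 1 → m n (i + 1) ≤ T := fun n i hi => by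
    rw [← hmT n]
    exact mul_le_mul_of_nonneg_right (by exact_mod_cast hi) (hn0 n).le
  set k : ℕ → ℝ → ℕ := fun n σ => ⌊σ / (T / (n + 1))⌋₊ with hk
  set A : ℕ → ℝ → ℝ := fun n σ => Ψ (m n (k n σ)) (m n (k n σ + 1)) σ with hA
  have hkm : ∀ n σ, 0 ≤ σ → m n (k n σ) ≤ σ ∧ σ < m n (k n σ + 1) := fun n σ hσ => by
    have h1 := Nat.floor_le (div_nonneg hσ (hn0 n).le)
    have h2 := Nat.lt_floor_add_one (σ / (T / (n + 1)))
    rw [le_div_iff₀ (hn0 n)] at h1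
    rw [div_lt_iff₀ (hn0 n)] at h2
    refine ⟨h1, ?_⟩
    simp only [hm]; push_cast; exact h2
  have hki : ∀ n i σ, σ ∈ Ico (m n i) (m n (i + 1)) → k n σ = i := fun n i σ hσ => by
    have h0 : 0 ≤ σ := (hmi n i).trans hσ.1
    rw [hk]
    rw [Nat.floor_eq_iff (div_nonneg h0 (hn0 n).le), le_div_iff₀ (hn0 n), div_lt_iff₀ (hn0 n)]
    refine ⟨hσ.1, ?_⟩
    have := hσ.2
    simp only [hm] at this; push_cast at this; exact this
  have hkn : ∀ n σ, 0 ≤ σ → σ < T → k n σ < n + 1 := fun n σ h0 hσ => by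
    rw [hk, Nat.floor_lt (div_nonneg h0 (hn0 n).le), div_lt_iff₀ (hn0 n), ]
    have := hmT n
    simp only [hm] at this
    rwa [this]
  have hδn : Tendsto (fun n : ℕ => T / ((n : ℝ) + 1)) atTop (𝓝 0) := by
    have := (tendsto_one_div_add_atTop_nhds_zero_nat (𝕜 := ℝ)).const_mul T
    rw [mul_zero] at this
    exact this.congr fun n => by ring
  have hfine : ∀ᶠ n : ℕ in atTop, T / ((n : ℝ) + 1) ≤ δ :=
    (hδn.eventually (gt_mem_nhds hδ)).mono fun n hn => hn.le
  have hpiece : ∀ n : ℕ, T / ((n : ℝ) + 1) ≤ δ → ∀ i < n + 1,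
      IntervalIntegrable (A n) volume (m n i) (m n (i + 1)) ∧
        ∫ σ in m n i..m n (i + 1), A n σ = X (m n (i + 1)) - X (m n i) := by
    intro n hn i hi
    have hlt : m n i < m n (i + 1) := by rw [hms]; linarith [hn0 n]
    obtain ⟨h1, h2, -⟩ := h (m n i) (m n (i + 1)) (hmi n i) hlt (hmle n i hi)
      (by rw [hms]; linarith)
    have hae : Ψ (m n i) (m n (i + 1)) =ᵐ[volume.restrict (Set.uIoc (m n i) (m n (i + 1)))] A n := by
      rw [uIoc_of_le hlt.le, ← restrict_Ioo_eq_restrict_Ioc, EventuallyEq,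
        ae_restrict_iff' measurableSet_Ioo]
      refine Eventually.of_forall fun σ hσ => ?_
      simp only [hA, hki n i σ ⟨hσ.1.le, hσ.2⟩]
    refine ⟨h1.congr_ae hae, ?_⟩
    rw [← intervalIntegral.integral_congr_ae_restrict hae]
    exact h2.symm
  have hsum : ∀ n : ℕ, T / ((n : ℝ) + 1) ≤ δ → IntervalIntegrable (A n) volume 0 T ∧
      ∫ σ in (0 : ℝ)..T, A n σ = X T - X 0 := by
    intro n hn
    have i1 := IntervalIntegrable.trans_iterate fun i hi => (hpiece n hn i hi).1
    have i2 := intervalIntegral.sum_integral_adjacent_intervals fun i hi => (hpiece n hn i hi).1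
    rw [hm0, hmT] at i1 i2
    refine ⟨i1, i2.symm.trans ?_⟩
    rw [Finset.sum_congr rfl fun i hi => (hpiece n hn i (Finset.mem_range.1 hi)).2,
      Finset.sum_range_sub (fun i => X (m n i)), hm0, hmT]
  have hbd : ∀ n : ℕ, T / ((n : ℝ) + 1) ≤ δ → ∀ σ ∈ Ioo 0 T, ‖A n σ‖ ≤ C := by
    intro n hn σ hσ
    have hkm' := hkm n σ hσ.1.le
    exact (h _ _ (hmi n _) (hkm'.1.trans_lt hkm'.2) (hmle n _ (hkn n σ hσ.1.le hσ.2))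
      (by rw [hms]; linarith)).2.2 σ hkm'
  have hlim : ∀ σ ∈ Ioo 0 T, Tendsto (fun n => A n σ) atTop (𝓝 (G σ)) := by
    intro σ hσ
    have t1 : Tendsto (fun n => m n (k n σ)) atTop (𝓝 σ) := by
      refine tendsto_of_tendsto_of_tendsto_of_le_of_le (g := fun n : ℕ => σ - T / ((n : ℝ) + 1))
        (h := fun _ => σ) (by simpa using hδn.const_sub σ) tendsto_const_nhds (fun n => ?_)
        (fun n => (hkm n σ hσ.1.le).1)
      have := (hkm n σ hσ.1.le).2
      rw [hms] at this
      simp only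
      linarith
    have t2 : Tendsto (fun n => m n (k n σ + 1)) atTop (𝓝 σ) := by
      have := t1.add hδn
      rw [add_zero] at this
      exact this.congr fun n => (hms _ _).symm
    have t3 : Tendsto (fun n => (m n (k n σ), m n (k n σ + 1))) atTop
        (𝓝[{p | 0 ≤ p.1 ∧ p.1 ≤ σ ∧ σ < p.2 ∧ p.2 ≤ T}] (σ, σ)) :=
      tendsto_nhdsWithin_iff.2 ⟨t1.prodMk_nhds t2, Eventually.of_forall fun n =>
        ⟨hmi n _, (hkm n σ hσ.1.le).1, (hkm n σ hσ.1.le).2, hmle n _ (hkn n σ hσ.1.le hσ.2)⟩⟩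
    exact (l σ hσ).comp t3
  have haeI : ∀ {P : ℝ → Prop}, (∀ σ ∈ Ioo 0 T, P σ) → ∀ᵐ σ ∂volume, σ ∈ Set.uIoc 0 T → P σ := by
    intro P hP
    rw [← ae_restrict_iff' measurableSet_uIoc, uIoc_of_le hT.le, ← restrict_Ioo_eq_restrict_Ioc,
      ae_restrict_iff' measurableSet_Ioo]
    exact Eventually.of_forall hP
  have hGm : AEStronglyMeasurable G (volume.restrict (Set.uIoc 0 T)) := by
    obtain ⟨N, hN⟩ := eventually_atTop.1 hfine
    refine aestronglyMeasurable_of_tendsto_ae atTop (f := fun n => A (n + N)) (fun n => ?_) ?_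
    · have := (hsum (n + N) (hN _ (Nat.le_add_left _ _))).1
      exact (intervalIntegrable_iff.1 this).aestronglyMeasurable
    · rw [ae_restrict_iff' measurableSet_uIoc]
      exact haeI fun σ hσ => (hlim σ hσ).comp (tendsto_add_atTop_nat N)
  have hGb : ∀ σ ∈ Ioo 0 T, ‖G σ‖ ≤ C := fun σ hσ =>
    le_of_tendsto (hlim σ hσ).norm (hfine.mono fun n hn => hbd n hn σ hσ)
  refine ⟨?_, ?_⟩
  · refine intervalIntegrable_const.mono_fun (g := G) (f := fun _ => C) hGm ?_
    rw [EventuallyLE, ae_restrict_iff' measurableSet_uIoc]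
    exact haeI fun σ hσ => (hGb σ hσ).trans (le_abs_self C)
  · refine tendsto_nhds_unique (intervalIntegral.tendsto_integral_filter_of_dominated_convergence
      (fun _ => C) ?_ ?_ intervalIntegrable_const (haeI hlim))
      ((tendsto_const_nhds (x := X T - X 0)).congr' ?_)
    · exact hfine.mono fun n hn => (intervalIntegrable_iff.1 (hsum n hn).1).aestronglyMeasurable
    · exact hfine.mono fun n hn => haeI (hbd n hn)
    · exact hfine.mono fun n hn => (hsum n hn).2.symm

end HasIncrementDensity

theorem ae_uIoc_of_forall_mem_Ioo {a b : ℝ} (hab : a ≤ b) {P : ℝ → Prop}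
    (hP : ∀ x ∈ Ioo a b, P x) : ∀ᵐ x ∂volume, x ∈ Set.uIoc a b → P x := by
  rw [← ae_restrict_iff' measurableSet_uIoc, uIoc_of_le hab, ← restrict_Ioo_eq_restrict_Ioc,
    ae_restrict_iff' measurableSet_Ioo]
  exact Eventually.of_forall hP

theorem abs_integral_le_of_forall_mem_Ioo {f : ℝ → ℝ} {a b C : ℝ} (hab : a ≤ b)
    (hf : ∀ x ∈ Ioo a b, |f x| ≤ C) : |∫ x in a..b, f x| ≤ C * (b - a) := by
  have := intervalIntegral.norm_integral_le_of_norm_le_const_ae (f := f) (C := C)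
    (ae_uIoc_of_forall_mem_Ioo hab hf)
  rwa [Real.norm_eq_abs, abs_of_nonneg (sub_nonneg.2 hab)] at this

theorem intervalIntegrable_of_hasDerivAt_of_abs_le {f f' : ℝ → ℝ} {a b M : ℝ} (hab : a ≤ b)
    (hd : ∀ x ∈ Ioo a b, HasDerivAt f (f' x) x) (hM : ∀ x ∈ Ioo a b, |f' x| ≤ M) :
    IntervalIntegrable f' volume a b := by
  rw [intervalIntegrable_iff_integrableOn_Ioo_of_le hab]
  refine Integrable.of_bound ((measurable_deriv f).aestronglyMeasurable.congr ?_) M ?_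
  · rw [EventuallyEq, ae_restrict_iff' measurableSet_Ioo]
    exact Eventually.of_forall fun x hx => (hd x hx).deriv
  · rw [ae_restrict_iff' measurableSet_Ioo]
    exact Eventually.of_forall hM

/-- If `χ` is uniformly small and `χ'` is uniformly bounded then `χ'` is weakly small. -/
theorem exists_forall_abs_integral_mul_deriv_le {P : ℝ → ℝ} {c b M ε : ℝ}
    (hP : ContinuousOn P (Icc c b)) (hM : 0 ≤ M) (hε : 0 < ε) :
    ∃ η > 0, ∀ a ∈ Icc c b, ∀ χ χ' : ℝ → ℝ, ContinuousOn χ (Icc a b) →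
      (∀ y ∈ Ioo a b, HasDerivAt χ (χ' y) y) → (∀ y ∈ Ioo a b, |χ' y| ≤ M) →
      (∀ y ∈ Icc a b, |χ y| ≤ η) → |∫ y in a..b, P y * χ' y| ≤ ε := by
  by_cases hcb : c ≤ b
  swap
  · exact ⟨1, one_pos, fun a ha => absurd (ha.1.trans ha.2) hcb⟩
  set d := ε / 2 / (M * (b - c) + 1) with hd
  have hbc : 0 ≤ M * (b - c) := mul_nonneg hM (sub_nonneg.2 hcb)
  have hd0 : 0 < d := by positivity
  obtain ⟨Q, hQ⟩ := exists_polynomial_near_of_continuousOn c b P hP d hd0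
  obtain ⟨C₀, hC₀⟩ := isCompact_Icc.exists_bound_of_continuousOn
    (Q.continuous.continuousOn (s := Icc c b))
  obtain ⟨C₁, hC₁⟩ := isCompact_Icc.exists_bound_of_continuousOn
    (Q.derivative.continuous.continuousOn (s := Icc c b))
  have hC₀0 : 0 ≤ C₀ := (norm_nonneg _).trans (hC₀ c ⟨le_rfl, hcb⟩)
  have hC₁0 : 0 ≤ C₁ := (norm_nonneg _).trans (hC₁ c ⟨le_rfl, hcb⟩)
  set R := 2 * C₀ + C₁ * (b - c) + 1 with hR
  have hR0 : 0 < R := by have := mul_nonneg hC₁0 (sub_nonneg.2 hcb); linarith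
  refine ⟨ε / 2 / R, by positivity, ?_⟩
  intro a ha χ χ' hχ hχd hχM hχη
  have hab := ha.2
  have hsub : Icc a b ⊆ Icc c b := Icc_subset_Icc_left ha.1
  have hχi := intervalIntegrable_of_hasDerivAt_of_abs_le hab hχd hχM
  have hPi : IntervalIntegrable (fun y => P y * χ' y) volume a b :=
    hχi.continuousOn_mul (by rw [uIcc_of_le hab]; exact hP.mono hsub)
  have hQi : IntervalIntegrable (fun y => Q.eval y * χ' y) volume a b :=
    hχi.continuousOn_mul Q.continuous.continuousOn
  have e1 : |∫ y in a..b, (P y * χ' y - Q.eval y * χ' y)| ≤ d * M * (b - a) := by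
    refine abs_integral_le_of_forall_mem_Ioo hab fun y hy => ?_
    rw [← sub_mul, abs_mul, abs_sub_comm]
    exact mul_le_mul (hQ y (hsub (Ioo_subset_Icc_self hy))).le (hχM y hy) (abs_nonneg _) hd0.le
  have e2 : ∫ y in a..b, Q.eval y * χ' y
      = Q.eval b * χ b - Q.eval a * χ a - ∫ y in a..b, Q.derivative.eval y * χ y := by
    refine intervalIntegral.integral_mul_deriv_eq_deriv_mul_of_hasDerivAt
      Q.continuous.continuousOn (by rwa [uIcc_of_le hab]) (fun y _ => Q.hasDerivAt y) ?_
      (Q.derivative.continuous.intervalIntegrable _ _) hχi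
    rwa [min_eq_left hab, max_eq_right hab]
  set η := ε / 2 / R with hη
  have hη0 : 0 < η := by positivity
  have hprod : ∀ y ∈ Icc a b, |Q.eval y * χ y| ≤ C₀ * η := fun y hy => by
    rw [abs_mul]
    exact mul_le_mul (hC₀ y (hsub hy)) (hχη y hy) (abs_nonneg _) hC₀0
  have e3 : |∫ y in a..b, Q.derivative.eval y * χ y| ≤ C₁ * η * (b - a) := by
    refine abs_integral_le_of_forall_mem_Ioo hab fun y hy => ?_
    rw [abs_mul]
    exact mul_le_mul (hC₁ y (hsub (Ioo_subset_Icc_self hy))) (hχη y (Ioo_subset_Icc_self hy))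
      (abs_nonneg _) hC₁0
  rw [intervalIntegral.integral_sub hPi hQi] at e1
  have b1 := abs_le.1 (hprod b ⟨hab, le_rfl⟩)
  have b2 := abs_le.1 (hprod a ⟨le_rfl, hab⟩)
  have b3 := abs_le.1 e3
  have b4 := abs_le.1 e1
  have f1 : d * M * (b - a) ≤ ε / 2 := by
    have g1 : d * (M * (b - c) + 1) = ε / 2 := div_mul_cancel₀ _ (by linarith)
    have g2 : d * (M * (b - a)) ≤ d * (M * (b - c) + 1) :=
      mul_le_mul_of_nonneg_left (by linarith [mul_le_mul_of_nonneg_left ha.1 hM]) hd0.le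
    linarith
  have f2 : η * (2 * C₀ + C₁ * (b - a)) ≤ ε / 2 := by
    have g1 : η * R = ε / 2 := div_mul_cancel₀ _ hR0.ne'
    have g2 : η * (2 * C₀ + C₁ * (b - a)) ≤ η * R :=
      mul_le_mul_of_nonneg_left (by linarith [mul_le_mul_of_nonneg_left ha.1 hC₁0]) hη0.le
    linarith
  rw [abs_le]
  constructor <;> linarith [b1.1, b1.2, b2.1, b2.2, b3.1, b3.2, b4.1, b4.2]

namespace IsBurgersOn

variable {v vt vy vyy : ℝ → ℝ → ℝ} {τ₁ τ₂ a b L : ℝ}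

theorem aestronglyMeasurable_space (h : IsBurgersOn v vt vy vyy τ₁ τ₂ a b L) (hτ : τ₁ < τ₂)
    (hab : a < b) : AEStronglyMeasurable (fun p : ℝ × ℝ => vy p.1 p.2)
      ((volume.prod volume).restrict (Ioo τ₁ τ₂ ×ˢ Ioo a b)) := by
  obtain ⟨B, hB⟩ := h.exists_isBurgersBox hτ hab
  refine aestronglyMeasurable_of_hasDerivAt (x₀ := 0)
    (F := fun x p => v (clampIcc τ₁ τ₂ p.1) (clampIcc a b (p.2 + x))) (fun x => ?_) ?_
  · exact (hB.cont.comp (by fun_prop : Continuous fun p : ℝ × ℝ => (p.1, p.2 + x))).aestronglyMeasurable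
  · rw [ae_restrict_iff' (measurableSet_Ioo.prod measurableSet_Ioo)]
    refine Eventually.of_forall fun p hp => ?_
    have h1 := hB.space p.1 hp.1 p.2 hp.2
    have h2 : HasDerivAt (fun x => p.2 + x) 1 0 := by simpa using (hasDerivAt_id (0 : ℝ)).const_add p.2
    have h3 : HasDerivAt (fun x => v (clampIcc τ₁ τ₂ p.1) (clampIcc a b x)) (vy p.1 p.2) (p.2 + 0) := by
      rwa [add_zero]
    have := h3.comp 0 h2
    rwa [mul_one] at this

/-- The conservation law tested against a function which vanishes on the right boundary. -/
theorem integral_mul_test (h : IsBurgersOn v vt vy vyy τ₁ τ₂ a b L) (hτ : τ₁ < τ₂) {x M : ℝ}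
    (hax : a < x) (hxb : x < b) {φ φ' : ℝ → ℝ} (hφ : ContinuousOn φ (Icc x b))
    (hφd : ∀ y ∈ Ioo x b, HasDerivAt φ (φ' y) y) (hφM : ∀ y ∈ Ioo x b, |φ' y| ≤ M)
    (hφb : φ b = 0) :
    IntervalIntegrable (fun σ => -(vy σ x - v σ x ^ 2 / 2) * φ x
        - ∫ y in x..b, (vy σ y - v σ y ^ 2 / 2) * φ' y) volume τ₁ τ₂ ∧
      ∫ y in x..b, (v τ₂ y - v τ₁ y) * φ y = ∫ σ in τ₁..τ₂, (-(vy σ x - v σ x ^ 2 / 2) * φ x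
        - ∫ y in x..b, (vy σ y - v σ y ^ 2 / 2) * φ' y) := by
  obtain ⟨B, hB⟩ := h.exists_isBurgersBox hτ (hax.trans hxb)
  set w : ℝ → ℝ → ℝ := fun t y => v (clampIcc τ₁ τ₂ t) (clampIcc a b y) with hw
  have hwv : ∀ t ∈ Icc τ₁ τ₂, ∀ z ∈ Icc a b, w t z = v t z := fun t ht z hz => by
    simp only [hw]; rw [clampIcc_of_mem ht, clampIcc_of_mem hz]
  have hB0 : 0 ≤ B := (abs_nonneg _).trans (hB.bound 0 0)
  have hxI : x ∈ Ioo a b := ⟨hax, hxb⟩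
  have hJb : ∀ σ ∈ Ioo τ₁ τ₂, ∀ y ∈ Ioo a b, |vy σ y - v σ y ^ 2 / 2| ≤ L + B ^ 2 / 2 := by
    intro σ hσ y hy
    have h1 := abs_le.1 (h.abs_space_le hσ hy)
    have h2 : |v σ y| ≤ B := by
      rw [← hwv σ (Ioo_subset_Icc_self hσ) y (Ioo_subset_Icc_self hy)]; exact hB.bound _ _
    have h3 := sq_le_sq' (by linarith [(abs_le.1 h2).1]) (abs_le.1 h2).2
    rw [abs_le]
    constructor <;> linarith [sq_nonneg (v σ y), h1.1, h1.2]
  have hCJ : 0 ≤ L + B ^ 2 / 2 := by have := hB.L_nonneg; positivity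
  have hφ'i := intervalIntegrable_of_hasDerivAt_of_abs_le hxb.le hφd hφM
  have hsub : Ioo x b ⊆ Ioo a b := Ioo_subset_Ioo_left hax.le
  have hJm : AEStronglyMeasurable (fun p : ℝ × ℝ => vy p.1 p.2 - v p.1 p.2 ^ 2 / 2)
      ((volume.prod volume).restrict (Ioo τ₁ τ₂ ×ˢ Ioo x b)) := by
    have m1 : AEStronglyMeasurable (fun p : ℝ × ℝ => vy p.1 p.2)
        ((volume.prod volume).restrict (Ioo τ₁ τ₂ ×ˢ Ioo x b)) :=
      (h.aestronglyMeasurable_space hτ (hax.trans hxb)).mono_measure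
        (Measure.restrict_mono (prod_mono_right hsub) le_rfl)
    have hc := h.cont
    refine m1.sub (ContinuousOn.aestronglyMeasurable ?_ (measurableSet_Ioo.prod measurableSet_Ioo))
    exact ((hc.mono (prod_mono Ioo_subset_Icc_self (hsub.trans Ioo_subset_Icc_self))).pow 2).div_const 2
  have hFint : Integrable (Function.uncurry fun σ y => (vy σ y - v σ y ^ 2 / 2) * φ' y)
      ((volume.restrict (Set.uIoc τ₁ τ₂)).prod (volume.restrict (Set.uIoc x b))) := by
    rw [uIoc_of_le hτ.le, uIoc_of_le hxb.le, ← restrict_Ioo_eq_restrict_Ioc,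
      ← restrict_Ioo_eq_restrict_Ioc]
    have m2 : AEStronglyMeasurable (fun p : ℝ × ℝ => φ' p.2)
        ((volume.restrict (Ioo τ₁ τ₂)).prod (volume.restrict (Ioo x b))) :=
      ((intervalIntegrable_iff_integrableOn_Ioo_of_le hxb.le).1 hφ'i).aestronglyMeasurable.comp_snd
    rw [← Measure.prod_restrict] at hJm
    refine Integrable.of_bound (hJm.mul m2) ((L + B ^ 2 / 2) * M) ?_
    rw [Measure.prod_restrict, ae_restrict_iff' (measurableSet_Ioo.prod measurableSet_Ioo)]
    refine Eventually.of_forall fun p hp => ?_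
    simp only [Function.uncurry, norm_mul, Real.norm_eq_abs]
    exact mul_le_mul (hJb _ hp.1 _ (hsub hp.2)) (hφM _ hp.2) (abs_nonneg _) hCJ
  have hJint : ∀ y ∈ Ioo a b, IntervalIntegrable (fun σ => vy σ y - v σ y ^ 2 / 2) volume τ₁ τ₂ := by
    intro y hy
    have hc : ContinuousOn (fun σ => v σ y ^ 2 / 2) (Icc τ₁ τ₂) :=
      ((h.cont.comp (f := fun σ : ℝ => (σ, y)) (by fun_prop)
        fun σ hσ => ⟨hσ, Ioo_subset_Icc_self hy⟩).pow 2).div_const 2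
    have hwc : ∀ y, Continuous fun t => w t y := fun y =>
      hB.cont.comp (by fun_prop : Continuous fun t : ℝ => (t, y))
    have hm : AEStronglyMeasurable (fun t => vy t y) (volume.restrict (Ioo τ₁ τ₂)) := by
      refine aestronglyMeasurable_of_hasDerivAt (x₀ := y) (F := fun y t => w t y)
        (fun y => (hwc y).aestronglyMeasurable) ?_
      rw [ae_restrict_iff' measurableSet_Ioo]
      exact Eventually.of_forall fun t ht => hB.space t ht y hy
    rw [intervalIntegrable_iff_integrableOn_Ioo_of_le hτ.le]
    refine Integrable.of_bound (hm.sub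
      ((hc.mono Ioo_subset_Icc_self).aestronglyMeasurable measurableSet_Ioo)) (L + B ^ 2 / 2) ?_
    rw [ae_restrict_iff' measurableSet_Ioo]
    exact Eventually.of_forall fun t ht => hJb t ht y hy
  have hIi : IntervalIntegrable (fun σ => ∫ y in x..b, (vy σ y - v σ y ^ 2 / 2) * φ' y)
      volume τ₁ τ₂ := by
    rw [intervalIntegrable_iff]
    have := hFint.integral_prod_left
    rw [uIoc_of_le hxb.le] at this
    simp only [intervalIntegral.integral_of_le hxb.le]
    exact this
  have hJx : IntervalIntegrable (fun σ => -(vy σ x - v σ x ^ 2 / 2) * φ x) volume τ₁ τ₂ :=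
    (hJint x hxI).neg.mul_const (φ x)
  refine ⟨hJx.sub hIi, ?_⟩
  set D : ℝ → ℝ := fun y => ∫ σ in τ₁..τ₂, (vy σ y - v σ y ^ 2 / 2) with hD
  set ψ : ℝ → ℝ := fun y => w τ₂ y - w τ₁ y with hψ
  have hψc : Continuous ψ :=
    (hB.cont.comp (by fun_prop : Continuous fun t : ℝ => (τ₂, t))).sub
      (hB.cont.comp (by fun_prop : Continuous fun t : ℝ => (τ₁, t)))
  have hψv : ∀ y ∈ Icc a b, ψ y = v τ₂ y - v τ₁ y := fun y hy => by
    simp only [hψ]; rw [hwv _ ⟨hτ.le, le_rfl⟩ _ hy, hwv _ ⟨le_rfl, hτ.le⟩ _ hy]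
  set E : ℝ → ℝ := fun y => D x + ∫ z in x..y, ψ z with hE
  have hEd : ∀ y, HasDerivAt E (ψ y) y := fun y =>
    (intervalIntegral.integral_hasDerivAt_right (hψc.intervalIntegrable _ _)
      (hψc.stronglyMeasurableAtFilter _ _) hψc.continuousAt).const_add (D x)
  have hED : ∀ y ∈ Ico x b, E y = D y := by
    intro y hy
    simp only [hE, hD]
    rw [← h.flux_eq hτ hax hy.1 hy.2]
    congr 1
    refine intervalIntegral.integral_congr fun z hz => ?_
    rw [uIcc_of_le hy.1] at hz
    exact hψv z ⟨by linarith [hz.1], by linarith [hz.2, hy.2]⟩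
  have hip := intervalIntegral.integral_mul_deriv_eq_deriv_mul_of_hasDerivAt (a := x) (b := b)
    (u := E) (v := φ) (u' := ψ) (v' := φ')
    (fun y _ => (hEd y).continuousAt.continuousWithinAt) (by rwa [uIcc_of_le hxb.le])
    (fun y _ => hEd y) (by rwa [min_eq_left hxb.le, max_eq_right hxb.le])
    (hψc.intervalIntegrable _ _) hφ'i
  have e1 : ∫ y in x..b, (v τ₂ y - v τ₁ y) * φ y = ∫ y in x..b, ψ y * φ y :=
    intervalIntegral.integral_congr fun y hy => by
      rw [uIcc_of_le hxb.le] at hy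
      simp only [hψv y ⟨by linarith [hy.1], hy.2⟩]
  have e2 : ∫ y in x..b, E y * φ' y
      = ∫ σ in τ₁..τ₂, ∫ y in x..b, (vy σ y - v σ y ^ 2 / 2) * φ' y := by
    rw [intervalIntegral_intervalIntegral_swap
      (by rwa [IntegrableOn, Measure.volume_eq_prod, ← Measure.prod_restrict])]
    refine intervalIntegral.integral_congr_ae (ae_uIoc_of_forall_mem_Ioo hxb.le fun y hy => ?_)
    rw [hED y ⟨hy.1.le, hy.2⟩, hD, intervalIntegral.integral_mul_const]
  rw [intervalIntegral.integral_sub hJx hIi, intervalIntegral.integral_mul_const,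
    intervalIntegral.integral_neg, e1, ← e2, hip, hφb, hED x ⟨le_rfl, hxb⟩, hD]
  ring

end IsBurgersOn

theorem exists_abs_sub_le_of_continuousOn {v : ℝ → ℝ → ℝ}
    (hv : ContinuousOn (fun p : ℝ × ℝ => v p.1 p.2) (Ici 0 ×ˢ Icc (-1) 1)) (T : ℝ) {η : ℝ}
    (hη : 0 < η) : ∃ δ > 0, ∀ s ∈ Icc 0 T, ∀ t ∈ Icc 0 T, |s - t| < δ → ∀ y ∈ Icc (-1 : ℝ) 1,
      |v s y - v t y| ≤ η := by
  have hc : ContinuousOn (fun p : ℝ × ℝ => v p.1 p.2) (Icc 0 T ×ˢ Icc (-1) 1) :=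
    hv.mono (prod_mono_left Icc_subset_Ici_self)
  have hu := (isCompact_Icc.prod isCompact_Icc).uniformContinuousOn_of_continuous hc
  obtain ⟨δ, hδ, h⟩ := Metric.uniformContinuousOn_iff.1 hu η hη
  refine ⟨δ, hδ, fun s hs t ht hst y hy => ?_⟩
  have := h (s, y) ⟨hs, hy⟩ (t, y) ⟨ht, hy⟩ (by
    rw [Prod.dist_eq, dist_self, max_eq_left dist_nonneg, Real.dist_eq]; exact hst)
  rw [Real.dist_eq] at this
  exact this.le

theorem abs_sub_le_of_abs_deriv_le {f f' : ℝ → ℝ} {a b M : ℝ} (hf : ContinuousOn f (Icc a b))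
    (hd : ∀ x ∈ Ioo a b, HasDerivAt f (f' x) x) (hM : ∀ x ∈ Ioo a b, |f' x| ≤ M)
    {x y : ℝ} (hx : x ∈ Icc a b) (hy : y ∈ Icc a b) : |f x - f y| ≤ M * |x - y| := by
  wlog hxy : x < y generalizing x y
  · rcases (not_lt.1 hxy).eq_or_lt with rfl | h
    · simp
    · rw [abs_sub_comm (f x), abs_sub_comm x]; exact this hy hx h
  obtain ⟨c, hc, he⟩ := exists_hasDerivAt_eq_slope f f' hxy (hf.mono (Icc_subset_Icc hx.1 hy.2))
    fun z hz => hd z ⟨hx.1.trans_lt hz.1, hz.2.trans_le hy.2⟩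
  have h1 := hM c ⟨hx.1.trans_lt hc.1, hc.2.trans_le hy.2⟩
  have h0 : 0 < y - x := sub_pos.2 hxy
  rw [he, abs_div, abs_of_pos h0, div_le_iff₀ h0] at h1
  rwa [abs_sub_comm (f x), abs_sub_comm x, abs_of_pos h0]

/-- The fluid to the right of the particle. -/
structure IsRightSide (v vt vy vyy : ℝ → ℝ → ℝ) (h g g' q : ℝ → ℝ) : Prop where
  mem : ∀ t, 0 ≤ t → h t ∈ Ioo (-1 : ℝ) 1
  deriv_pos : ∀ t, HasDerivAt h (g t) t
  deriv_vel : ∀ t, HasDerivAt g (g' t) t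
  cont_acc : Continuous g'
  cont : ContinuousOn (fun p : ℝ × ℝ => v p.1 p.2) (Ici 0 ×ˢ Icc (-1) 1)
  time : ∀ t, 0 ≤ t → ∀ y ∈ Ioo (h t) 1, HasDerivAt (fun s => v s y) (vt t y) t
  space : ∀ t, 0 ≤ t → ∀ y ∈ Ioo (h t) 1, HasDerivAt (fun x => v t x) (vy t y) y
  space₂ : ∀ t, 0 ≤ t → ∀ y ∈ Ioo (h t) 1, HasDerivAt (fun x => vy t x) (vyy t y) y
  pde : ∀ t, 0 ≤ t → ∀ y ∈ Ioo (h t) 1, vt t y + v t y * vy t y = vyy t y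
  space_cont : ∀ t, 0 ≤ t → ContinuousOn (fun y => vy t y) (Ioc (h t) 1)
  space_lim : ∀ t, 0 ≤ t → Tendsto (fun y => vy t y) (𝓝[>] (h t)) (𝓝 (q t))
  wall : ∀ t, 0 ≤ t → v t 1 = 0
  particle : ∀ t, 0 ≤ t → v t (h t) = g t

namespace IsRightSide

variable {v vt vy vyy : ℝ → ℝ → ℝ} {h g g' q : ℝ → ℝ} {T : ℝ}

theorem cont_slice (S : IsRightSide v vt vy vyy h g g' q) {t : ℝ} (ht : 0 ≤ t) :
    ContinuousOn (fun y => v t y) (Icc (-1) 1) :=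
  S.cont.comp (f := fun y : ℝ => (t, y)) (by fun_prop) fun y hy => ⟨ht, hy⟩

theorem exists_continuousOn_space (S : IsRightSide v vt vy vyy h g g' q) {t : ℝ} (ht : 0 ≤ t) :
    ∃ P : ℝ → ℝ, ContinuousOn P (Icc (h t) 1) ∧ ∀ y ∈ Ioo (h t) 1, P y = vy t y := by
  classical
  refine ⟨Function.update (vy t) (h t) (q t), ?_, fun y hy => Function.update_of_ne hy.1.ne' _ _⟩
  rw [continuousOn_update_iff, Icc_sdiff_left, nhdsWithin_Ioc_eq_nhdsGT (S.mem t ht).2]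
  exact ⟨S.space_cont t ht, fun _ => S.space_lim t ht⟩

theorem exists_lipschitz (S : IsRightSide v vt vy vyy h g g' q) (hT : 0 ≤ T) :
    ∃ L, 0 ≤ L ∧ ∀ t ∈ Icc 0 T, ∀ x ∈ Icc (h t) 1, ∀ y ∈ Icc (h t) 1,
      |v t x - v t y| ≤ L * |x - y| := by
  have hc : ContinuousOn (fun p : ℝ × ℝ => v p.1 p.2) (Icc 0 T ×ˢ Icc (-1) 1) :=
    S.cont.mono (prod_mono_left Icc_subset_Ici_self)
  obtain ⟨B, hB⟩ := (isCompact_Icc.prod isCompact_Icc).exists_bound_of_continuousOn hc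
  have hB' : ∀ t ∈ Icc 0 T, ∀ y ∈ Icc (-1 : ℝ) 1, |v t y| ≤ B := fun t ht y hy => hB (t, y) ⟨ht, hy⟩
  obtain ⟨P, hPc, hP⟩ := S.exists_continuousOn_space le_rfl
  obtain ⟨L₀, hL₀⟩ := isCompact_Icc.exists_bound_of_continuousOn hPc
  have hmem : ∀ t ∈ Icc 0 T, h t ∈ Icc (-1 : ℝ) 1 := fun t ht => Ioo_subset_Icc_self (S.mem t ht.1)
  have hsol : IsDriftSol v v vt vy vyy h (fun _ => 1) T B :=
    { cont_left := continuous_iff_continuousAt.2 fun t => (S.deriv_pos t).continuousAt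
      cont_right := continuous_const
      le_left := fun t ht => (S.mem t ht.1).1.le
      lt := fun t ht => (S.mem t ht.1).2
      right_le := fun _ _ => le_rfl
      cont := hc
      bound := hB'
      drift := hB'
      time := fun t ht => S.time t ht.1
      space := fun t ht => S.space t ht.1
      space₂ := fun t ht => S.space₂ t ht.1
      pde := fun t ht => S.pde t ht.1 }
  have hgB : ∀ t ∈ Icc 0 T, |g t| ≤ B := fun t ht => by
    rw [← S.particle t ht.1]; exact hB' t ht _ (hmem t ht)
  refine hsol.exists_lipschitz (a' := g) (b' := fun _ => 0) (α := g) (β := fun _ => 0) (α' := g')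
    (β' := fun _ => 0) (L₀ := L₀) hT (fun t _ => S.deriv_pos t) (fun t _ => hasDerivAt_const t 1)
    (fun t _ => S.deriv_vel t) (fun t _ => hasDerivAt_const t 0) hgB
    (fun t ht => by rw [abs_zero]; exact (abs_nonneg _).trans (hgB t ht)) S.cont_acc
    continuous_const (fun t ht => S.particle t ht.1) (fun t ht => S.wall t ht.1) ?_
  intro x hx y hy
  refine abs_sub_le_of_abs_deriv_le
    ((S.cont_slice le_rfl).mono (Icc_subset_Icc_left (S.mem 0 le_rfl).1.le)) (S.space 0 le_rfl)
    (fun z hz => ?_) hx hy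
  rw [← hP z hz]
  exact hL₀ z (Ioo_subset_Icc_self hz)

theorem abs_space_le (S : IsRightSide v vt vy vyy h g g' q) {t L y : ℝ} (ht : 0 ≤ t) (hL : 0 ≤ L)
    (hlip : ∀ x ∈ Icc (h t) 1, ∀ y ∈ Icc (h t) 1, |v t x - v t y| ≤ L * |x - y|)
    (hy : y ∈ Ioo (h t) 1) : |vy t y| ≤ L := by
  refine (S.space t ht y hy).le_of_lip' hL ?_
  filter_upwards [Icc_mem_nhds hy.1 hy.2] with x hx using hlip x hx y (Ioo_subset_Icc_self hy)

theorem integral_sq_mul_space (S : IsRightSide v vt vy vyy h g g' q) {t : ℝ} (ht : 0 ≤ t)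
    (hi : IntervalIntegrable (fun y => vy t y) volume (h t) 1) :
    ∫ y in h t..1, v t y ^ 2 * vy t y = -(g t ^ 3 / 3) := by
  have hm := S.mem t ht
  have hc := (S.cont_slice ht).mono (Icc_subset_Icc_left hm.1.le)
  have := intervalIntegral.integral_eq_sub_of_hasDerivAt_of_le hm.2.le
    (f := fun y => v t y ^ 3 / 3) (f' := fun y => v t y ^ 2 * vy t y) ((hc.pow 3).div_const 3)
    (fun y hy => (((S.space t ht y hy).pow 3).div_const 3).congr_deriv (by push_cast; ring))
    (hi.continuousOn_mul (by rw [uIcc_of_le hm.2.le]; exact hc.pow 2))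
  rw [this, S.wall t ht, S.particle t ht]
  ring

theorem abs_pos_sub_le (S : IsRightSide v vt vy vyy h g g' q) {H : ℝ}
    (hH : ∀ t ∈ Icc 0 T, |g t| ≤ H) {s t : ℝ} (hs : s ∈ Icc 0 T) (ht : t ∈ Icc 0 T) :
    |h s - h t| ≤ H * |s - t| :=
  abs_sub_le_of_abs_deriv_le (fun t _ => (S.deriv_pos t).continuousAt.continuousWithinAt)
    (fun t _ => S.deriv_pos t) (fun t ht => hH t (Ioo_subset_Icc_self ht)) hs ht

theorem isBurgersOn (S : IsRightSide v vt vy vyy h g g' q) {H L s t : ℝ}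
    (hH : ∀ t ∈ Icc 0 T, |g t| ≤ H)
    (hlip : ∀ t ∈ Icc 0 T, ∀ x ∈ Icc (h t) 1, ∀ y ∈ Icc (h t) 1, |v t x - v t y| ≤ L * |x - y|)
    (hs : 0 ≤ s) (hst : s < t) (ht : t ≤ T) :
    IsBurgersOn v vt vy vyy s t (h s + H * (t - s)) 1 L := by
  have hH0 : 0 ≤ H := (abs_nonneg _).trans (hH 0 ⟨le_rfl, by linarith⟩)
  have hle : ∀ σ ∈ Icc s t, h σ ≤ h s + H * (t - s) := by
    intro σ hσ
    have h1 := (abs_le.1 (S.abs_pos_sub_le hH (s := σ) (t := s) ⟨by linarith [hσ.1], by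
      linarith [hσ.2]⟩ ⟨hs, by linarith⟩)).2
    rw [abs_of_nonneg (sub_nonneg.2 hσ.1)] at h1
    linarith [mul_le_mul_of_nonneg_left hσ.2 hH0]
  have h0 : ∀ σ ∈ Icc s t, 0 ≤ σ := fun σ hσ => hs.trans hσ.1
  have hI : ∀ σ ∈ Icc s t, Icc (h s + H * (t - s)) 1 ⊆ Icc (h σ) 1 := fun σ hσ =>
    Icc_subset_Icc_left (hle σ hσ)
  have hI' : ∀ σ ∈ Ioo s t, Ioo (h s + H * (t - s)) 1 ⊆ Ioo (h σ) 1 := fun σ hσ =>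
    Ioo_subset_Ioo_left (hle σ (Ioo_subset_Icc_self hσ))
  refine ⟨S.cont.mono (prod_mono (fun σ hσ => h0 σ hσ) fun y hy => ⟨?_, hy.2⟩), ?_, ?_, ?_, ?_, ?_⟩
  · have := hI s ⟨le_rfl, hst.le⟩ hy
    linarith [(S.mem s hs).1, this.1]
  · exact fun σ hσ x hx y hy => hlip σ ⟨h0 σ hσ, hσ.2.trans ht⟩ x (hI σ hσ hx) y (hI σ hσ hy)
  · exact fun σ hσ y hy => S.time σ (hs.trans hσ.1.le) y (hI' σ hσ hy)
  · exact fun σ hσ y hy => S.space σ (hs.trans hσ.1.le) y (hI' σ hσ hy)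
  · exact fun σ hσ y hy => S.space₂ σ (hs.trans hσ.1.le) y (hI' σ hσ hy)
  · exact fun σ hσ y hy => S.pde σ (hs.trans hσ.1.le) y (hI' σ hσ hy)

/-- Weak continuity in time of the spatial derivative. -/
theorem tendsto_integral_flux_mul (S : IsRightSide v vt vy vyy h g g' q) {L σ : ℝ} (hL : 0 ≤ L)
    (hb : ∀ t ∈ Icc 0 T, ∀ y ∈ Ioo (h t) 1, |vy t y| ≤ L) (hσ : σ ∈ Icc 0 T)
    {l : Filter (ℝ × ℝ)} {a : ℝ × ℝ → ℝ} (hl : l ≤ 𝓝 (σ, σ))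
    (hmem : ∀ᶠ p in l, p.1 ∈ Icc 0 T ∧ p.2 ∈ Icc 0 T ∧ h p.1 ≤ a p ∧ h p.2 ≤ a p ∧ h σ < a p)
    (ha : Tendsto a l (𝓝 (h σ))) :
    Tendsto (fun p => ∫ y in a p..1, (vy σ y - v σ y ^ 2 / 2) * (vy p.1 y + vy p.2 y)) l
      (𝓝 (∫ y in h σ..1, (vy σ y - v σ y ^ 2 / 2) * (vy σ y + vy σ y))) := by
  have hm := S.mem σ hσ.1
  obtain ⟨P₀, hP₀c, hP₀⟩ := S.exists_continuousOn_space hσ.1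
  set P : ℝ → ℝ := fun y => P₀ y - v σ y ^ 2 / 2 with hP
  have hPc : ContinuousOn P (Icc (h σ) 1) :=
    hP₀c.sub ((((S.cont_slice hσ.1).mono (Icc_subset_Icc_left hm.1.le)).pow 2).div_const 2)
  have hcongr : ∀ (X : ℝ → ℝ) (c : ℝ), h σ ≤ c → c ≤ 1 →
      ∫ y in c..1, (vy σ y - v σ y ^ 2 / 2) * X y = ∫ y in c..1, P y * X y := by
    intro X c h1 h2
    refine intervalIntegral.integral_congr_ae (ae_uIoc_of_forall_mem_Ioo h2 fun y hy => ?_)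
    simp only [hP]
    rw [hP₀ y ⟨h1.trans_lt hy.1, hy.2⟩]
  obtain ⟨C, hC⟩ := isCompact_Icc.exists_bound_of_continuousOn hPc
  have hC0 : 0 ≤ C := (norm_nonneg _).trans (hC (h σ) ⟨le_rfl, hm.2.le⟩)
  rw [Metric.tendsto_nhds]
  intro ε hε
  obtain ⟨η, hη, hweak⟩ := exists_forall_abs_integral_mul_deriv_le (M := 4 * L) (ε := ε / 2) hPc
    (by linarith) (by linarith)
  obtain ⟨δ, hδ, hunif⟩ := exists_abs_sub_le_of_continuousOn S.cont T (η := η / 2) (by linarith)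
  have ev1 : ∀ᶠ p in l, |p.1 - σ| < δ :=
    hl ((by fun_prop : ContinuousAt (fun p : ℝ × ℝ => |p.1 - σ|) (σ, σ)).eventually_lt
      continuousAt_const (by simpa using hδ))
  have ev2 : ∀ᶠ p in l, |p.2 - σ| < δ :=
    hl ((by fun_prop : ContinuousAt (fun p : ℝ × ℝ => |p.2 - σ|) (σ, σ)).eventually_lt
      continuousAt_const (by simpa using hδ))
  have ev3 : ∀ᶠ p in l, a p < 1 := ha.eventually (gt_mem_nhds hm.2)
  have ev4 : ∀ᶠ p in l, C * (2 * L) * (a p - h σ) < ε / 2 := by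
    have : Tendsto (fun p => C * (2 * L) * (a p - h σ)) l (𝓝 0) := by
      simpa using (ha.sub_const (h σ)).const_mul (C * (2 * L))
    exact this.eventually (gt_mem_nhds (by linarith))
  filter_upwards [hmem, ev1, ev2, ev3, ev4] with p hp e1 e2 e3 e4
  obtain ⟨m1, m2, m3, m4, m5⟩ := hp
  have haI : a p ∈ Icc (h σ) 1 := ⟨m5.le, e3.le⟩
  have hsub : ∀ t ∈ Icc 0 T, h t ≤ a p → Ioo (a p) 1 ⊆ Ioo (h t) 1 := fun t _ ht =>
    Ioo_subset_Ioo_left ht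
  have hintg : ∀ t ∈ Icc 0 T, ∀ c, h t ≤ c → c ≤ 1 → IntervalIntegrable (fun y => vy t y) volume c 1 := by
    intro t ht c h1 h2
    exact intervalIntegrable_of_hasDerivAt_of_abs_le h2
      (fun y hy => S.space t ht.1 y ⟨h1.trans_lt hy.1, hy.2⟩)
      (fun y hy => hb t ht y ⟨h1.trans_lt hy.1, hy.2⟩)
  have hPa : ContinuousOn P (uIcc (a p) 1) := by
    rw [uIcc_of_le e3.le]; exact hPc.mono (Icc_subset_Icc_left m5.le)
  have i1 : IntervalIntegrable (fun y => P y * (vy p.1 y + vy p.2 y)) volume (a p) 1 :=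
    ((hintg _ m1 _ m3 e3.le).add (hintg _ m2 _ m4 e3.le)).continuousOn_mul hPa
  have i2 : IntervalIntegrable (fun y => P y * (vy σ y + vy σ y)) volume (h σ) 1 :=
    ((hintg _ hσ _ le_rfl hm.2.le).add (hintg _ hσ _ le_rfl hm.2.le)).continuousOn_mul
      (by rwa [uIcc_of_le hm.2.le])
  have i3 : IntervalIntegrable (fun y => P y * (vy σ y + vy σ y)) volume (a p) 1 :=
    ((hintg _ hσ _ m5.le e3.le).add (hintg _ hσ _ m5.le e3.le)).continuousOn_mul hPa
  have i4 : IntervalIntegrable (fun y => P y * (vy σ y + vy σ y)) volume (h σ) (a p) :=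
    i2.trans i3.symm
  have w1 := hweak (a p) haI (fun y => v p.1 y + v p.2 y - (v σ y + v σ y))
    (fun y => vy p.1 y + vy p.2 y - (vy σ y + vy σ y)) ?_ ?_ ?_ ?_
  · have w2 : |∫ y in h σ..a p, P y * (vy σ y + vy σ y)| ≤ C * (2 * L) * (a p - h σ) := by
      refine abs_integral_le_of_forall_mem_Ioo m5.le fun y hy => ?_
      rw [abs_mul]
      refine mul_le_mul (hC y ⟨hy.1.le, (hy.2.trans e3).le⟩) ?_ (abs_nonneg _) hC0
      have := hb σ hσ y ⟨hy.1, hy.2.trans e3⟩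
      exact (abs_add_le _ _).trans (by linarith)
    have w3 : ∫ y in a p..1, P y * (vy p.1 y + vy p.2 y - (vy σ y + vy σ y))
        = (∫ y in a p..1, P y * (vy p.1 y + vy p.2 y)) - ∫ y in a p..1, P y * (vy σ y + vy σ y) := by
      rw [← intervalIntegral.integral_sub i1 i3]
      exact intervalIntegral.integral_congr fun y _ => by ring
    have w4 := intervalIntegral.integral_add_adjacent_intervals i4 i3
    rw [Real.dist_eq, hcongr _ _ m5.le e3.le, hcongr _ _ le_rfl hm.2.le]
    have b1 := abs_le.1 w1
    have b2 := abs_le.1 w2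
    rw [abs_lt]
    constructor <;> linarith [b1.1, b1.2, b2.1, b2.2]
  · have hsl : ∀ t ∈ Icc 0 T, ContinuousOn (fun y => v t y) (Icc (a p) 1) := fun t ht =>
      (S.cont_slice ht.1).mono (Icc_subset_Icc_left (hm.1.le.trans m5.le))
    exact ((hsl _ m1).add (hsl _ m2)).sub ((hsl _ hσ).add (hsl _ hσ))
  · intro y hy
    have d0 := S.space σ hσ.1 y (hsub σ hσ m5.le hy)
    exact ((S.space _ m1.1 y (hsub _ m1 m3 hy)).add (S.space _ m2.1 y (hsub _ m2 m4 hy))).sub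
      (d0.add d0)
  · intro y hy
    have c0 := abs_le.1 (hb σ hσ y (hsub σ hσ m5.le hy))
    have c1 := abs_le.1 (hb _ m1 y (hsub _ m1 m3 hy))
    have c2 := abs_le.1 (hb _ m2 y (hsub _ m2 m4 hy))
    rw [abs_le]
    constructor <;> linarith [c0.1, c0.2, c1.1, c1.2, c2.1, c2.2]
  · intro y hy
    have hy' : y ∈ Icc (-1 : ℝ) 1 := ⟨by linarith [hy.1, hm.1], hy.2⟩
    have c1 := abs_le.1 (hunif _ m1 σ hσ e1 y hy')
    have c2 := abs_le.1 (hunif _ m2 σ hσ e2 y hy')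
    rw [abs_le]
    constructor <;> linarith [c1.1, c1.2, c2.1, c2.2]

theorem hasIncrementDensity (S : IsRightSide v vt vy vyy h g g' q) {H : ℝ} (hT : 0 < T)
    (hH : ∀ t ∈ Icc 0 T, |g t| ≤ H) :
    ∃ δ > 0, (∀ s t, 0 ≤ s → s < t → t ≤ T → t - s ≤ δ → h s + (H + 1) * (t - s) < 1) ∧
    HasIncrementDensity (fun s t => ∫ y in (h s + (H + 1) * (t - s))..1, (v t y ^ 2 - v s y ^ 2))
      (fun σ => -2 * g σ * q σ + 2 / 3 * g σ ^ 3 - 2 * ∫ y in h σ..1, vy σ y ^ 2) T ∧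
    ∀ σ ∈ Icc 0 T, IntervalIntegrable (fun y => vy σ y ^ 2) volume (h σ) 1 := by
  have hH0 : 0 ≤ H := (abs_nonneg _).trans (hH 0 ⟨le_rfl, hT.le⟩)
  obtain ⟨L, hL, hlip⟩ := S.exists_lipschitz hT.le
  have hb : ∀ t ∈ Icc 0 T, ∀ y ∈ Ioo (h t) 1, |vy t y| ≤ L := fun t ht y hy =>
    S.abs_space_le ht.1 hL (hlip t ht) hy
  have hc : ContinuousOn (fun p : ℝ × ℝ => v p.1 p.2) (Icc 0 T ×ˢ Icc (-1) 1) :=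
    S.cont.mono (prod_mono_left Icc_subset_Ici_self)
  obtain ⟨B, hB⟩ := (isCompact_Icc.prod isCompact_Icc).exists_bound_of_continuousOn hc
  have hB' : ∀ t ∈ Icc 0 T, ∀ y ∈ Icc (-1 : ℝ) 1, |v t y| ≤ B := fun t ht y hy => hB (t, y) ⟨ht, hy⟩
  have hB0 : 0 ≤ B := (abs_nonneg _).trans
    (hB' 0 ⟨le_rfl, hT.le⟩ 0 ⟨by norm_num, by norm_num⟩)
  have hhc : Continuous h := continuous_iff_continuousAt.2 fun t => (S.deriv_pos t).continuousAt
  obtain ⟨s₀, hs₀, hmax⟩ := isCompact_Icc.exists_isMaxOn ⟨0, ⟨le_rfl, hT.le⟩⟩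
    (hhc.continuousOn (s := Icc 0 T))
  have hroom : ∀ t ∈ Icc 0 T, h t ≤ h s₀ := fun t ht => hmax ht
  have hm₀ := (S.mem s₀ hs₀.1).2
  have hH1 : 0 < H + 1 := by linarith
  set δ := (1 - h s₀) / 2 / (H + 1) with hδ
  have hδ0 : 0 < δ := div_pos (by linarith) hH1
  have hlt1 : ∀ s t, 0 ≤ s → s < t → t ≤ T → t - s ≤ δ → h s + (H + 1) * (t - s) < 1 := by
    intro s t hs hst ht hd
    have h1 := hroom s ⟨hs, by linarith⟩
    have h2 : (H + 1) * (t - s) ≤ (H + 1) * δ := mul_le_mul_of_nonneg_left hd hH1.le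
    have h3 : (H + 1) * δ = (1 - h s₀) / 2 := mul_div_cancel₀ _ hH1.ne'
    linarith
  have hla : ∀ s t σ, 0 ≤ s → s < t → t ≤ T → σ ∈ Icc s t → h σ < h s + (H + 1) * (t - s) := by
    intro s t σ hs hst ht hσ
    have h1 := (abs_le.1 (S.abs_pos_sub_le hH (s := σ) (t := s) ⟨by linarith [hσ.1], by
      linarith [hσ.2]⟩ ⟨hs, by linarith⟩)).2
    rw [abs_of_nonneg (sub_nonneg.2 hσ.1)] at h1
    linarith [mul_le_mul_of_nonneg_left hσ.2 hH0]
  have hvyi : ∀ t ∈ Icc 0 T, IntervalIntegrable (fun y => vy t y) volume (h t) 1 := fun t ht =>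
    intervalIntegrable_of_hasDerivAt_of_abs_le (S.mem t ht.1).2.le (S.space t ht.1) (hb t ht)
  have hvy2 : ∀ t ∈ Icc 0 T, IntervalIntegrable (fun y => vy t y ^ 2) volume (h t) 1 := by
    intro t ht
    obtain ⟨P, hPc, hP⟩ := S.exists_continuousOn_space ht.1
    have hm := (S.mem t ht.1).2.le
    refine (ContinuousOn.intervalIntegrable (u := fun y => P y ^ 2)
      (by rw [uIcc_of_le hm]; exact hPc.pow 2)).congr_ae ?_
    rw [EventuallyEq, ae_restrict_iff' measurableSet_uIoc]
    exact ae_uIoc_of_forall_mem_Ioo hm fun y hy => by rw [hP y hy]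
  refine ⟨δ, hδ0, hlt1, ⟨δ, hδ0, (L + B ^ 2 / 2) * (2 * B) + (L + B ^ 2 / 2) * (2 * L) * 2,
    fun s t σ => -(vy σ (h s + (H + 1) * (t - s)) - v σ (h s + (H + 1) * (t - s)) ^ 2 / 2)
        * (v s (h s + (H + 1) * (t - s)) + v t (h s + (H + 1) * (t - s)))
      - ∫ y in (h s + (H + 1) * (t - s))..1, (vy σ y - v σ y ^ 2 / 2) * (vy s y + vy t y),
    ?_, ?_⟩, hvy2⟩
  · intro s t hs hst ht hd
    have ha1 := hlt1 s t hs hst ht hd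
    have hss : s ∈ Icc 0 T := ⟨hs, by linarith⟩
    have htt : t ∈ Icc 0 T := ⟨by linarith, ht⟩
    have hla' := fun σ hσ => hla s t σ hs hst ht hσ
    have ha0 : h s + H * (t - s) < h s + (H + 1) * (t - s) := by linarith
    set a := h s + (H + 1) * (t - s) with ha
    have hsa := hla' s ⟨le_rfl, hst.le⟩
    have hta := hla' t ⟨hst.le, le_rfl⟩
    have hma : -1 ≤ a := by linarith [(S.mem s hs).1]
    have hφM : ∀ y ∈ Ioo a 1, |vy s y + vy t y| ≤ 2 * L := fun y hy =>
      (abs_add_le _ _).trans (by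
        linarith [hb s hss y ⟨hsa.trans hy.1, hy.2⟩, hb t htt y ⟨hta.trans hy.1, hy.2⟩])
    obtain ⟨i1, i2⟩ := (S.isBurgersOn hH hlip hs hst ht).integral_mul_test hst ha0 ha1
      (φ := fun y => v s y + v t y) (φ' := fun y => vy s y + vy t y) (M := 2 * L)
      (((S.cont_slice hs).mono (Icc_subset_Icc_left hma)).add
        ((S.cont_slice htt.1).mono (Icc_subset_Icc_left hma)))
      (fun y hy => (S.space s hs y ⟨hsa.trans hy.1, hy.2⟩).add
        (S.space t htt.1 y ⟨hta.trans hy.1, hy.2⟩)) hφM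
      (by simp only [S.wall s hs, S.wall t htt.1, add_zero])
    refine ⟨i1, ?_, ?_⟩
    · rw [← i2]
      exact intervalIntegral.integral_congr fun y _ => by ring
    · intro σ hσ
      have hσT : σ ∈ Icc 0 T := ⟨hs.trans hσ.1, (hσ.2.trans_le ht).le⟩
      have hσa := hla' σ ⟨hσ.1, hσ.2.le⟩
      have hJ : ∀ y ∈ Ico a 1, |vy σ y - v σ y ^ 2 / 2| ≤ L + B ^ 2 / 2 := by
        intro y hy
        have h1 := abs_le.1 (hb σ hσT y ⟨hσa.trans_le hy.1, hy.2⟩)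
        have h2 := abs_le.1 (hB' σ hσT y ⟨hma.trans hy.1, hy.2.le⟩)
        have h3 := sq_le_sq' h2.1 h2.2
        rw [abs_le]
        constructor <;> linarith [sq_nonneg (v σ y), h1.1, h1.2]
      have hJ0 : 0 ≤ L + B ^ 2 / 2 := by positivity
      have k1 : |-(vy σ a - v σ a ^ 2 / 2) * (v s a + v t a)| ≤ (L + B ^ 2 / 2) * (2 * B) := by
        rw [abs_mul, abs_neg]
        refine mul_le_mul (hJ a ⟨le_rfl, ha1⟩) ?_ (abs_nonneg _) hJ0
        exact (abs_add_le _ _).trans (by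
          linarith [hB' s hss a ⟨hma, ha1.le⟩, hB' t htt a ⟨hma, ha1.le⟩])
      have k2 : |∫ y in a..1, (vy σ y - v σ y ^ 2 / 2) * (vy s y + vy t y)|
          ≤ (L + B ^ 2 / 2) * (2 * L) * (1 - a) := by
        refine abs_integral_le_of_forall_mem_Ioo ha1.le fun y hy => ?_
        rw [abs_mul]
        exact mul_le_mul (hJ y ⟨hy.1.le, hy.2⟩) (hφM y hy) (abs_nonneg _) hJ0
      have k3 : (L + B ^ 2 / 2) * (2 * L) * (1 - a) ≤ (L + B ^ 2 / 2) * (2 * L) * 2 :=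
        mul_le_mul_of_nonneg_left (by linarith) (by positivity)
      exact (abs_sub _ _).trans (by linarith)
  · intro σ hσ
    have hσT : σ ∈ Icc 0 T := Ioo_subset_Icc_self hσ
    have hm := S.mem σ hσ.1.le
    set l := 𝓝[{p : ℝ × ℝ | 0 ≤ p.1 ∧ p.1 ≤ σ ∧ σ < p.2 ∧ p.2 ≤ T}] (σ, σ) with hl
    have hll : l ≤ 𝓝 (σ, σ) := nhdsWithin_le_nhds
    set a : ℝ × ℝ → ℝ := fun p => h p.1 + (H + 1) * (p.2 - p.1) with ha
    have hac : Tendsto a l (𝓝 (h σ)) := by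
      have : Continuous a := by simp only [ha]; fun_prop
      have := this.tendsto (σ, σ)
      simp only [ha, sub_self, mul_zero, add_zero] at this
      exact this.mono_left hll
    have hset : ∀ᶠ p in l, 0 ≤ p.1 ∧ p.1 ≤ σ ∧ σ < p.2 ∧ p.2 ≤ T := self_mem_nhdsWithin
    have hag : ∀ᶠ p in l, h σ < a p := hset.mono fun p hp =>
      hla p.1 p.2 σ hp.1 (by linarith) hp.2.2.2 ⟨hp.2.1, hp.2.2.1.le⟩
    have hagt : Tendsto a l (𝓝[>] (h σ)) := tendsto_nhdsWithin_iff.2 ⟨hac, hag⟩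
    have t1 : Tendsto (fun p => vy σ (a p)) l (𝓝 (q σ)) := (S.space_lim σ hσ.1.le).comp hagt
    have hvc : Tendsto (fun p : ℝ × ℝ => v p.1 p.2) (𝓝 (σ, h σ)) (𝓝 (g σ)) := by
      have := (S.cont.continuousAt (x := (σ, h σ))
        (prod_mem_nhds (Ici_mem_nhds hσ.1) (Icc_mem_nhds hm.1 hm.2))).tendsto
      simpa only [S.particle σ hσ.1.le] using this
    have t2 : Tendsto (fun p => v σ (a p)) l (𝓝 (g σ)) :=
      hvc.comp ((tendsto_const_nhds (x := σ)).prodMk_nhds hac)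
    have t3 : Tendsto (fun p : ℝ × ℝ => v p.1 (a p)) l (𝓝 (g σ)) :=
      hvc.comp (((continuous_fst.tendsto (σ, σ)).mono_left hll).prodMk_nhds hac)
    have t4 : Tendsto (fun p : ℝ × ℝ => v p.2 (a p)) l (𝓝 (g σ)) :=
      hvc.comp (((continuous_snd.tendsto (σ, σ)).mono_left hll).prodMk_nhds hac)
    have t5 := S.tendsto_integral_flux_mul hL hb hσT hll (a := a) (by
      filter_upwards [hset, hag] with p hp hp'
      have hlt : p.1 < p.2 := by linarith
      exact ⟨⟨hp.1, by linarith⟩, ⟨by linarith, hp.2.2.2⟩,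
        (hla p.1 p.2 p.1 hp.1 hlt hp.2.2.2 ⟨le_rfl, hlt.le⟩).le,
        (hla p.1 p.2 p.2 hp.1 hlt hp.2.2.2 ⟨hlt.le, le_rfl⟩).le, hp'⟩) hac
    have t6 := (((t1.sub ((t2.pow 2).div_const 2)).neg).mul (t3.add t4)).sub t5
    have e1 : ∫ y in h σ..1, (vy σ y - v σ y ^ 2 / 2) * (vy σ y + vy σ y)
        = 2 * (∫ y in h σ..1, vy σ y ^ 2) + g σ ^ 3 / 3 := by
      have j1 := hvyi σ hσT
      have j2 : IntervalIntegrable (fun y => v σ y ^ 2 * vy σ y) volume (h σ) 1 :=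
        j1.continuousOn_mul (by
          rw [uIcc_of_le hm.2.le]
          exact ((S.cont_slice hσ.1.le).mono (Icc_subset_Icc_left hm.1.le)).pow 2)
      have j3 := S.integral_sq_mul_space hσ.1.le j1
      rw [show g σ ^ 3 / 3 = -(∫ y in h σ..1, v σ y ^ 2 * vy σ y) by rw [j3]; ring,
        ← intervalIntegral.integral_const_mul, ← sub_eq_add_neg,
        ← intervalIntegral.integral_sub ((hvy2 σ hσT).const_mul 2) j2]
      exact intervalIntegral.integral_congr fun y _ => by ring
    rw [e1] at t6
    convert t6 using 2
    ring

end IsRightSide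

namespace FluidParticleSol

variable {K h₁ : ℝ}

theorem hasDerivAt_pos (S : FluidParticleSol K h₁) (t : ℝ) : HasDerivAt S.h (deriv S.h t) t :=
  (S.h_C2.differentiable (by norm_num) t).hasDerivAt

theorem contDiff_deriv_pos (S : FluidParticleSol K h₁) : ContDiff ℝ 1 (deriv S.h) :=
  (contDiff_succ_iff_deriv.1 (show ContDiff ℝ (1 + 1) S.h by
    simpa only [one_add_one_eq_two] using S.h_C2)).2.2

theorem hasDerivAt_vel (S : FluidParticleSol K h₁) (t : ℝ) :
    HasDerivAt (deriv S.h) (deriv (deriv S.h) t) t :=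
  (S.contDiff_deriv_pos.differentiable one_ne_zero t).hasDerivAt

theorem continuous_acc (S : FluidParticleSol K h₁) : Continuous (deriv (deriv S.h)) :=
  S.contDiff_deriv_pos.continuous_deriv le_rfl

theorem isRightSide (S : FluidParticleSol K h₁) :
    IsRightSide S.v S.vt S.vy S.vyy S.h (deriv S.h) (deriv (deriv S.h)) S.vyR where
  mem := S.h_in
  deriv_pos := S.hasDerivAt_pos
  deriv_vel := S.hasDerivAt_vel
  cont_acc := S.continuous_acc
  cont := S.v_cont
  time t ht y hy := S.hasDeriv_t t ht y ⟨((S.h_in t ht).1.trans hy.1).le, hy.2.le⟩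
  space t ht y hy := S.hasDeriv_y t ht y ⟨(S.h_in t ht).1.trans hy.1, hy.2⟩ hy.1.ne'
  space₂ t ht y hy := S.hasDeriv_yy t ht y ⟨(S.h_in t ht).1.trans hy.1, hy.2⟩ hy.1.ne'
  pde t ht y hy := S.pde t ht y ⟨(S.h_in t ht).1.trans hy.1, hy.2⟩ hy.1.ne'
  space_cont := S.vy_contR
  space_lim := S.vy_limR
  wall := S.bc_right
  particle t ht := (S.ode1 t ht).symm

/-- The fluid on the left of the particle, seen from the right after the reflection `y ↦ -y`. -/
theorem isRightSide_reflect (S : FluidParticleSol K h₁) :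
    IsRightSide (fun t y => -S.v t (-y)) (fun t y => -S.vt t (-y)) (fun t y => S.vy t (-y))
      (fun t y => -S.vyy t (-y)) (fun t => -S.h t) (fun t => -deriv S.h t)
      (fun t => -deriv (deriv S.h) t) S.vyL := by
  have key : ∀ t, 0 ≤ t → ∀ y ∈ Ioo (-S.h t) 1, -y ∈ Ioo (-1) (S.h t) :=
    fun t _ y hy => ⟨by linarith [hy.2], by linarith [hy.1]⟩
  refine
    { mem := fun t ht => ⟨by linarith [(S.h_in t ht).2], by linarith [(S.h_in t ht).1]⟩
      deriv_pos := fun t => (S.hasDerivAt_pos t).neg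
      deriv_vel := fun t => (S.hasDerivAt_vel t).neg
      cont_acc := S.continuous_acc.neg
      cont := ?_
      time := fun t ht y hy => ?_
      space := fun t ht y hy => ?_
      space₂ := fun t ht y hy => ?_
      pde := fun t ht y hy => ?_
      space_cont := fun t ht => ?_
      space_lim := fun t ht => ?_
      wall := fun t ht => by simpa using S.bc_left t ht
      particle := fun t ht => by simpa using (S.ode1 t ht).symm }
  · refine (S.v_cont.comp (f := fun p : ℝ × ℝ => (p.1, -p.2)) (by fun_prop) ?_).neg
    rintro ⟨t, y⟩ ⟨ht, hy⟩
    exact ⟨ht, by linarith [hy.2], by linarith [hy.1]⟩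
  · have h := key t ht y hy
    exact (S.hasDeriv_t t ht (-y) ⟨h.1.le, (h.2.trans (S.h_in t ht).2).le⟩).neg
  · have h := key t ht y hy
    have := ((S.hasDeriv_y t ht (-y) ⟨h.1, h.2.trans (S.h_in t ht).2⟩ h.2.ne).comp y
      (hasDerivAt_neg y)).neg
    exact this.congr_deriv (by ring)
  · have h := key t ht y hy
    have := (S.hasDeriv_yy t ht (-y) ⟨h.1, h.2.trans (S.h_in t ht).2⟩ h.2.ne).comp y
      (hasDerivAt_neg y)
    exact this.congr_deriv (by ring)
  · have h := key t ht y hy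
    have := S.pde t ht (-y) ⟨h.1, h.2.trans (S.h_in t ht).2⟩ h.2.ne
    linarith
  · exact (S.vy_contL t ht).comp continuousOn_neg
      fun y hy => ⟨by linarith [hy.2], by linarith [hy.1]⟩
  · refine (S.vy_limL t ht).comp ?_
    rw [show S.h t = -(-S.h t) by ring]
    simpa using tendsto_neg_nhdsGT (a := -S.h t)

/-- Density of the kinetic energy of the fluid. -/
theorem hasIncrementDensity_energy (S : FluidParticleSol K h₁) {T : ℝ} (hT : 0 < T) :
    HasIncrementDensity
      (fun s t => (∫ y in (-1 : ℝ)..1, S.v t y ^ 2) - ∫ y in (-1 : ℝ)..1, S.v s y ^ 2)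
      (fun σ => -(2 * deriv S.h σ * (S.vyR σ - S.vyL σ))
        - 2 * ∫ y in (-1 : ℝ)..1, S.vy σ y ^ 2) T := by
  have hslice : ∀ t, 0 ≤ t → ContinuousOn (fun y => S.v t y) (Icc (-1) 1) :=
    fun t ht => S.isRightSide.cont_slice ht
  obtain ⟨H, hH⟩ := isCompact_Icc.exists_bound_of_continuousOn
    (S.contDiff_deriv_pos.continuous.continuousOn (s := Icc 0 T))
  have hH0 : 0 ≤ H := (norm_nonneg _).trans (hH 0 ⟨le_rfl, hT.le⟩)
  obtain ⟨δ₁, hδ₁, room₁, dens₁, int₁⟩ := S.isRightSide.hasIncrementDensity hT hH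
  obtain ⟨δ₂, hδ₂, room₂, dens₂, int₂⟩ := S.isRightSide_reflect.hasIncrementDensity (H := H) hT
    fun t ht => by simpa using hH t ht
  obtain ⟨B, hB⟩ := (isCompact_Icc.prod isCompact_Icc).exists_bound_of_continuousOn
    (S.v_cont.mono (show Icc 0 T ×ˢ Icc (-1 : ℝ) 1 ⊆ _ from prod_mono Icc_subset_Ici_self le_rfl))
  have hB' : ∀ t ∈ Icc 0 T, ∀ y ∈ Icc (-1 : ℝ) 1, |S.v t y| ≤ B := fun t ht y hy =>
    hB (t, y) ⟨ht, hy⟩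
  have hB0 : 0 ≤ B := (abs_nonneg _).trans (hB' 0 ⟨le_rfl, hT.le⟩ 0 (by norm_num))
  have strip : HasIncrementDensity (fun s t => ∫ y in (S.h s - (H + 1) * (t - s))..
      (S.h s + (H + 1) * (t - s)), (S.v t y ^ 2 - S.v s y ^ 2)) (fun _ => 0) T := by
    refine HasIncrementDensity.of_isLittleO fun ε hε => ?_
    have hc : 0 < 4 * (H + 1) * (B + 1) := by positivity
    obtain ⟨δ, hδ, hun⟩ := exists_abs_sub_le_of_continuousOn S.v_cont T (div_pos hε hc)
    refine ⟨min (δ / 2) (min δ₁ δ₂), by positivity, fun s t hs hst htT hle => ?_⟩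
    obtain ⟨hle0, hle'⟩ := le_min_iff.1 hle
    obtain ⟨hle1, hle2⟩ := le_min_iff.1 hle'
    have r1 := room₁ s t hs hst htT hle1
    have r2 := room₂ s t hs hst htT hle2
    have hκ : 0 < (H + 1) * (t - s) := mul_pos (by linarith) (by linarith)
    have hsm : s ∈ Icc 0 T := ⟨hs, by linarith⟩
    have htm : t ∈ Icc 0 T := ⟨by linarith, htT⟩
    refine (abs_integral_le_of_forall_mem_Ioo (C := ε / (4 * (H + 1) * (B + 1)) * (2 * (B + 1)))
      (by linarith) fun y hy => ?_).trans (le_of_eq ?_)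
    · have hy' : y ∈ Icc (-1 : ℝ) 1 := ⟨by linarith [hy.1], by linarith [hy.2]⟩
      rw [sq_sub_sq, mul_comm, abs_mul]
      refine mul_le_mul (hun t htm s hsm ?_ y hy') ?_ (abs_nonneg _) (by positivity)
      · rw [abs_of_pos (by linarith)]
        linarith
      · linarith [abs_add_le (S.v t y) (S.v s y), hB' t htm y hy', hB' s hsm y hy']
    · field_simp
      ring
  refine ((dens₁.add dens₂).add strip |>.congr_of_le (lt_min hδ₁ hδ₂)
    fun s t hs hst htT hle => ?_).congr_density fun σ hσ => ?_
  · obtain ⟨hle1, hle2⟩ := le_min_iff.1 hle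
    have r1 := room₁ s t hs hst htT hle1
    have r2 := room₂ s t hs hst htT hle2
    have hκ : 0 < (H + 1) * (t - s) := mul_pos (by linarith) (by linarith)
    have hsq : ∀ r, 0 ≤ r → ContinuousOn (fun y => S.v r y ^ 2) (Icc (-1) 1) :=
      fun r hr => (hslice r hr).pow 2
    have ht0 : 0 ≤ t := by linarith
    have hI : ∀ a ∈ Icc (-1 : ℝ) 1, ∀ b ∈ Icc (-1 : ℝ) 1,
        IntervalIntegrable (fun y => S.v t y ^ 2 - S.v s y ^ 2) volume a b := fun a ha b hb =>
      (((hsq t ht0).sub (hsq s hs)).mono (uIcc_subset_Icc ha hb)).intervalIntegrable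
    have e1 : (∫ y in (-1 : ℝ)..1, S.v t y ^ 2) - ∫ y in (-1 : ℝ)..1, S.v s y ^ 2
        = ∫ y in (-1 : ℝ)..1, (S.v t y ^ 2 - S.v s y ^ 2) := by
      refine (intervalIntegral.integral_sub ?_ ?_).symm
      · exact ((hsq t ht0).mono (uIcc_of_le (by norm_num)).le).intervalIntegrable
      · exact ((hsq s hs).mono (uIcc_of_le (by norm_num)).le).intervalIntegrable
    have e2 : ∫ y in (-S.h s + (H + 1) * (t - s))..1, ((-S.v t (-y)) ^ 2 - (-S.v s (-y)) ^ 2)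
        = ∫ y in (-1 : ℝ)..(S.h s - (H + 1) * (t - s)), (S.v t y ^ 2 - S.v s y ^ 2) := by
      have := intervalIntegral.integral_comp_neg (a := -S.h s + (H + 1) * (t - s)) (b := 1)
        (fun y => S.v t y ^ 2 - S.v s y ^ 2)
      simp only [neg_sq]
      rw [this]
      congr 1
      ring
    have ma : S.h s - (H + 1) * (t - s) ∈ Icc (-1 : ℝ) 1 := ⟨by linarith, by linarith⟩
    have mb : S.h s + (H + 1) * (t - s) ∈ Icc (-1 : ℝ) 1 := ⟨by linarith, by linarith⟩
    have ml : (-1 : ℝ) ∈ Icc (-1 : ℝ) 1 := by norm_num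
    have mr : (1 : ℝ) ∈ Icc (-1 : ℝ) 1 := by norm_num
    have e3 := intervalIntegral.integral_add_adjacent_intervals (hI _ ml _ ma) (hI _ ma _ mb)
    have e4 := intervalIntegral.integral_add_adjacent_intervals (hI _ ml _ mb) (hI _ mb _ mr)
    rw [e1, e2]
    linarith
  · have hσ' : σ ∈ Icc 0 T := Ioo_subset_Icc_self hσ
    have e := intervalIntegral.integral_comp_neg (a := -S.h σ) (b := 1) fun y => S.vy σ y ^ 2
    have i2 : IntervalIntegrable (fun y => S.vy σ y ^ 2) volume (-1) (S.h σ) := by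
      have := (IntervalIntegrable.iff_comp_neg (by simp)).1 (int₂ σ hσ')
      simpa using this.symm
    have e' := intervalIntegral.integral_add_adjacent_intervals i2 (int₁ σ hσ')
    simp only [neg_neg] at e
    rw [e, ← e']
    ring

end FluidParticleSol

/-- Energy identity for classical solutions of the fluid–particle system. -/
theorem energy_identity {K h₁ : ℝ} (S : FluidParticleSol K h₁) (t : ℝ) (ht : 0 ≤ t) :
    (∫ y in (-1 : ℝ)..1, (S.v t y) ^ 2) + (deriv S.h t) ^ 2 + K * (S.h t - h₁) ^ 2
      + 2 * ∫ σ in (0 : ℝ)..t, (∫ y in (-1 : ℝ)..1, (S.vy σ y) ^ 2)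
    = (∫ y in (-1 : ℝ)..1, (S.v 0 y) ^ 2) + (deriv S.h 0) ^ 2 + K * (S.h 0 - h₁) ^ 2 := by
  rcases ht.eq_or_lt with rfl | hT
  · simp
  obtain ⟨hintg, hflu⟩ := (S.hasIncrementDensity_energy hT).integral_eq hT
  set F : ℝ → ℝ := fun σ => 2 * deriv S.h σ * (deriv (deriv S.h) σ + K * (S.h σ - h₁)) with hF
  have hFc : Continuous F := by
    have := S.contDiff_deriv_pos.continuous
    have := S.continuous_acc
    have := S.h_C2.continuous
    fun_prop
  have hpart : ∫ σ in (0 : ℝ)..t, F σ = (deriv S.h t ^ 2 + K * (S.h t - h₁) ^ 2)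
      - (deriv S.h 0 ^ 2 + K * (S.h 0 - h₁) ^ 2) := by
    refine intervalIntegral.integral_eq_sub_of_hasDerivAt
      (f := fun σ => deriv S.h σ ^ 2 + K * (S.h σ - h₁) ^ 2) (fun σ _ => ?_)
      (hFc.intervalIntegrable _ _)
    refine (((S.hasDerivAt_vel σ).pow 2).add
      ((((S.hasDerivAt_pos σ).sub_const h₁).pow 2).const_mul K)).congr_deriv ?_
    simp only [hF]
    push_cast
    ring
  have hsum := intervalIntegral.integral_add hintg (hFc.intervalIntegrable 0 t)
  have hdiss : ∫ σ in (0 : ℝ)..t, ((-(2 * deriv S.h σ * (S.vyR σ - S.vyL σ))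
        - 2 * ∫ y in (-1 : ℝ)..1, S.vy σ y ^ 2) + F σ)
      = ∫ σ in (0 : ℝ)..t, (-2) * ∫ y in (-1 : ℝ)..1, S.vy σ y ^ 2 := by
    refine intervalIntegral.integral_congr fun σ hσ => ?_
    rw [uIcc_of_le hT.le] at hσ
    simp only [hF]
    rw [S.ode2 σ hσ.1]
    ring
  rw [hdiss, intervalIntegral.integral_const_mul, hflu, hpart] at hsum
  linarith
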